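/- arXiv:math/0106185 — 3 statements merged into one kernel-verified Lean document; each statement's English description precedes it below -/
import Mathlib

section
/- Let K be a field and let q, Q be invertible elements of K such that Q ≠ −q^f for every integer f. Then for every n ≥ 1 the Iwahori–Hecke algebra H_{q,Q}(B_n) is Morita equivalent to the direct sum of K-algebras ⊕_{m=0}^{n} H_q(A_{m−1}) ⊗_K H_q(A_{n−m−1}). -/
/-- The defining relations of the Iwahori--Hecke algebra of type `Bₙ` with generators
`T_0, …, T_{n-1}`, where `T_0` satisfies `(T_0 - α)(T_0 - β) = 0` and the other
generators satisfy `(T_i + 1)(T_i - q) = 0`. -/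
inductive HeckeBRel (K : Type) [Field K] (α β q : K) (n : ℕ) :
    FreeAlgebra K (Fin n) → FreeAlgebra K (Fin n) → Prop
  | quad_zero (i : Fin n) (hi : (i : ℕ) = 0) :
      HeckeBRel K α β q n
        ((FreeAlgebra.ι K i - algebraMap K (FreeAlgebra K (Fin n)) α) *
          (FreeAlgebra.ι K i - algebraMap K (FreeAlgebra K (Fin n)) β)) 0
  | quad (i : Fin n) (hi : 0 < (i : ℕ)) :
      HeckeBRel K α β q n
        ((FreeAlgebra.ι K i + 1) * (FreeAlgebra.ι K i - algebraMap K (FreeAlgebra K (Fin n)) q)) 0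
  | braid_zero (i j : Fin n) (hi : (i : ℕ) = 0) (hj : (j : ℕ) = 1) :
      HeckeBRel K α β q n
        (FreeAlgebra.ι K i * FreeAlgebra.ι K j * FreeAlgebra.ι K i * FreeAlgebra.ι K j)
        (FreeAlgebra.ι K j * FreeAlgebra.ι K i * FreeAlgebra.ι K j * FreeAlgebra.ι K i)
  | braid (i j : Fin n) (hi : 0 < (i : ℕ)) (hij : (j : ℕ) = (i : ℕ) + 1) :
      HeckeBRel K α β q n
        (FreeAlgebra.ι K j * FreeAlgebra.ι K i * FreeAlgebra.ι K j)
        (FreeAlgebra.ι K i * FreeAlgebra.ι K j * FreeAlgebra.ι K i)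
  | comm (i j : Fin n) (hij : (i : ℕ) + 1 < (j : ℕ)) :
      HeckeBRel K α β q n (FreeAlgebra.ι K i * FreeAlgebra.ι K j)
        (FreeAlgebra.ι K j * FreeAlgebra.ι K i)

/-- The Iwahori--Hecke algebra of type `Bₙ`: the quotient of the free algebra on
`T_0, …, T_{n-1}` by the two-sided ideal generated by the defining relations, where
`T_0` satisfies `(T_0 - α)(T_0 - β) = 0`. -/
abbrev HeckeB (K : Type) [Field K] (α β q : K) (n : ℕ) : Type := RingQuot (HeckeBRel K α β q n)
/-- The defining relations of the Iwahori--Hecke algebra of type `A` on `m` generators. -/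
inductive HeckeARel (K : Type) [Field K] (q : K) (m : ℕ) :
    FreeAlgebra K (Fin m) → FreeAlgebra K (Fin m) → Prop
  | quad (i : Fin m) :
      HeckeARel K q m
        ((FreeAlgebra.ι K i + 1) * (FreeAlgebra.ι K i - algebraMap K (FreeAlgebra K (Fin m)) q)) 0
  | braid (i j : Fin m) (hij : (j : ℕ) = (i : ℕ) + 1) :
      HeckeARel K q m
        (FreeAlgebra.ι K j * FreeAlgebra.ι K i * FreeAlgebra.ι K j)
        (FreeAlgebra.ι K i * FreeAlgebra.ι K j * FreeAlgebra.ι K i)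
  | comm (i j : Fin m) (hij : (i : ℕ) + 1 < (j : ℕ)) :
      HeckeARel K q m (FreeAlgebra.ι K i * FreeAlgebra.ι K j)
        (FreeAlgebra.ι K j * FreeAlgebra.ι K i)

/-- The Iwahori--Hecke algebra `H_q(A_{m-1})` of type `A_{m-1}`, with the `m - 1`
generators `T_1, …, T_{m-1}`:  the quotient of the free algebra on these generators by
the two-sided ideal generated by the defining relations.  For `m ≤ 1` this is `K`. -/
abbrev HeckeA (K : Type) [Field K] (q : K) (m : ℕ) : Type := RingQuot (HeckeARel K q (m - 1))
open CategoryTheory in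
/-- Two `K`-algebras are Morita equivalent if their categories of right modules are
equivalent as `K`-linear categories, i.e. there is an equivalence of categories whose
functor is `K`-linear on hom-spaces. -/
def MoritaEquivalentOver (K : Type) [Field K] (A B : Type) [Ring A] [Algebra K A]
    [Ring B] [Algebra K B] : Prop :=
  ∃ e : ModuleCat.{0} Aᵐᵒᵖ ≌ ModuleCat.{0} Bᵐᵒᵖ,
    ∀ (X Y : ModuleCat.{0} Aᵐᵒᵖ) (c : K) (f g : X ⟶ Y),
      e.functor.map (c • f + g) = c • e.functor.map f + e.functor.map g

section FullIdempotent

open CategoryTheory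

variable {A B : Type} [Ring A] [Ring B]

/-- The part `eM` of an `A`-module `M` cut out by the idempotent `e = φ 1`, where `φ : B → A`
is a non-unital ring homomorphism. -/
def cornerSubgroup (φ : B →ₙ+* A) (M : Type) [AddCommGroup M] [Module A M] : AddSubgroup M where
  carrier := {m | φ 1 • m = m}
  add_mem' := by
    intro a b ha hb
    simp only [Set.mem_ofPred_eq] at *
    rw [smul_add, ha, hb]
  zero_mem' := by simp
  neg_mem' := by
    intro a ha
    simp only [Set.mem_ofPred_eq] at *
    rw [smul_neg, ha]

theorem mem_cornerSubgroup {φ : B →ₙ+* A} {M : Type} [AddCommGroup M] [Module A M] {m : M} :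
    m ∈ cornerSubgroup φ M ↔ φ 1 • m = m := Iff.rfl

theorem smul_mem_cornerSubgroup (φ : B →ₙ+* A) {M : Type} [AddCommGroup M] [Module A M]
    (b : B) (m : M) : φ b • m ∈ cornerSubgroup φ M := by
  rw [mem_cornerSubgroup, smul_smul, ← map_mul, one_mul]

instance cornerModule (φ : B →ₙ+* A) (M : Type) [AddCommGroup M] [Module A M] :
    Module B (cornerSubgroup φ M) where
  smul b m := ⟨φ b • m.1, smul_mem_cornerSubgroup φ b m.1⟩
  one_smul m := Subtype.ext m.2
  mul_smul a b m := Subtype.ext (by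
    change φ (a * b) • (m : M) = φ a • φ b • (m : M)
    rw [map_mul, mul_smul])
  smul_zero a := Subtype.ext (smul_zero (φ a))
  smul_add a x y := Subtype.ext (smul_add (φ a) (x : M) (y : M))
  add_smul a b m := Subtype.ext (by
    change φ (a + b) • (m : M) = φ a • (m : M) + φ b • (m : M)
    rw [map_add, add_smul])
  zero_smul m := Subtype.ext (by
    change φ 0 • (m : M) = 0
    rw [map_zero, zero_smul])

theorem coe_smul_corner (φ : B →ₙ+* A) {M : Type} [AddCommGroup M] [Module A M]
    (b : B) (m : cornerSubgroup φ M) : ((b • m : cornerSubgroup φ M) : M) = φ b • (m : M) := rfl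

/-- The functor `M ↦ eM` from `A`-modules to `B`-modules. -/
def cornerFunctor (φ : B →ₙ+* A) : ModuleCat.{0} A ⥤ ModuleCat.{0} B where
  obj M := ModuleCat.of B (cornerSubgroup φ M)
  map {M N} f := ModuleCat.ofHom
    { toFun := fun m => ⟨f.hom (m : M), by
        rw [mem_cornerSubgroup, ← map_smul, mem_cornerSubgroup.1 m.2]⟩
      map_add' := fun x y => Subtype.ext (map_add f.hom (x : M) (y : M))
      map_smul' := fun b x => Subtype.ext (map_smul f.hom (φ b) (x : M)) }

theorem coe_cornerFunctor_map (φ : B →ₙ+* A) {M N : ModuleCat.{0} A} (f : M ⟶ N)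
    (m : cornerSubgroup φ M) :
    (((cornerFunctor φ).map f).hom m : cornerSubgroup φ N).1 = f.hom (m : M) := rfl

/-- The `A`-module of `B`-linear maps `eA → N`, coinduced from the `B`-module `N`. -/
def coindSubgroup (φ : B →ₙ+* A) (N : Type) [AddCommGroup N] [Module B N] :
    AddSubgroup (A →+ N) where
  carrier := {h | ∀ b x, h (φ b * x) = b • h x}
  add_mem' := by
    intro h h' hh hh' b x
    simp [hh b x, hh' b x]
  zero_mem' := by simp
  neg_mem' := by
    intro h hh b x
    simp [hh b x]

instance coindModule (φ : B →ₙ+* A) (N : Type) [AddCommGroup N] [Module B N] :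
    Module A (coindSubgroup φ N) where
  smul a h := ⟨(h : A →+ N).comp (AddMonoidHom.mulRight a), fun b x => by
    simp [mul_assoc, h.2 b (x * a)]⟩
  one_smul h := by
    ext x
    exact congrArg (h : A →+ N) (mul_one x)
  mul_smul a b h := by
    ext x
    exact congrArg (h : A →+ N) (mul_assoc x a b).symm
  smul_zero a := rfl
  smul_add a h h' := rfl
  add_smul a b h := by
    ext x
    exact (congrArg (h : A →+ N) (mul_add x a b)).trans (map_add (h : A →+ N) _ _)
  zero_smul h := by
    ext x
    exact (congrArg (h : A →+ N) (mul_zero x)).trans (map_zero (h : A →+ N))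

theorem coind_smul_apply (φ : B →ₙ+* A) {N : Type} [AddCommGroup N] [Module B N]
    (a : A) (h : coindSubgroup φ N) (x : A) : (a • h).1 x = h.1 (x * a) := rfl

theorem cornerFunctor_faithful (φ : B →ₙ+* A) {ι : Type} (s : Finset ι) (u v : ι → A)
    (huv : ∑ i ∈ s, u i * φ 1 * v i = 1) : (cornerFunctor φ).Faithful where
  map_injective {M N f g} h := by
    ext m
    have key (x : M) : f.hom (φ 1 • x) = g.hom (φ 1 • x) := by
      have := congrArg (fun k => (k.hom ⟨φ 1 • x, smul_mem_cornerSubgroup φ 1 x⟩ :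
        cornerSubgroup φ N).1) h
      simpa only [coe_cornerFunctor_map] using this
    have hm : m = ∑ i ∈ s, u i • φ 1 • v i • m := by
      simp only [smul_smul, ← Finset.sum_smul, ← mul_assoc]
      rw [huv, one_smul]
    rw [hm, map_sum, map_sum]
    refine Finset.sum_congr rfl fun i _ => ?_
    rw [(f.hom.map_smul (u i) _ :), (g.hom.map_smul (u i) _ :), key]

theorem cornerFunctor_full (φ : B →ₙ+* A) (hφ : ∀ a, ∃ b, φ b = φ 1 * a * φ 1)
    {ι : Type} (s : Finset ι) (u v : ι → A)
    (huv : ∑ i ∈ s, u i * φ 1 * v i = 1) : (cornerFunctor φ).Full where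
  map_surjective {M N} h := by
    have he : φ 1 * φ 1 = φ 1 := by rw [← map_mul, one_mul]
    let p (x : M) : cornerSubgroup φ M := ⟨φ 1 • x, smul_mem_cornerSubgroup φ 1 x⟩
    let k (x : cornerSubgroup φ M) : cornerSubgroup φ N := h.hom x
    have kadd (x y) : k (x + y) = k x + k y := map_add h.hom x y
    have ksum (t : Finset ι) (f : ι → cornerSubgroup φ M) :
        k (∑ i ∈ t, f i) = ∑ i ∈ t, k (f i) := map_sum h.hom f t
    have ksmul (b x) : k (b • x) = b • k x := map_smul h.hom b x
    have padd (x y) : p (x + y) = p x + p y := Subtype.ext (smul_add _ _ _)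
    have pcorner (a : A) (x : M) : (k (p (a • φ 1 • x))).1 = φ 1 • a • φ 1 • (k (p x)).1 := by
      obtain ⟨b, hb⟩ := hφ a
      have : p (a • φ 1 • x) = b • p x := Subtype.ext (by
        rw [coe_smul_corner, hb]
        simp only [p, smul_smul]
        rw [mul_assoc (φ 1 * a), he, ← mul_assoc])
      refine (congrArg (fun z => (k z).1) this).trans ?_
      refine (congrArg Subtype.val (ksmul b (p x))).trans ?_
      change φ b • (k (p x)).1 = _
      rw [hb]
      simp only [smul_smul, mul_assoc]
    have kfix (x : cornerSubgroup φ M) : φ 1 • (k x).1 = (k x).1 := (k x).2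
    let F (x : M) : N := ∑ i ∈ s, u i • (k (p (v i • x))).1
    have Fadd (x y : M) : F (x + y) = F x + F y := by
      simp only [F, smul_add, padd, kadd, AddSubgroup.coe_add, Finset.sum_add_distrib]
    have Fe (a : A) (x : M) : F (a • φ 1 • x) = a • φ 1 • (k (p x)).1 := by
      have : ∀ i, u i • (k (p (v i • a • φ 1 • x))).1
          = (u i * φ 1 * v i) • a • φ 1 • (k (p x)).1 := by
        intro i
        rw [smul_smul (v i), pcorner]
        simp only [smul_smul, mul_assoc]
      simp only [F, this]
      rw [← Finset.sum_smul, huv, one_smul]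
    have hsplit (x : M) : x = ∑ i ∈ s, u i • φ 1 • v i • x := by
      simp only [smul_smul, ← Finset.sum_smul, ← mul_assoc]
      rw [huv, one_smul]
    let F' : M →+ N := AddMonoidHom.mk' F Fadd
    have Fsmul (a : A) (x : M) : F (a • x) = a • F x := by
      conv_lhs => rw [hsplit x, Finset.smul_sum]
      change F' _ = _
      rw [map_sum]
      simp only [F', AddMonoidHom.mk'_apply, F, Finset.smul_sum]
      refine Finset.sum_congr rfl fun i _ => ?_
      have := Fe (a * u i) (v i • x)
      rw [mul_smul] at this
      refine this.trans ?_
      rw [mul_smul, kfix]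
    refine ⟨ModuleCat.ofHom { toFun := F, map_add' := Fadd, map_smul' := Fsmul }, ?_⟩
    ext x
    refine Subtype.ext ?_
    have hx : φ 1 • (x : cornerSubgroup φ M).1 = (x : cornerSubgroup φ M).1 :=
      (x : cornerSubgroup φ M).2
    have hp : p (x : cornerSubgroup φ M).1 = x := Subtype.ext hx
    have := Fe 1 (x : cornerSubgroup φ M).1
    rw [one_smul, one_smul, hx, hp] at this
    exact this.trans (kfix x)

theorem cornerFunctor_essSurj (φ : B →ₙ+* A) (hinj : Function.Injective φ)
    (hφ : ∀ a, ∃ b, φ b = φ 1 * a * φ 1) : (cornerFunctor φ).EssSurj where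
  mem_essImage N := by
    have he : φ 1 * φ 1 = φ 1 := by rw [← map_mul, one_mul]
    have hl (b : B) : φ 1 * φ b = φ b := by rw [← map_mul, one_mul]
    have hr (b : B) : φ b * φ 1 = φ b := by rw [← map_mul, mul_one]
    choose r hr' using hφ
    have radd (x y) : r (x + y) = r x + r y := hinj (by
      rw [map_add, hr', hr', hr', mul_add, add_mul])
    have rmul (b x) : r (φ b * x) = b * r x := hinj (by
      rw [map_mul, hr', hr', ← mul_assoc, hl, ← mul_assoc, ← mul_assoc, hr])
    have rφ (b) : r (φ b) = b := hinj (by rw [hr', hl, hr])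
    have re (x) : r (x * φ 1) = r x := hinj (by
      rw [hr', hr', ← mul_assoc, mul_assoc _ (φ 1), he])
    let M : ModuleCat.{0} A := ModuleCat.of A (coindSubgroup φ N)
    let toFun (h : cornerSubgroup φ (coindSubgroup φ N)) : N := h.1.1 1
    let inv (n : N) : cornerSubgroup φ (coindSubgroup φ N) :=
      ⟨⟨AddMonoidHom.mk' (fun x => r x • n) (fun x y => by rw [radd, add_smul]),
        fun b x => by simp [rmul, mul_smul]⟩, by
        rw [mem_cornerSubgroup]
        ext x
        rw [coind_smul_apply]
        simp [re]⟩
    refine ⟨M, ⟨LinearEquiv.toModuleIso (X₁ := cornerSubgroup φ (coindSubgroup φ N)) (X₂ := N)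
      { toFun := toFun
        invFun := inv
        map_add' := fun _ _ => rfl
        map_smul' := fun b h => ?_
        left_inv := fun h => ?_
        right_inv := fun n => ?_ }⟩⟩
    · change (φ b • h.1).1 1 = b • h.1.1 1
      rw [coind_smul_apply, ← h.1.2 b 1, one_mul, mul_one]
    · refine Subtype.ext (Subtype.ext (AddMonoidHom.ext fun x => ?_))
      change r x • h.1.1 1 = h.1.1 x
      have h1 (y : A) : h.1.1 (y * φ 1) = h.1.1 y := by
        rw [← coind_smul_apply, mem_cornerSubgroup.1 h.2]
      have h2 (y : A) : h.1.1 (φ 1 * y) = h.1.1 y := by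
        rw [h.1.2, one_smul]
      rw [← h.1.2, hr', mul_one, h1, h2]
    · change r 1 • n = n
      have : r 1 = 1 := by rw [← rφ 1]; exact hinj (by rw [hr', hr', mul_one, he, hl])
      rw [this, one_smul]

theorem exists_linear_equivalence_of_full_idempotent (K : Type) [Field K] [Algebra K A]
    [Algebra K B] (φ : B →ₙ+* A) (hK : ∀ (c : K) b, φ (c • b) = c • φ b)
    (hinj : Function.Injective φ) (hφ : ∀ a, ∃ b, φ b = φ 1 * a * φ 1)
    {ι : Type} (s : Finset ι) (u v : ι → A) (huv : ∑ i ∈ s, u i * φ 1 * v i = 1) :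
    ∃ e : ModuleCat.{0} A ≌ ModuleCat.{0} B,
      ∀ (X Y : ModuleCat.{0} A) (c : K) (f g : X ⟶ Y),
        e.functor.map (c • f + g) = c • e.functor.map f + e.functor.map g := by
  have := cornerFunctor_faithful φ s u v huv
  have := cornerFunctor_full φ hφ s u v huv
  have := cornerFunctor_essSurj φ hinj hφ
  have : (cornerFunctor φ).IsEquivalence := {}
  refine ⟨(cornerFunctor φ).asEquivalence, fun X Y c f g => ?_⟩
  ext x
  refine Subtype.ext ?_
  change algebraMap K A c • f.hom (x : cornerSubgroup φ X).1 + g.hom (x : cornerSubgroup φ X).1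
    = φ (algebraMap K B c) • f.hom (x : cornerSubgroup φ X).1
      + g.hom (x : cornerSubgroup φ X).1
  have hx : φ 1 • (x : cornerSubgroup φ X).1 = (x : cornerSubgroup φ X).1 :=
    (x : cornerSubgroup φ X).2
  rw [Algebra.algebraMap_eq_smul_one, Algebra.algebraMap_eq_smul_one, hK]
  rw [← hx, map_smul, smul_smul, smul_smul, smul_mul_assoc, one_mul, smul_mul_assoc,
    ← map_mul, one_mul]

/-- A full idempotent `e = φ 1` of `A` gives a Morita equivalence of `A` with `B ≅ eAe`. -/
theorem MoritaEquivalentOver.of_full_idempotent (K : Type) [Field K] [Algebra K A]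
    [Algebra K B] (φ : B →ₙ+* A) (hK : ∀ (c : K) b, φ (c • b) = c • φ b)
    (hinj : Function.Injective φ) (hφ : ∀ a, ∃ b, φ b = φ 1 * a * φ 1)
    {ι : Type} (s : Finset ι) (u v : ι → A) (huv : ∑ i ∈ s, u i * φ 1 * v i = 1) :
    MoritaEquivalentOver K A B := by
  refine exists_linear_equivalence_of_full_idempotent K (NonUnitalRingHom.op φ)
    (fun c b => MulOpposite.unop_injective (hK c b.unop))
    (fun a b h => MulOpposite.unop_injective (hinj (congrArg MulOpposite.unop h)))
    (fun a => ?_) s (fun i => MulOpposite.op (v i)) (fun i => MulOpposite.op (u i)) ?_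
  · obtain ⟨b, hb⟩ := hφ a.unop
    refine ⟨MulOpposite.op b, MulOpposite.unop_injective ?_⟩
    change φ b = φ 1 * (a.unop * φ 1)
    rw [hb, mul_assoc]
  · apply MulOpposite.unop_injective
    rw [Finset.unop_sum, MulOpposite.unop_one, ← huv]
    exact Finset.sum_congr rfl fun i _ => (mul_assoc (u i) (φ 1) (v i)).symm

end FullIdempotent

section Presentations

variable {K : Type} [Field K] {A : Type} [Ring A] [Algebra K A]

/-- The elements `T 1, …, T (n - 1)` satisfy the relations of type `A`. -/
structure IsTypeA (q : K) (n : ℕ) (T : ℕ → A) : Prop where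
  quad : ∀ i, 0 < i → i < n → T i * T i = (q - 1) • T i + q • (1 : A)
  braid : ∀ i, 0 < i → i + 1 < n → T (i + 1) * T i * T (i + 1) = T i * T (i + 1) * T i
  comm : ∀ i j, 0 < i → i + 1 < j → j < n → T i * T j = T j * T i

/-- The elements `T 0, …, T (n - 1)` satisfy the relations of type `B`. -/
structure IsTypeB (q Q : K) (n : ℕ) (T : ℕ → A) : Prop extends IsTypeA q n T where
  quad_zero : 0 < n → T 0 * T 0 = (Q - 1) • T 0 + Q • (1 : A)
  braid_zero : 1 < n → T 0 * T 1 * T 0 * T 1 = T 1 * T 0 * T 1 * T 0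
  comm_zero : ∀ j, 1 < j → j < n → T 0 * T j = T j * T 0

theorem IsTypeB.commute {q Q : K} {n : ℕ} {T : ℕ → A} (h : IsTypeB q Q n T) {i j : ℕ}
    (hij : i + 1 < j) (hj : j < n) : T i * T j = T j * T i := by
  rcases Nat.eq_zero_or_pos i with rfl | hi
  · exact h.comm_zero j (by omega) hj
  · exact h.comm i j hi hij hj

theorem quad_iff (a : A) (c : K) :
    (a + 1) * (a - algebraMap K A c) = 0 ↔ a * a = (c - 1) • a + c • (1 : A) := by
  rw [Algebra.algebraMap_eq_smul_one, ← sub_eq_zero (a := a * a)]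
  have : (a + 1) * (a - c • 1) = a * a - ((c - 1) • a + c • (1 : A)) := by
    rw [add_mul, mul_sub, mul_smul_comm, mul_one, one_mul, sub_smul, one_smul]
    abel
  rw [this]

/-- The generators of the Hecke algebra of type `B`, extended by zero. -/
noncomputable def heckeBGen (q Q : K) (n : ℕ) (i : ℕ) : HeckeB K (-1) Q q n :=
  if h : i < n then RingQuot.mkAlgHom K (HeckeBRel K (-1) Q q n) (FreeAlgebra.ι K ⟨i, h⟩) else 0

theorem heckeBGen_of_lt (q Q : K) {n i : ℕ} (h : i < n) :
    heckeBGen q Q n i =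
      RingQuot.mkAlgHom K (HeckeBRel K (-1) Q q n) (FreeAlgebra.ι K ⟨i, h⟩) := dif_pos h

theorem isTypeB_heckeBGen (q Q : K) (n : ℕ) : IsTypeB q Q n (heckeBGen q Q n) where
  quad i h0 hi := by
    have := RingQuot.mkAlgHom_rel K (HeckeBRel.quad (α := -1) (β := Q) (q := q) ⟨i, hi⟩ h0)
    simp only [map_mul, map_add, map_sub, map_one, map_zero, AlgHom.commutes] at this
    rw [heckeBGen_of_lt q Q hi]
    exact (quad_iff _ _).1 this
  braid i h0 hi := by
    have := RingQuot.mkAlgHom_rel K (HeckeBRel.braid (α := -1) (β := Q) (q := q)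
      ⟨i, by omega⟩ ⟨i + 1, hi⟩ h0 rfl)
    simp only [map_mul] at this
    rw [heckeBGen_of_lt q Q hi, heckeBGen_of_lt q Q (by omega : i < n)]
    exact this
  comm i j h0 hij hj := by
    have := RingQuot.mkAlgHom_rel K (HeckeBRel.comm (α := -1) (β := Q) (q := q)
      ⟨i, by omega⟩ ⟨j, hj⟩ hij)
    simp only [map_mul] at this
    rw [heckeBGen_of_lt q Q hj, heckeBGen_of_lt q Q (by omega : i < n)]
    exact this
  quad_zero hi := by
    have := RingQuot.mkAlgHom_rel K (HeckeBRel.quad_zero (α := -1) (β := Q) (q := q) ⟨0, hi⟩ rfl)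
    simp only [map_mul, map_sub, map_zero, AlgHom.commutes, map_neg, map_one,
      sub_neg_eq_add, map_add] at this
    rw [heckeBGen_of_lt q Q hi]
    exact (quad_iff _ _).1 this
  braid_zero hi := by
    have := RingQuot.mkAlgHom_rel K (HeckeBRel.braid_zero (α := -1) (β := Q) (q := q)
      ⟨0, by omega⟩ ⟨1, hi⟩ rfl rfl)
    simp only [map_mul] at this
    rw [heckeBGen_of_lt q Q hi, heckeBGen_of_lt q Q (by omega : 0 < n)]
    exact this
  comm_zero j hij hj := by
    have := RingQuot.mkAlgHom_rel K (HeckeBRel.comm (α := -1) (β := Q) (q := q)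
      ⟨0, by omega⟩ ⟨j, hj⟩ hij)
    simp only [map_mul] at this
    rw [heckeBGen_of_lt q Q hj, heckeBGen_of_lt q Q (by omega : 0 < n)]
    exact this

theorem exists_heckeB_lift {q Q : K} {n : ℕ} {T : ℕ → A} (h : IsTypeB q Q n T) :
    ∃ f : HeckeB K (-1) Q q n →ₐ[K] A, ∀ i, i < n → f (heckeBGen q Q n i) = T i := by
  let g : FreeAlgebra K (Fin n) →ₐ[K] A := FreeAlgebra.lift K (fun i => T i)
  have hg (i : Fin n) : g (FreeAlgebra.ι K i) = T i := FreeAlgebra.lift_ι_apply _ _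
  have hrel : ∀ ⦃x y⦄, HeckeBRel K (-1) Q q n x y → g x = g y := by
    intro x y hxy
    induction hxy with
    | quad_zero i hi =>
      simp only [map_mul, map_sub, map_zero, AlgHom.commutes, map_neg, map_one,
        sub_neg_eq_add, map_add, hg, hi]
      exact (quad_iff _ _).2 (h.quad_zero (by have := i.2; omega))
    | quad i hi =>
      simp only [map_mul, map_sub, map_zero, AlgHom.commutes, map_add, map_one, hg]
      exact (quad_iff _ _).2 (h.quad i hi i.2)
    | braid_zero i j hi hj =>
      simp only [map_mul, hg, hi, hj]
      exact h.braid_zero (by have := j.2; omega)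
    | braid i j hi hj =>
      simp only [map_mul, hg, hj]
      exact h.braid i hi (by have := j.2; omega)
    | comm i j hij =>
      simp only [map_mul, hg]
      exact h.commute hij j.2
  refine ⟨RingQuot.liftAlgHom K ⟨g, hrel⟩, fun i hi => ?_⟩
  rw [heckeBGen_of_lt q Q hi, RingQuot.liftAlgHom_mkAlgHom_apply, hg]

theorem adjoin_heckeBGen (q Q : K) (n : ℕ) :
    Algebra.adjoin K (heckeBGen q Q n '' Set.Iio n) = ⊤ := by
  have h1 := congrArg (Subalgebra.map (RingQuot.mkAlgHom K (HeckeBRel K (-1) Q q n)))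
    (FreeAlgebra.adjoin_range_ι (R := K) (X := Fin n))
  rw [AlgHom.map_adjoin, Algebra.map_top,
    (AlgHom.range_eq_top _).2 (RingQuot.mkAlgHom_surjective K _)] at h1
  rw [← h1]
  congr 1
  ext x
  constructor
  · rintro ⟨i, hi, rfl⟩
    exact ⟨_, ⟨⟨i, hi⟩, rfl⟩, (heckeBGen_of_lt q Q hi).symm⟩
  · rintro ⟨_, ⟨i, rfl⟩, rfl⟩
    exact ⟨i, i.2, heckeBGen_of_lt q Q i.2⟩

/-- The generators `T 1, …, T (m - 1)` of the Hecke algebra of type `A`, extended by zero. -/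
noncomputable def heckeAGen (q : K) (m : ℕ) (i : ℕ) : HeckeA K q m :=
  if h : i - 1 < m - 1 then
    RingQuot.mkAlgHom K (HeckeARel K q (m - 1)) (FreeAlgebra.ι K ⟨i - 1, h⟩) else 0

theorem heckeAGen_succ (q : K) {m i : ℕ} (h : i < m - 1) :
    heckeAGen q m (i + 1) =
      RingQuot.mkAlgHom K (HeckeARel K q (m - 1)) (FreeAlgebra.ι K ⟨i, h⟩) := dif_pos h

theorem isTypeA_heckeAGen (q : K) (m : ℕ) : IsTypeA q m (heckeAGen q m) where
  quad i h0 hi := by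
    obtain ⟨i, rfl⟩ := Nat.exists_eq_succ_of_ne_zero h0.ne'
    have := RingQuot.mkAlgHom_rel K (HeckeARel.quad (q := q) (m := m - 1) ⟨i, by omega⟩)
    simp only [map_mul, map_add, map_sub, map_one, map_zero, AlgHom.commutes] at this
    rw [Nat.succ_eq_add_one, heckeAGen_succ q (by omega)]
    exact (quad_iff _ _).1 this
  braid i h0 hi := by
    obtain ⟨i, rfl⟩ := Nat.exists_eq_succ_of_ne_zero h0.ne'
    have := RingQuot.mkAlgHom_rel K (HeckeARel.braid (q := q) (m := m - 1)
      ⟨i, by omega⟩ ⟨i + 1, by omega⟩ rfl)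
    simp only [map_mul] at this
    rw [Nat.succ_eq_add_one, heckeAGen_succ q (by omega), heckeAGen_succ q (by omega)]
    exact this
  comm i j h0 hij hj := by
    obtain ⟨i, rfl⟩ := Nat.exists_eq_succ_of_ne_zero h0.ne'
    obtain ⟨j, rfl⟩ := Nat.exists_eq_succ_of_ne_zero (by omega : j ≠ 0)
    have := RingQuot.mkAlgHom_rel K (HeckeARel.comm (q := q) (m := m - 1)
      ⟨i, by omega⟩ ⟨j, by omega⟩ (by simp; omega))
    simp only [map_mul] at this
    rw [Nat.succ_eq_add_one, Nat.succ_eq_add_one, heckeAGen_succ q (by omega),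
      heckeAGen_succ q (by omega)]
    exact this

theorem exists_heckeA_lift {q : K} {m : ℕ} {T : ℕ → A} (h : IsTypeA q m T) :
    ∃ f : HeckeA K q m →ₐ[K] A, ∀ i, 0 < i → i < m → f (heckeAGen q m i) = T i := by
  let g : FreeAlgebra K (Fin (m - 1)) →ₐ[K] A := FreeAlgebra.lift K (fun i => T (i + 1))
  have hg (i : Fin (m - 1)) : g (FreeAlgebra.ι K i) = T (i + 1) := FreeAlgebra.lift_ι_apply _ _
  have hrel : ∀ ⦃x y⦄, HeckeARel K q (m - 1) x y → g x = g y := by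
    intro x y hxy
    induction hxy with
    | quad i =>
      simp only [map_mul, map_sub, map_zero, AlgHom.commutes, map_add, map_one, hg]
      exact (quad_iff _ _).2 (h.quad _ (by omega) (by have := i.2; omega))
    | braid i j hj =>
      simp only [map_mul, hg, hj]
      exact h.braid _ (by omega) (by have := j.2; omega)
    | comm i j hij =>
      simp only [map_mul, hg]
      exact h.comm _ _ (by omega) (by omega) (by have := j.2; omega)
  refine ⟨RingQuot.liftAlgHom K ⟨g, hrel⟩, fun i h0 hi => ?_⟩
  obtain ⟨i, rfl⟩ := Nat.exists_eq_succ_of_ne_zero h0.ne'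
  rw [Nat.succ_eq_add_one, heckeAGen_succ q (by omega), RingQuot.liftAlgHom_mkAlgHom_apply, hg]

theorem adjoin_heckeAGen (q : K) (m : ℕ) :
    Algebra.adjoin K (heckeAGen q m '' Set.Ioo 0 m) = ⊤ := by
  have h1 := congrArg (Subalgebra.map (RingQuot.mkAlgHom K (HeckeARel K q (m - 1))))
    (FreeAlgebra.adjoin_range_ι (R := K) (X := Fin (m - 1)))
  rw [AlgHom.map_adjoin, Algebra.map_top,
    (AlgHom.range_eq_top _).2 (RingQuot.mkAlgHom_surjective K _)] at h1
  rw [← h1]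
  congr 1
  ext x
  constructor
  · rintro ⟨i, ⟨h0, hi⟩, rfl⟩
    obtain ⟨i, rfl⟩ := Nat.exists_eq_succ_of_ne_zero h0.ne'
    exact ⟨_, ⟨⟨i, by omega⟩, rfl⟩, (heckeAGen_succ q (by omega)).symm⟩
  · rintro ⟨_, ⟨i, rfl⟩, rfl⟩
    exact ⟨i + 1, ⟨by omega, by have := i.2; omega⟩, heckeAGen_succ q i.2⟩

end Presentations

section LowerBound

variable {K : Type} [Field K] {A : Type} [Ring A] [Algebra K A]

/-- The function underlying `cosetOp`. -/
def cosetFun (q Q : K) (N : ℕ) (t : ℕ → A) (i : ℕ) (f : ℕ → A) (k : ℕ) : A :=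
  if 2 * N + 1 < k then -f k
  else if k + i = N ∨ k = N + i then (if i = 0 then Q else q) • f (k + 1)
  else if k + i = N + 1 ∨ k = N + i + 1 then
    f (k - 1) + ((if i = 0 then Q else q) - 1) • f k
  else if N + 1 < k + i ∧ k < N + i then t (i - 1) * f k
  else t i * f k

/-- The action of the generators `T 0, …, T N` of the Hecke algebra of type `B_{N+1}` on itself,
as a free module over the Hecke algebra of type `B_N` with basis the `2 N + 2` distinguished coset
representatives; the representatives are indexed by `0, …, 2 N + 1`. -/
def cosetOp (q Q : K) (N : ℕ) (t : ℕ → A) (i : ℕ) : Module.End K (ℕ → A) where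
  toFun := cosetFun q Q N t i
  map_add' f g := by
    ext k
    simp only [cosetFun, Pi.add_apply]
    split_ifs <;> simp only [smul_add, mul_add, neg_add] <;> abel
  map_smul' c f := by
    ext k
    simp only [cosetFun, Pi.smul_apply, RingHom.id_apply]
    split_ifs <;> simp only [smul_add, mul_smul_comm, smul_neg, smul_comm c]

variable {q Q : K} {N : ℕ} {t : ℕ → A} {i : ℕ}

theorem cosetOp_lower {k : ℕ} (hi : i ≤ N) (h : k + i = N ∨ k = N + i) (f : ℕ → A) :
    cosetOp q Q N t i f k = (if i = 0 then Q else q) • f (k + 1) := by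
  change cosetFun q Q N t i f k = _
  rw [cosetFun, if_neg (by omega), if_pos h]

theorem cosetOp_upper {k : ℕ} (hi : i ≤ N) (h : k + i = N ∨ k = N + i) (f : ℕ → A) :
    cosetOp q Q N t i f (k + 1) = f k + ((if i = 0 then Q else q) - 1) • f (k + 1) := by
  change cosetFun q Q N t i f (k + 1) = _
  rw [cosetFun, if_neg (by omega), if_neg (by omega), if_pos (by omega), Nat.add_sub_cancel]

theorem cosetOp_mid {k : ℕ} (hi : i ≤ N) (h : N + 1 < k + i ∧ k < N + i) (f : ℕ → A) :
    cosetOp q Q N t i f k = t (i - 1) * f k := by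
  change cosetFun q Q N t i f k = _
  rw [cosetFun, if_neg (by omega), if_neg (by omega), if_neg (by omega), if_pos (by omega)]

theorem cosetOp_out {k : ℕ} (hk : k ≤ 2 * N + 1) (h : k + i < N ∨ N + i + 1 < k)
    (f : ℕ → A) : cosetOp q Q N t i f k = t i * f k := by
  change cosetFun q Q N t i f k = _
  rw [cosetFun, if_neg (by omega), if_neg (by omega), if_neg (by omega), if_neg (by omega)]

theorem cosetOp_junk {k : ℕ} (hk : 2 * N + 1 < k) (f : ℕ → A) :
    cosetOp q Q N t i f k = - f k := by
  change cosetFun q Q N t i f k = _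
  rw [cosetFun, if_pos hk]

/-- The possible positions of `k` with respect to the generator `i`. -/
theorem coset_cases (N i k : ℕ) (hi : i ≤ N) :
    2 * N + 1 < k ∨ (k + i = N ∨ k = N + i) ∨ (∃ b, k = b + 1 ∧ (b + i = N ∨ b = N + i)) ∨
      (N + 1 < k + i ∧ k < N + i) ∨ (k ≤ 2 * N + 1 ∧ (k + i < N ∨ N + i + 1 < k)) := by
  by_cases h1 : 2 * N + 1 < k
  · exact .inl h1
  by_cases h2 : k + i = N + 1 ∨ k = N + i + 1
  · exact .inr (.inr (.inl ⟨k - 1, by omega, by omega⟩))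
  · omega

theorem cosetOp_quad {c : K} (hc : (if i = 0 then Q else q) = c) (hi : i ≤ N)
    (h1 : i < N → t i * t i = (c - 1) • t i + c • (1 : A))
    (h2 : 1 < i → t (i - 1) * t (i - 1) = (c - 1) • t (i - 1) + c • (1 : A)) :
    cosetOp q Q N t i * cosetOp q Q N t i = (c - 1) • cosetOp q Q N t i + c • 1 := by
  refine LinearMap.ext fun f => funext fun k => ?_
  simp only [Module.End.mul_apply, LinearMap.add_apply, LinearMap.smul_apply, Pi.add_apply,
    Pi.smul_apply, Module.End.one_apply]
  rcases coset_cases N i k hi with h | h | ⟨k, rfl, h⟩ | h | ⟨h', h⟩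
  · simp only [cosetOp_junk h]
    module
  · simp only [cosetOp_lower hi h, cosetOp_upper hi h, hc]
    module
  · simp only [cosetOp_lower hi h, cosetOp_upper hi h, hc]
    module
  · simp only [cosetOp_mid hi h]
    rw [← mul_assoc, h2 (by omega), add_mul, smul_mul_assoc, smul_mul_assoc, one_mul]
  · simp only [cosetOp_out h' h]
    rw [← mul_assoc, h1 (by omega), add_mul, smul_mul_assoc, smul_mul_assoc, one_mul]

theorem cosetOp_comm (ht : IsTypeB q Q N t) {i j : ℕ} (hij : i + 1 < j) (hj : j ≤ N) :
    cosetOp q Q N t i * cosetOp q Q N t j = cosetOp q Q N t j * cosetOp q Q N t i := by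
  refine LinearMap.ext fun f => funext fun k => ?_
  simp only [Module.End.mul_apply]
  have hi : i ≤ N := by omega
  rcases coset_cases N i k hi with h | h | ⟨k, rfl, h⟩ | h | ⟨h', h⟩
  · simp only [cosetOp_junk h]
  · have hk : N + 1 < k + j ∧ k < N + j := by omega
    have hk' : N + 1 < k + 1 + j ∧ k + 1 < N + j := by omega
    simp only [cosetOp_lower hi h, cosetOp_mid hj hk, cosetOp_mid hj hk', mul_smul_comm]
  · have hk : N + 1 < k + j ∧ k < N + j := by omega
    have hk' : N + 1 < k + 1 + j ∧ k + 1 < N + j := by omega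
    simp only [cosetOp_upper hi h, cosetOp_mid hj hk, cosetOp_mid hj hk', mul_smul_comm, mul_add]
  · have hk : N + 1 < k + j ∧ k < N + j := by omega
    simp only [cosetOp_mid hi h, cosetOp_mid hj hk]
    rw [← mul_assoc, ← mul_assoc, ht.commute (i := i - 1) (j := j - 1) (by omega) (by omega)]
  · rcases coset_cases N j k hj with g | g | ⟨k, rfl, g⟩ | g | ⟨g', g⟩
    · omega
    · have hk : k + 1 + i < N ∨ N + i + 1 < k + 1 := by omega
      simp only [cosetOp_lower hj g, cosetOp_out h' h, cosetOp_out (by omega) hk, mul_smul_comm]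
    · have hk : k + i < N ∨ N + i + 1 < k := by omega
      simp only [cosetOp_upper hj g, cosetOp_out h' h, cosetOp_out (by omega) hk, mul_smul_comm,
        mul_add]
    · simp only [cosetOp_out h' h, cosetOp_mid hj g]
      rw [← mul_assoc, ← mul_assoc, ht.commute (i := i) (j := j - 1) (by omega) (by omega)]
    · simp only [cosetOp_out h' h, cosetOp_out g' g]
      rw [← mul_assoc, ← mul_assoc, ht.commute hij (by omega)]

theorem cosetOp_braid (ht : IsTypeB q Q N t) {i : ℕ} (h0 : 0 < i) (hj : i + 1 ≤ N) :
    cosetOp q Q N t (i + 1) * cosetOp q Q N t i * cosetOp q Q N t (i + 1) =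
      cosetOp q Q N t i * cosetOp q Q N t (i + 1) * cosetOp q Q N t i := by
  refine LinearMap.ext fun f => funext fun k => ?_
  simp only [Module.End.mul_apply]
  have hi : i ≤ N := by omega
  have h0' : ¬ i = 0 := by omega
  have hs : ¬ i + 1 = 0 := by omega
  by_cases hjunk : 2 * N + 1 < k
  · simp only [cosetOp_junk hjunk]
  have e7 (x : A) : t i * (t i * x) = (q - 1) • (t i * x) + q • x := by
    rw [← mul_assoc, ht.quad i h0 hj, add_mul, smul_mul_assoc, smul_mul_assoc, one_mul]
  by_cases ha : ∃ b, b + (i + 1) = N ∧ (k = b ∨ k = b + 1 ∨ k = b + 1 + 1)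
  · obtain ⟨b, hb, hk⟩ := ha
    have e1 (f : ℕ → A) := cosetOp_lower (q := q) (Q := Q) (t := t) hj (.inl hb) f
    have e2 (f : ℕ → A) := cosetOp_upper (q := q) (Q := Q) (t := t) hj (.inl hb) f
    have e3 (f : ℕ → A) := cosetOp_mid (q := q) (Q := Q) (t := t) (k := b + 1 + 1) hj
      (by omega) f
    have e4 (f : ℕ → A) := cosetOp_out (q := q) (Q := Q) (t := t) (k := b) (i := i) (N := N)
      (by omega) (by omega) f
    have e5 (f : ℕ → A) := cosetOp_lower (q := q) (Q := Q) (t := t) (k := b + 1) hi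
      (by omega) f
    have e6 (f : ℕ → A) := cosetOp_upper (q := q) (Q := Q) (t := t) (k := b + 1) hi
      (by omega) f
    simp only [if_neg h0', if_neg hs, Nat.add_sub_cancel] at e1 e2 e3 e4 e5 e6
    rcases hk with rfl | rfl | rfl <;>
    · simp only [e1, e2, e3, e4, e5, e6, e7, mul_add, mul_smul_comm]
      try module
  by_cases hc : ∃ b, b = N + i ∧ (k = b ∨ k = b + 1 ∨ k = b + 1 + 1)
  · obtain ⟨b, hb, hk⟩ := hc
    have e1 (f : ℕ → A) := cosetOp_lower (q := q) (Q := Q) (t := t) hi (.inr hb) f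
    have e2 (f : ℕ → A) := cosetOp_upper (q := q) (Q := Q) (t := t) hi (.inr hb) f
    have e3 (f : ℕ → A) := cosetOp_out (q := q) (Q := Q) (t := t) (k := b + 1 + 1) (i := i)
      (N := N) (by omega) (by omega) f
    have e4 (f : ℕ → A) := cosetOp_mid (q := q) (Q := Q) (t := t) (k := b) hj (by omega) f
    have e5 (f : ℕ → A) := cosetOp_lower (q := q) (Q := Q) (t := t) (k := b + 1) hj
      (by omega) f
    have e6 (f : ℕ → A) := cosetOp_upper (q := q) (Q := Q) (t := t) (k := b + 1) hj
      (by omega) f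
    simp only [if_neg h0', if_neg hs, Nat.add_sub_cancel] at e1 e2 e3 e4 e5 e6
    rcases hk with rfl | rfl | rfl <;>
    · simp only [e1, e2, e3, e4, e5, e6, e7, mul_add, mul_smul_comm]
      try module
  replace ha : k + (i + 1) ≠ N ∧ k + i ≠ N ∧ k + i ≠ N + 1 := by
    refine ⟨fun h => ha ⟨k, by omega⟩, fun h => ha ⟨k - 1, by omega⟩, fun h => ha ⟨k - 2, by omega⟩⟩
  replace hc : k ≠ N + i ∧ k ≠ N + i + 1 ∧ k ≠ N + i + 1 + 1 := by
    refine ⟨fun h => hc ⟨k, by omega⟩, fun h => hc ⟨k - 1, by omega⟩, fun h => hc ⟨k - 2, by omega⟩⟩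
  by_cases hm : N + 1 < k + i ∧ k < N + i
  · have hm' : N + 1 < k + (i + 1) ∧ k < N + (i + 1) := by omega
    obtain ⟨j, rfl⟩ := Nat.exists_eq_add_of_le' (show 1 ≤ i from h0)
    simp only [cosetOp_mid hi hm, cosetOp_mid hj hm', ← mul_assoc]
    simp only [Nat.add_sub_cancel]
    rw [ht.braid j (by omega) (by omega)]
  · have g1 : k + i < N ∨ N + i + 1 < k := by omega
    have g2 : k + (i + 1) < N ∨ N + (i + 1) + 1 < k := by omega
    simp only [cosetOp_out (by omega : k ≤ 2 * N + 1) g1,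
      cosetOp_out (by omega : k ≤ 2 * N + 1) g2, ← mul_assoc]
    rw [ht.braid i (by omega) (by omega)]

theorem cosetOp_braid_zero (ht : IsTypeB q Q N t) (hN : 0 < N) :
    cosetOp q Q N t 0 * cosetOp q Q N t 1 * cosetOp q Q N t 0 * cosetOp q Q N t 1 =
      cosetOp q Q N t 1 * cosetOp q Q N t 0 * cosetOp q Q N t 1 * cosetOp q Q N t 0 := by
  refine LinearMap.ext fun f => funext fun k => ?_
  simp only [Module.End.mul_apply]
  by_cases hjunk : 2 * N + 1 < k
  · simp only [cosetOp_junk hjunk]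
  have e9 (x : A) : t 0 * (t 0 * x) = (Q - 1) • (t 0 * x) + Q • x := by
    rw [← mul_assoc, ht.quad_zero hN, add_mul, smul_mul_assoc, smul_mul_assoc, one_mul]
  by_cases ha : ∃ b, b + 1 = N ∧ (k = b ∨ k = b + 1 ∨ k = b + 1 + 1 ∨ k = b + 1 + 1 + 1)
  · obtain ⟨b, hb, hk⟩ := ha
    have e1 (f : ℕ → A) := cosetOp_lower (q := q) (Q := Q) (t := t) (k := b) (i := 1) (N := N)
      (by omega) (by omega) f
    have e2 (f : ℕ → A) := cosetOp_upper (q := q) (Q := Q) (t := t) (k := b) (i := 1) (N := N)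
      (by omega) (by omega) f
    have e3 (f : ℕ → A) := cosetOp_lower (q := q) (Q := Q) (t := t) (k := b + 1) (i := 0) (N := N)
      (by omega) (by omega) f
    have e4 (f : ℕ → A) := cosetOp_upper (q := q) (Q := Q) (t := t) (k := b + 1) (i := 0) (N := N)
      (by omega) (by omega) f
    have e5 (f : ℕ → A) := cosetOp_lower (q := q) (Q := Q) (t := t) (k := b + 1 + 1) (i := 1)
      (N := N) (by omega) (by omega) f
    have e6 (f : ℕ → A) := cosetOp_upper (q := q) (Q := Q) (t := t) (k := b + 1 + 1) (i := 1)
      (N := N) (by omega) (by omega) f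
    have e7 (f : ℕ → A) := cosetOp_out (q := q) (Q := Q) (t := t) (k := b) (i := 0) (N := N)
      (by omega) (by omega) f
    have e8 (f : ℕ → A) := cosetOp_out (q := q) (Q := Q) (t := t) (k := b + 1 + 1 + 1) (i := 0)
      (N := N) (by omega) (by omega) f
    simp only [one_ne_zero, if_true, if_false] at e1 e2 e3 e4 e5 e6
    rcases hk with rfl | rfl | rfl | rfl <;>
    · simp only [e1, e2, e3, e4, e5, e6, e7, e8, e9, mul_add, mul_smul_comm, smul_add]
      try module
  replace ha : k + 1 ≠ N ∧ k ≠ N ∧ k ≠ N + 1 ∧ k ≠ N + 2 := by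
    refine ⟨fun h => ha ⟨k, by omega⟩, fun h => ha ⟨k - 1, by omega⟩,
      fun h => ha ⟨k - 2, by omega⟩, fun h => ha ⟨k - 3, by omega⟩⟩
  have g1 : k + 0 < N ∨ N + 0 + 1 < k := by omega
  have g2 : k + 1 < N ∨ N + 1 + 1 < k := by omega
  simp only [cosetOp_out (by omega : k ≤ 2 * N + 1) g1,
    cosetOp_out (by omega : k ≤ 2 * N + 1) g2, ← mul_assoc]
  rw [ht.braid_zero (by omega)]

theorem isTypeB_cosetOp (ht : IsTypeB q Q N t) : IsTypeB q Q (N + 1) (cosetOp q Q N t) where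
  quad i h0 hi := cosetOp_quad (if_neg (by omega)) (by omega) (fun h => ht.quad i h0 h)
    (fun h => ht.quad _ (by omega) (by omega))
  braid i h0 hi := cosetOp_braid ht h0 (by omega)
  comm i j h0 hij hj := cosetOp_comm ht hij (by omega)
  quad_zero hi := cosetOp_quad (if_pos rfl) (by omega) (fun h => ht.quad_zero h)
    (fun h => by omega)
  braid_zero hi := cosetOp_braid_zero ht (by omega)
  comm_zero j hij hj := cosetOp_comm ht hij (by omega)

theorem cosetOp_single_lower {k : ℕ} (hi : i ≤ N) (h : k + i = N ∨ k = N + i) (x : A) :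
    cosetOp q Q N t i (Pi.single k x) = Pi.single (k + 1) x := by
  have hs {j l : ℕ} (hjl : j ≠ l) : (Pi.single l x : ℕ → A) j = 0 := by
    simp [hjl]
  funext j
  rcases coset_cases N i j hi with g | g | ⟨j, rfl, g⟩ | g | ⟨g', g⟩
  · rw [cosetOp_junk g, hs (by omega), hs (by omega), neg_zero]
  · rw [cosetOp_lower hi g, hs (by omega), hs (by omega), smul_zero]
  · rw [cosetOp_upper hi g, hs (by omega : j + 1 ≠ k), smul_zero, add_zero]
    by_cases hjk : j = k
    · subst hjk
      simp
    · rw [hs hjk, hs (by omega)]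
  · rw [cosetOp_mid hi g, hs (by omega), hs (by omega), mul_zero]
  · rw [cosetOp_out g' g, hs (by omega), hs (by omega), mul_zero]

theorem cosetOp_single_zero (hi : i < N) (x : A) :
    cosetOp q Q N t i (Pi.single 0 x) = Pi.single 0 (t i * x) := by
  have hs {j : ℕ} (hj : j ≠ 0) (x : A) : (Pi.single 0 x : ℕ → A) j = 0 := by
    simp [hj]
  funext j
  rcases coset_cases N i j hi.le with g | g | ⟨j, rfl, g⟩ | g | ⟨g', g⟩
  · rw [cosetOp_junk g, hs (by omega), hs (by omega), neg_zero]
  · rw [cosetOp_lower hi.le g, hs (by omega), hs (by omega), smul_zero]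
  · rw [cosetOp_upper hi.le g, hs (by omega), hs (by omega), hs (by omega), smul_zero, add_zero]
  · rw [cosetOp_mid hi.le g, hs (by omega), hs (by omega), mul_zero]
  · rw [cosetOp_out g' g]
    by_cases hj : j = 0
    · subst hj
      simp
    · rw [hs hj, hs hj, mul_zero]

theorem exists_single_eq (N : ℕ) (f : HeckeB K (-1) Q q (N + 1) →ₐ[K]
      Module.End K (ℕ → HeckeB K (-1) Q q N))
    (hf : ∀ i, i < N + 1 → f (heckeBGen q Q (N + 1) i) =
      cosetOp q Q N (heckeBGen q Q N) i) (k : ℕ) (hk : k < 2 * N + 2)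
    (x : HeckeB K (-1) Q q N) : ∃ h, f h (Pi.single 0 1) = Pi.single k x := by
  induction k with
  | zero =>
    have hx : x ∈ Algebra.adjoin K (heckeBGen q Q N '' Set.Iio N) := by
      rw [adjoin_heckeBGen]; trivial
    suffices ∀ y : HeckeB K (-1) Q q N, (∃ h, f h (Pi.single 0 1) = Pi.single 0 y) →
        ∃ h, f h (Pi.single 0 1) = Pi.single 0 (x * y) by
      simpa using this 1 ⟨1, by simp⟩
    induction hx using Algebra.adjoin_induction with
    | mem x hx =>
      obtain ⟨i, hi, rfl⟩ := hx
      rintro y ⟨h, hh⟩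
      refine ⟨heckeBGen q Q (N + 1) i * h, ?_⟩
      rw [map_mul, Module.End.mul_apply, hh, hf i (Nat.lt_succ_of_lt hi), cosetOp_single_zero hi]
    | algebraMap r =>
      rintro y ⟨h, hh⟩
      refine ⟨r • h, ?_⟩
      rw [map_smul, LinearMap.smul_apply, hh, ← Pi.single_smul, Algebra.smul_def]
    | add a b _ _ ha hb =>
      intro y hy
      obtain ⟨h, hh⟩ := ha y hy
      obtain ⟨h', hh'⟩ := hb y hy
      refine ⟨h + h', ?_⟩
      rw [map_add, LinearMap.add_apply, hh, hh', ← Pi.single_add, add_mul]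
    | mul a b _ _ ha hb =>
      intro y hy
      rw [mul_assoc]
      exact ha _ (hb _ hy)
  | succ k ih =>
    obtain ⟨h, hh⟩ := ih (by omega)
    have key (i : ℕ) (hi : i ≤ N) (hki : k + i = N ∨ k = N + i) :
        ∃ h, f h (Pi.single 0 1) = Pi.single (k + 1) x := by
      refine ⟨heckeBGen q Q (N + 1) i * h, ?_⟩
      rw [map_mul, Module.End.mul_apply, hh, hf i (by omega), cosetOp_single_lower hi hki]
    rcases le_total k N with h1 | h1
    · exact key (N - k) (by omega) (by omega)
    · exact key (k - N) (by omega) (by omega)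

theorem rank_heckeB_succ (q Q : K) (N : ℕ) :
    ((2 * N + 2 : ℕ) : Cardinal) * Module.rank K (HeckeB K (-1) Q q N) ≤
      Module.rank K (HeckeB K (-1) Q q (N + 1)) := by
  obtain ⟨f, hf⟩ := exists_heckeB_lift (isTypeB_cosetOp (isTypeB_heckeBGen q Q N))
  let g : HeckeB K (-1) Q q (N + 1) →ₗ[K] (Fin (2 * N + 2) → HeckeB K (-1) Q q N) :=
    LinearMap.funLeft K _ (fun i : Fin (2 * N + 2) => (i : ℕ)) ∘ₗ
      (LinearMap.applyₗ (Pi.single 0 1)) ∘ₗ f.toLinearMap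
  have hg : Function.Surjective g := by
    rw [← LinearMap.range_eq_top, eq_top_iff, ← LinearMap.iSup_range_single, iSup_le_iff]
    rintro k _ ⟨x, rfl⟩
    obtain ⟨h, hh⟩ := exists_single_eq N f hf k k.2 x
    refine ⟨h, funext fun j => ?_⟩
    change f h (Pi.single 0 1) j = _
    rw [hh]
    simp [Pi.single_apply, Fin.ext_iff]
  have := LinearMap.rank_le_of_surjective g hg
  rw [rank_fun] at this
  simpa using this

theorem rank_heckeB_ge (q Q : K) (n : ℕ) :
    ((2 ^ n * n.factorial : ℕ) : Cardinal) ≤ Module.rank K (HeckeB K (-1) Q q n) := by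
  induction n with
  | zero =>
    obtain ⟨f, -⟩ := exists_heckeB_lift (K := K) (q := q) (Q := Q) (n := 0) (A := K)
      (T := fun _ => 0) ⟨⟨by omega, by omega, by omega⟩, by omega, by omega, by omega⟩
    have := f.toRingHom.domain_nontrivial
    simpa using Cardinal.one_le_iff_ne_zero.2 (rank_pos (R := K)
      (M := HeckeB K (-1) Q q 0)).ne'
  | succ n ih =>
    refine le_trans ?_ (rank_heckeB_succ q Q n)
    refine le_trans ?_ (mul_le_mul_right ih _)
    rw [← Nat.cast_mul]
    refine Nat.cast_le.2 (le_of_eq ?_)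
    rw [Nat.factorial_succ]
    ring

end LowerBound

section UpperBound

variable {K : Type} [Field K] {A : Type} [Ring A] [Algebra K A]

/-- The subalgebra generated by `T i` for `0 < i < k`. -/
def parabolicA (K : Type) [Field K] [Algebra K A] (T : ℕ → A) (k : ℕ) : Subalgebra K A :=
  Algebra.adjoin K (T '' Set.Ioo 0 k)

theorem mem_parabolicA {T : ℕ → A} {i k : ℕ} (h0 : 0 < i) (hi : i < k) :
    T i ∈ parabolicA K T k :=
  Algebra.subset_adjoin ⟨i, ⟨h0, hi⟩, rfl⟩

theorem parabolicA_mono (T : ℕ → A) {k l : ℕ} (h : k ≤ l) :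
    parabolicA K T k ≤ parabolicA K T l :=
  Algebra.adjoin_mono (Set.image_mono (Set.Ioo_subset_Ioo_right h))

/-- An element commuting with a generating set commutes with the generated subalgebra. -/
theorem commute_of_mem_adjoin {s : Set A} {x y : A} (h : ∀ z ∈ s, Commute x z)
    (hy : y ∈ Algebra.adjoin K s) : Commute x y := by
  induction hy using Algebra.adjoin_induction with
  | mem z hz => exact h z hz
  | algebraMap r => exact (Algebra.commutes r x).symm
  | add a b _ _ ha hb => exact ha.add_right hb
  | mul a b _ _ ha hb => exact ha.mul_right hb

/-- A left-stable submodule containing `1` contains the subalgebra. -/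
theorem adjoin_le_of_mul_mem {s : Set A} {S : Submodule K A} (h1 : (1 : A) ∈ S)
    (h : ∀ z ∈ s, ∀ x ∈ S, z * x ∈ S) {y : A} (hy : y ∈ Algebra.adjoin K s) : y ∈ S := by
  suffices ∀ x ∈ S, y * x ∈ S by simpa using this 1 h1
  induction hy using Algebra.adjoin_induction with
  | mem z hz => exact h z hz
  | algebraMap r =>
    intro x hx
    rw [← Algebra.smul_def]
    exact S.smul_mem r hx
  | add a b _ _ ha hb =>
    intro x hx
    rw [add_mul]
    exact S.add_mem (ha x hx) (hb x hx)
  | mul a b _ _ ha hb =>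
    intro x hx
    rw [mul_assoc]
    exact ha _ (hb x hx)

/-- The product `T (k - 1) * T (k - 2) * ⋯ * T (k - j)`. -/
def descProd (T : ℕ → A) : ℕ → ℕ → A
  | _, 0 => 1
  | k, j + 1 => T (k - 1) * descProd T (k - 1) j

theorem descProd_mem (T : ℕ → A) {k j : ℕ} (h : j < k) : descProd T k j ∈ parabolicA K T k := by
  induction j generalizing k with
  | zero => exact one_mem _
  | succ j ih =>
    exact mul_mem (mem_parabolicA (by omega) (by omega))
      (parabolicA_mono T (by omega) (ih (k := k - 1) (by omega)))

/-- The span of the products of elements of `parabolicA K T k` with the distinguished coset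
representatives in `parabolicA K T (k + 1)`. -/
def cosetSpan (K : Type) [Field K] [Algebra K A] (T : ℕ → A) (k : ℕ) : Submodule K A :=
  Submodule.span K {x | ∃ d ∈ parabolicA K T k, ∃ j < k + 1, x = d * descProd T (k + 1) j}

theorem mul_mem_cosetSpan {T : ℕ → A} {k : ℕ} {d x : A} (hd : d ∈ parabolicA K T k)
    (hx : x ∈ cosetSpan K T k) : d * x ∈ cosetSpan K T k := by
  induction hx using Submodule.span_induction with
  | mem x hx =>
    obtain ⟨d', hd', j, hj, rfl⟩ := hx
    rw [← mul_assoc]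
    exact Submodule.subset_span ⟨_, mul_mem hd hd', j, hj, rfl⟩
  | zero => rw [mul_zero]; exact zero_mem _
  | add a b _ _ ha hb => rw [mul_add]; exact add_mem ha hb
  | smul c a _ ha => rw [mul_smul_comm]; exact Submodule.smul_mem _ _ ha

theorem le_cosetSpan {T : ℕ → A} {k : ℕ} {d : A} (hd : d ∈ parabolicA K T k) :
    d ∈ cosetSpan K T k :=
  Submodule.subset_span ⟨d, hd, 0, by omega, (mul_one d).symm⟩

theorem IsTypeA.commute_parabolicA {q : K} {m : ℕ} {T : ℕ → A} (h : IsTypeA q m T) {k : ℕ}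
    (hk : k + 1 < m) {d : A} (hd : d ∈ parabolicA K T k) : Commute (T (k + 1)) d := by
  refine commute_of_mem_adjoin ?_ hd
  rintro _ ⟨i, ⟨h0, hi⟩, rfl⟩
  exact (h.comm i (k + 1) h0 (Nat.succ_lt_succ hi) hk).symm

theorem IsTypeA.parabolicA_succ_le {q : K} {m : ℕ} {T : ℕ → A} (h : IsTypeA q m T) (k : ℕ)
    (hk : k < m) {x : A} (hx : x ∈ parabolicA K T (k + 1)) : x ∈ cosetSpan K T k := by
  induction k generalizing x with
  | zero =>
    refine le_cosetSpan ?_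
    have e : parabolicA K T 0 = parabolicA K T (0 + 1) := by
      unfold parabolicA
      congr 2
      ext i
      simp only [Set.mem_Ioo]
      omega
    rwa [e]
  | succ k ih =>
    have hT := mem_parabolicA (K := K) (T := T) (i := k + 1) (k := k + 1 + 1) (by omega)
      (by omega)
    have double {a b : A} (ha : a ∈ parabolicA K T (k + 1)) (hb : b ∈ parabolicA K T (k + 1)) :
        a * T (k + 1) * b ∈ cosetSpan K T (k + 1) := by
      have := ih (by omega) hb
      clear hb
      induction this using Submodule.span_induction with
      | mem b hb =>
        obtain ⟨d, hd, j, hj, rfl⟩ := hb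
        refine Submodule.subset_span ⟨a * d, mul_mem ha (parabolicA_mono T (by omega) hd), j + 1,
          by omega, ?_⟩
        rw [descProd, Nat.add_sub_cancel, mul_assoc, ← mul_assoc (T _) d,
          (h.commute_parabolicA hk hd).eq]
        simp only [mul_assoc]
      | zero => rw [mul_zero]; exact zero_mem _
      | add b b' _ _ hb hb' => rw [mul_add]; exact add_mem hb hb'
      | smul c b _ hb => rw [mul_smul_comm]; exact Submodule.smul_mem _ _ hb
    have triple {a b : A} (ha : a ∈ parabolicA K T (k + 1)) (hb : b ∈ parabolicA K T (k + 1)) :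
        T (k + 1) * a * (T (k + 1) * b) ∈ cosetSpan K T (k + 1) := by
      have := ih (by omega) ha
      clear ha
      induction this using Submodule.span_induction with
      | mem a ha =>
        obtain ⟨d, hd, j, hj, rfl⟩ := ha
        rw [← mul_assoc (T _) d, (h.commute_parabolicA hk hd).eq]
        have hd' := parabolicA_mono T (by omega : k ≤ k + 1) hd
        rw [mul_assoc d, mul_assoc d]
        refine mul_mem_cosetSpan hd' ?_
        cases j with
        | zero =>
          rw [descProd, mul_one, ← mul_assoc, h.quad (k + 1) (by omega) hk, add_mul,
            smul_mul_assoc, smul_mul_assoc, one_mul]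
          refine add_mem (Submodule.smul_mem _ _ ?_) (Submodule.smul_mem _ _ (le_cosetSpan hb))
          simpa using double (one_mem _) hb
        | succ j =>
          have hw : descProd T k j ∈ parabolicA K T k := descProd_mem T (by omega)
          have e : T (k + 1) * (T k * descProd T k j) * (T (k + 1) * b) =
              T k * T (k + 1) * (T k * descProd T k j * b) := by
            calc _ = T (k + 1) * T k * (descProd T k j * T (k + 1)) * b := by
                  simp only [mul_assoc]
              _ = T (k + 1) * T k * T (k + 1) * descProd T k j * b := by
                  rw [← (h.commute_parabolicA hk hw).eq]
                  simp only [mul_assoc]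
              _ = _ := by
                  rw [h.braid k (by omega) hk]
                  simp only [mul_assoc]
          rw [descProd, Nat.add_sub_cancel, e]
          have hTk := mem_parabolicA (K := K) (T := T) (by omega : 0 < k) (by omega : k < k + 1)
          exact double hTk (mul_mem (mul_mem hTk (parabolicA_mono T (by omega) hw)) hb)
      | zero => rw [mul_zero, zero_mul]; exact zero_mem _
      | add a a' _ _ ha ha' => rw [mul_add, add_mul]; exact add_mem ha ha'
      | smul c a _ ha =>
        rw [mul_smul_comm, smul_mul_assoc]
        exact Submodule.smul_mem _ _ ha
    refine adjoin_le_of_mul_mem (le_cosetSpan (one_mem _)) ?_ hx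
    rintro _ ⟨i, ⟨h0, hi⟩, rfl⟩ y hy
    rcases Nat.lt_or_ge i (k + 1) with hik | hik
    · exact mul_mem_cosetSpan (mem_parabolicA h0 hik) hy
    · obtain rfl : i = k + 1 := by omega
      induction hy using Submodule.span_induction with
      | mem y hy =>
        obtain ⟨d, hd, j, hj, rfl⟩ := hy
        cases j with
        | zero =>
          rw [descProd, mul_one]
          simpa using double (one_mem _) hd
        | succ j =>
          rw [descProd, Nat.add_sub_cancel, ← mul_assoc]
          exact triple hd (descProd_mem T (by omega))
      | zero => rw [mul_zero]; exact zero_mem _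
      | add b b' _ _ hb hb' => rw [mul_add]; exact add_mem hb hb'
      | smul c b _ hb => rw [mul_smul_comm]; exact Submodule.smul_mem _ _ hb

open Classical in
theorem IsTypeA.exists_finset {q : K} {m : ℕ} {T : ℕ → A} (h : IsTypeA q m T) (k : ℕ)
    (hk : k ≤ m) : ∃ s : Finset A, s.card ≤ k.factorial ∧
      Subalgebra.toSubmodule (parabolicA K T k) ≤ Submodule.span K (s : Set A) := by
  induction k with
  | zero =>
    refine ⟨{1}, by simp, ?_⟩
    have e : parabolicA K T 0 = ⊥ := by
      unfold parabolicA
      rw [show Set.Ioo 0 0 = (∅ : Set ℕ) by simp, Set.image_empty, Algebra.adjoin_empty]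
    rw [e, Algebra.toSubmodule_bot, Finset.coe_singleton, Submodule.one_eq_span]
  | succ k ih =>
    obtain ⟨s, hs, hle⟩ := ih (by omega)
    refine ⟨Finset.image₂ (· * ·) s ((Finset.range (k + 1)).image (descProd T (k + 1))), ?_, ?_⟩
    · refine (Finset.card_image₂_le _ _ _).trans ?_
      rw [Nat.factorial_succ, mul_comm]
      refine Nat.mul_le_mul ?_ hs
      simpa using Finset.card_image_le (s := Finset.range (k + 1)) (f := descProd T (k + 1))
    · intro x hx
      refine Submodule.span_le.2 ?_ (h.parabolicA_succ_le k (by omega) hx)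
      rintro _ ⟨d, hd, j, hj, rfl⟩
      have := Submodule.mul_mem_mul (hle hd) (Submodule.subset_span (R := K)
        (Set.mem_singleton (descProd T (k + 1) j)))
      rw [Submodule.span_mul_span] at this
      refine Submodule.span_mono ?_ this
      rintro _ ⟨a, ha, _, rfl, rfl⟩
      simp only [Finset.coe_image₂]
      exact ⟨a, ha, _, Finset.mem_coe.2 (Finset.mem_image_of_mem _ (Finset.mem_range.2 hj)), rfl⟩

theorem exists_finset_span_heckeA (q : K) (m : ℕ) : ∃ s : Finset (HeckeA K q m),
    s.card ≤ m.factorial ∧ Submodule.span K (s : Set (HeckeA K q m)) = ⊤ := by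
  obtain ⟨s, hs, hle⟩ := (isTypeA_heckeAGen q m).exists_finset m le_rfl
  refine ⟨s, hs, eq_top_iff.2 ?_⟩
  rwa [parabolicA, adjoin_heckeAGen, Algebra.top_toSubmodule] at hle

instance finite_heckeA (q : K) (m : ℕ) : Module.Finite K (HeckeA K q m) := by
  obtain ⟨s, -, h⟩ := exists_finset_span_heckeA q m
  exact ⟨⟨s, h⟩⟩

theorem finrank_heckeA_le (q : K) (m : ℕ) :
    Module.finrank K (HeckeA K q m) ≤ m.factorial := by
  obtain ⟨s, hs, h⟩ := exists_finset_span_heckeA q m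
  have := finrank_span_finset_le_card (R := K) s
  rw [Set.finrank, h, finrank_top] at this
  exact this.trans hs

end UpperBound

section AffinePair

open Polynomial

variable {K : Type} [Field K] {A : Type} [Ring A] [Algebra K A]

/-- If `x` and `y` commute then `y - x` divides `p(y) - p(x)`. -/
theorem exists_aeval_sub {x y : A} (hxy : Commute x y) (p : K[X]) :
    ∃ D ∈ Algebra.adjoin K {x, y}, D * (y - x) = aeval y p - aeval x p := by
  have hx : x ∈ Algebra.adjoin K {x, y} := Algebra.subset_adjoin (by simp)
  have hy : y ∈ Algebra.adjoin K {x, y} := Algebra.subset_adjoin (by simp)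
  induction p using Polynomial.induction_on' with
  | add p p' hp hp' =>
    obtain ⟨D, hD, h⟩ := hp
    obtain ⟨D', hD', h'⟩ := hp'
    refine ⟨D + D', add_mem hD hD', ?_⟩
    rw [add_mul, h, h', map_add, map_add]
    abel
  | monomial n a =>
    suffices ∃ D ∈ Algebra.adjoin K {x, y}, D * (y - x) = y ^ n - x ^ n by
      obtain ⟨D, hD, h⟩ := this
      refine ⟨a • D, Subalgebra.smul_mem _ hD a, ?_⟩
      rw [smul_mul_assoc, h, aeval_monomial, aeval_monomial, smul_sub, Algebra.smul_def,
        Algebra.smul_def]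
    induction n with
    | zero => exact ⟨0, zero_mem _, by simp⟩
    | succ n ih =>
      obtain ⟨D, hD, h⟩ := ih
      refine ⟨D * y + x ^ n, add_mem (mul_mem hD hy) (pow_mem hx n), ?_⟩
      have e : y * (y - x) = (y - x) * y := by rw [mul_sub, sub_mul, hxy.eq]
      rw [add_mul, mul_assoc, e, ← mul_assoc, h, pow_succ, pow_succ, sub_mul, mul_sub,
        sub_add_sub_cancel]

/-- Elements `t`, `x`, `y` satisfying the relations of the affine Hecke algebra of `GL₂`. -/
structure IsAffinePair (q : K) (t x y : A) : Prop where
  ne_zero : q ≠ 0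
  quad : t * t = (q - 1) • t + q • (1 : A)
  conj : t * x * t = q • y
  comm : Commute x y

namespace IsAffinePair

variable {q : K} {t x y : A} (h : IsAffinePair q t x y)
include h

theorem mul_left : t * x = y * t - (q - 1) • y := by
  have h1 : t * x * t * t = q • (y * t) := by rw [h.conj, smul_mul_assoc]
  rw [mul_assoc (t * x), h.quad, mul_add, mul_smul_comm, mul_smul_comm, mul_one, h.conj] at h1
  have h2 : q • (t * x) = q • (y * t - (q - 1) • y) := by
    rw [smul_sub, ← h1]
    module
  exact smul_right_injective A h.ne_zero h2

theorem mul_right : x * t = t * y - (q - 1) • y := by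
  have h1 : t * (t * x * t) = q • (t * y) := by rw [h.conj, mul_smul_comm]
  rw [← mul_assoc, ← mul_assoc, h.quad, add_mul, add_mul, smul_mul_assoc, smul_mul_assoc,
    smul_mul_assoc, smul_mul_assoc, one_mul, h.conj] at h1
  have h2 : q • (x * t) = q • (t * y - (q - 1) • y) := by
    rw [smul_sub, ← h1]
    module
  exact smul_right_injective A h.ne_zero h2

theorem mul_left' : t * y = x * t + (q - 1) • y := by rw [h.mul_right, sub_add_cancel]

theorem mem_commute {w z : A} (hw : w ∈ Algebra.adjoin K {x, y})
    (hz : z ∈ Algebra.adjoin K {x, y}) : Commute w z := by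
  refine commute_of_mem_adjoin ?_ hz
  have hx : ∀ u ∈ ({x, y} : Set A), Commute x u := by
    rintro u (rfl | rfl)
    exacts [Commute.refl _, h.comm]
  have hy : ∀ u ∈ ({x, y} : Set A), Commute y u := by
    rintro u (rfl | rfl)
    exacts [h.comm.symm, Commute.refl _]
  rintro u (rfl | rfl)
  exacts [(commute_of_mem_adjoin hx hw).symm, (commute_of_mem_adjoin hy hw).symm]

omit h in
theorem aeval_left_mem (p : K[X]) : aeval x p ∈ Algebra.adjoin K {x, y} :=
  Algebra.adjoin_mono (by simp) (aeval_mem_adjoin_singleton K x)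

omit h in
theorem aeval_right_mem (p : K[X]) : aeval y p ∈ Algebra.adjoin K {x, y} :=
  Algebra.adjoin_mono (by simp) (aeval_mem_adjoin_singleton K y)

/-- The Bernstein relation. -/
theorem bernstein (p : K[X]) : ∃ w ∈ Algebra.adjoin K {x, y},
    t * aeval x p = aeval y p * t - w ∧ t * aeval y p = aeval x p * t + w := by
  have hx : x ∈ Algebra.adjoin K {x, y} := Algebra.subset_adjoin (by simp)
  have hy : y ∈ Algebra.adjoin K {x, y} := Algebra.subset_adjoin (by simp)
  induction p using Polynomial.induction_on' with
  | add p p' hp hp' =>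
    obtain ⟨D, hD, h1, h2⟩ := hp
    obtain ⟨D', hD', h1', h2'⟩ := hp'
    refine ⟨D + D', add_mem hD hD', ?_, ?_⟩
    · rw [map_add, map_add, mul_add, h1, h1', add_mul]
      abel
    · rw [map_add, map_add, mul_add, h2, h2', add_mul]
      abel
  | monomial n a =>
    suffices ∃ D ∈ Algebra.adjoin K {x, y}, D * (y - x) = y ^ n - x ^ n ∧
        t * x ^ n = y ^ n * t - (q - 1) • (y * D) ∧
        t * y ^ n = x ^ n * t + (q - 1) • (y * D) by
      obtain ⟨D, hD, -, h1, h2⟩ := this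
      refine ⟨a • ((q - 1) • (y * D)), Subalgebra.smul_mem _
        (Subalgebra.smul_mem _ (mul_mem hy hD) _) a, ?_, ?_⟩
      · rw [aeval_monomial, aeval_monomial, ← Algebra.smul_def, ← Algebra.smul_def,
          mul_smul_comm, h1, smul_sub, smul_mul_assoc]
      · rw [aeval_monomial, aeval_monomial, ← Algebra.smul_def, ← Algebra.smul_def,
          mul_smul_comm, h2, smul_add, smul_mul_assoc]
    induction n with
    | zero => exact ⟨0, zero_mem _, by simp, by simp, by simp⟩
    | succ n ih =>
      obtain ⟨D, hD, h0, h1, h2⟩ := ih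
      have hDx := (h.mem_commute hD hx).eq
      have hDy := (h.mem_commute hD hy).eq
      have e : x * D + y ^ n = y * D + x ^ n := by
        rw [mul_sub, hDx, hDy, sub_eq_sub_iff_add_eq_add] at h0
        rw [h0, add_comm]
      refine ⟨y * D + x ^ n, add_mem (mul_mem hy hD) (pow_mem hx n), ?_, ?_, ?_⟩
      · rw [add_mul, mul_assoc, h0, mul_sub, mul_sub, ← pow_succ', ← pow_succ,
          (h.comm.pow_left n).eq, sub_add_sub_cancel]
      · rw [pow_succ', ← mul_assoc, h.mul_left, sub_mul, mul_assoc, h1, pow_succ']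
        simp only [mul_sub, mul_add, mul_smul_comm, smul_mul_assoc, mul_assoc]
        module
      · rw [← e, pow_succ', ← mul_assoc, h.mul_left', add_mul, mul_assoc, h2, pow_succ']
        simp only [mul_add, mul_smul_comm, smul_mul_assoc, ← mul_assoc, h.comm.eq]
        module

theorem commute_aeval_add (p : K[X]) : Commute t (aeval x p + aeval y p) := by
  obtain ⟨w, -, h1, h2⟩ := h.bernstein p
  rw [commute_iff_eq, mul_add, h1, h2, add_mul]
  abel

theorem commute_aeval_mul (p : K[X]) : Commute t (aeval x p * aeval y p) := by
  obtain ⟨w, hw, h1, h2⟩ := h.bernstein p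
  rw [commute_iff_eq, ← mul_assoc, h1, sub_mul, mul_assoc, h2, mul_add, ← mul_assoc,
    (h.mem_commute hw (aeval_right_mem p)).eq,
    (h.mem_commute (aeval_left_mem p) (aeval_right_mem p)).eq, add_sub_cancel_right]

/-- The intertwining element. -/
theorem exists_intertwiner : ∃ φ ∈ Algebra.adjoin K {t, x, y},
    φ * x = y * φ ∧ φ * y = x * φ ∧ φ * φ = (q • x - y) * (q • y - x) := by
  have ht : t ∈ Algebra.adjoin K {t, x, y} := Algebra.subset_adjoin (by simp)
  have hx : x ∈ Algebra.adjoin K {t, x, y} := Algebra.subset_adjoin (by simp)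
  have hy : y ∈ Algebra.adjoin K {t, x, y} := Algebra.subset_adjoin (by simp)
  have hyx : y * x = x * y := h.comm.eq.symm
  have e1 : (t * (x - y) + (q - 1) • y) * x = y * (t * (x - y) + (q - 1) • y) := by
    have : (t * (x - y) + (q - 1) • y) * x = t * x * (x - y) + (q - 1) • (y * x) := by
      rw [add_mul, smul_mul_assoc, mul_assoc, mul_assoc, sub_mul, mul_sub x, hyx, mul_sub]
    rw [this, h.mul_left, sub_mul, mul_add, smul_mul_assoc, mul_sub y x y, mul_smul_comm,
      mul_assoc]
    module
  have e2 : (t * (x - y) + (q - 1) • y) * y = x * (t * (x - y) + (q - 1) • y) := by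
    have : (t * (x - y) + (q - 1) • y) * y = t * y * (x - y) + (q - 1) • (y * y) := by
      rw [add_mul, smul_mul_assoc, mul_assoc, mul_assoc, sub_mul, mul_sub y, hyx, mul_sub]
    rw [this, h.mul_left', add_mul, mul_add, smul_mul_assoc, mul_sub y x y, mul_smul_comm,
      mul_assoc, hyx]
    module
  refine ⟨t * (x - y) + (q - 1) • y, add_mem (mul_mem ht (sub_mem hx hy))
    (Subalgebra.smul_mem _ hy _), e1, e2, ?_⟩
  have e3 : t * (t * (x - y) + (q - 1) • y) = (q - 1) • (t * x) + q • (x - y) := by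
    rw [mul_add, ← mul_assoc, h.quad, add_mul, smul_mul_assoc, smul_mul_assoc, one_mul, mul_sub,
      mul_smul_comm]
    module
  set φ := t * (x - y) + (q - 1) • y with hφ
  have e4 : φ * φ = t * φ * (y - x) + (q - 1) • (φ * x) := by
    conv_lhs => arg 1; rw [hφ]
    rw [add_mul, smul_mul_assoc, ← e1, mul_assoc, mul_assoc, mul_sub, e1, e2, sub_mul]
  rw [e4, e3, hφ]
  simp only [add_mul, sub_mul, mul_sub, smul_mul_assoc, mul_smul_comm, mul_assoc, hyx]
  module

omit h in
theorem aeval_intertwine {φ u v : A} (h : φ * u = v * φ) (p : K[X]) :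
    φ * aeval u p = aeval v p * φ := by
  induction p using Polynomial.induction_on' with
  | add p p' hp hp' => rw [map_add, map_add, mul_add, hp, hp', add_mul]
  | monomial n a =>
    rw [aeval_monomial, aeval_monomial, ← Algebra.smul_def, ← Algebra.smul_def, mul_smul_comm,
      smul_mul_assoc, (SemiconjBy.pow_right h n).eq]

end IsAffinePair

end AffinePair

section JucysMurphy

open Polynomial

variable {K : Type} [Field K] {A : Type} [Ring A] [Algebra K A]

namespace IsAffinePair

variable {q : K} {t x y : A}

theorem aeval_comp_C_mul_X (c : K) (x : A) (p : K[X]) :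
    aeval x (p.comp (C c * X)) = aeval (c • x) p := by
  rw [aeval_comp, map_mul, aeval_C, aeval_X, Algebra.smul_def]

theorem exists_aeval_smul_sub (hxy : Commute x y) (c : K) (p : K[X]) :
    ∃ D ∈ Algebra.adjoin K {x, y}, D * (c • y - x) = aeval (c • y) p - aeval x p := by
  obtain ⟨D, hD, h⟩ := exists_aeval_sub (hxy.smul_right c) p
  refine ⟨D, Algebra.adjoin_le ?_ hD, h⟩
  rintro z (rfl | rfl)
  · exact Algebra.subset_adjoin (by simp)
  · exact Subalgebra.smul_mem _ (Algebra.subset_adjoin (by simp)) _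

theorem exists_inverse (h : IsAffinePair q t x y) {F G : K[X]}
    (h1 : IsCoprime F (G.comp (C q * X))) (h2 : IsCoprime G (F.comp (C q * X))) :
    ∃ g ∈ Algebra.adjoin K {x, y}, ∀ e : A, aeval x F * e = 0 → aeval y G * e = 0 →
      g * ((q • x - y) * (q • y - x)) * e = e := by
  have hx : x ∈ Algebra.adjoin K {x, y} := Algebra.subset_adjoin (by simp)
  have hy : y ∈ Algebra.adjoin K {x, y} := Algebra.subset_adjoin (by simp)
  obtain ⟨a, b, hab⟩ := h1
  obtain ⟨a', b', hab'⟩ := h2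
  obtain ⟨D, hD, hd⟩ := exists_aeval_smul_sub h.comm.symm q G
  obtain ⟨D', hD', hd'⟩ := exists_aeval_smul_sub h.comm q F
  rw [Set.pair_comm] at hD
  refine ⟨aeval x b * D * (aeval y b' * D'), mul_mem (mul_mem (aeval_left_mem b) hD)
    (mul_mem (aeval_right_mem b') hD'), fun e he he' => ?_⟩
  have e1 : aeval x b * D * (q • x - y) * e = e := by
    have := congrArg (aeval x · * e) hab
    simp only [map_add, map_mul, aeval_comp_C_mul_X, map_one, one_mul, add_mul] at this
    rw [mul_assoc, he, mul_zero, zero_add] at this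
    rw [mul_assoc (aeval x b), hd, mul_sub, sub_mul, this, mul_assoc, he', mul_zero, sub_zero]
  have e2 : aeval y b' * D' * (q • y - x) * e = e := by
    have := congrArg (aeval y · * e) hab'
    simp only [map_add, map_mul, aeval_comp_C_mul_X, map_one, one_mul, add_mul] at this
    rw [mul_assoc, he', mul_zero, zero_add] at this
    rw [mul_assoc (aeval y b'), hd', mul_sub, sub_mul, this, mul_assoc, he, mul_zero, sub_zero]
  have hc := (h.mem_commute (mul_mem (aeval_right_mem b') hD')
    (sub_mem (Subalgebra.smul_mem _ hx q) hy)).eq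
  calc _ = aeval x b * D * (aeval y b' * D' * (q • x - y)) * ((q • y - x) * e) := by
        simp only [mul_assoc]
    _ = aeval x b * D * (q • x - y) * (aeval y b' * D' * (q • y - x) * e) := by
        rw [hc]
        simp only [mul_assoc]
    _ = e := by rw [e2, e1]

theorem aeval_eq_zero (h : IsAffinePair q t x y) {p : K[X]} (hp : aeval x p = 0) :
    aeval y (p * p.comp (C q⁻¹ * X) * p.comp (C q * X)) = 0 := by
  have hx : x ∈ Algebra.adjoin K {x, y} := Algebra.subset_adjoin (by simp)
  have hy : y ∈ Algebra.adjoin K {x, y} := Algebra.subset_adjoin (by simp)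
  obtain ⟨φ, -, h1, -, h2⟩ := h.exists_intertwiner
  obtain ⟨D, hD, hd⟩ := exists_aeval_smul_sub h.comm q⁻¹ p
  obtain ⟨D', hD', hd'⟩ := exists_aeval_smul_sub h.comm q p
  have e1 : aeval y p * ((q • x - y) * (q • y - x)) = 0 := by
    rw [← h2, ← mul_assoc, ← aeval_intertwine h1, hp, mul_zero, zero_mul]
  rw [map_mul, map_mul, aeval_comp_C_mul_X, aeval_comp_C_mul_X]
  rw [hp, sub_zero] at hd hd'
  rw [← hd, ← hd']
  have e2 : q⁻¹ • y - x = -q⁻¹ • (q • x - y) := by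
    rw [neg_smul, smul_sub, smul_smul, inv_mul_cancel₀ h.ne_zero]
    module
  have hxy := sub_mem (Subalgebra.smul_mem _ hx q) hy
  calc _ = -q⁻¹ • (aeval y p * (D * (q • x - y)) * D' * (q • y - x)) := by
        rw [e2]
        simp only [mul_smul_comm, smul_mul_assoc, mul_assoc]
    _ = -q⁻¹ • (D * (aeval y p * (q • x - y) * D') * (q • y - x)) := by
        rw [← mul_assoc _ D, (h.mem_commute (aeval_right_mem p) hD).eq]
        simp only [mul_assoc]
    _ = -q⁻¹ • (D * D' * (aeval y p * ((q • x - y) * (q • y - x)))) := by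
        rw [(h.mem_commute (mul_mem (aeval_right_mem p) hxy) hD').eq]
        simp only [mul_assoc]
    _ = 0 := by rw [e1, mul_zero, smul_zero]

end IsAffinePair

/-- Polynomials whose roots are of the form `c q ^ f`. -/
noncomputable def specPoly (q c : K) : ℕ → K[X]
  | 0 => X - C c
  | i + 1 => specPoly q c i * (specPoly q c i).comp (C q⁻¹ * X) *
      (specPoly q c i).comp (C q * X)

theorem specPoly_comp_succ {q : K} (hq : q ≠ 0) (c : K) (i : ℕ) (a : ℤ) :
    (specPoly q c (i + 1)).comp (C (q ^ a) * X) = (specPoly q c i).comp (C (q ^ a) * X) *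
      (specPoly q c i).comp (C (q ^ (a - 1)) * X) *
      (specPoly q c i).comp (C (q ^ (a + 1)) * X) := by
  have e (b : K) : (C b * X : K[X]).comp (C (q ^ a) * X) = C (b * q ^ a) * X := by
    rw [mul_comp, C_comp, X_comp, C_mul, mul_assoc]
  rw [specPoly, mul_comp, mul_comp, comp_assoc, comp_assoc, e, e, zpow_sub_one₀ hq,
    zpow_add_one₀ hq, mul_comm q⁻¹, mul_comm q]

theorem isCoprime_specPoly {q c d : K} (hq : q ≠ 0) (hcd : ∀ f : ℤ, d ≠ c * q ^ f) (i j : ℕ)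
    (a b : ℤ) : IsCoprime ((specPoly q c i).comp (C (q ^ a) * X))
      ((specPoly q d j).comp (C (q ^ b) * X)) := by
  induction i generalizing a with
  | succ i ih =>
    rw [specPoly_comp_succ hq]
    exact ((ih _).mul_left (ih _)).mul_left (ih _)
  | zero =>
    induction j generalizing b with
    | succ j ih =>
      rw [specPoly_comp_succ hq]
      exact ((ih _).mul_right (ih _)).mul_right (ih _)
    | zero =>
      simp only [specPoly, sub_comp, X_comp, C_comp]
      have hr : q ^ a * d - q ^ b * c ≠ 0 := by
        intro h0
        refine hcd (b - a) ?_
        rw [zpow_sub₀ hq]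
        have := zpow_ne_zero a hq
        field_simp
        linear_combination h0
      refine ⟨C ((q ^ a * d - q ^ b * c)⁻¹ * q ^ b), -C ((q ^ a * d - q ^ b * c)⁻¹ * q ^ a), ?_⟩
      rw [← C_1, ← inv_mul_cancel₀ hr]
      simp only [C_mul, C_sub]
      ring

theorem specPoly_dvd (q c : K) {i j : ℕ} (h : i ≤ j) : specPoly q c i ∣ specPoly q c j := by
  induction j, h using Nat.le_induction with
  | base => exact dvd_rfl
  | succ j _ ih => exact ih.trans (by rw [specPoly, mul_assoc]; exact dvd_mul_right _ _)

/-- The Jucys-Murphy elements. -/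
noncomputable def jucysMurphy (q : K) (T : ℕ → A) : ℕ → A
  | 0 => T 0
  | i + 1 => q⁻¹ • (T (i + 1) * jucysMurphy q T i * T (i + 1))

/-- The subalgebra generated by `T i` for `i < k`. -/
def parabolicB (K : Type) [Field K] [Algebra K A] (T : ℕ → A) (k : ℕ) : Subalgebra K A :=
  Algebra.adjoin K (T '' Set.Iio k)

theorem mem_parabolicB {T : ℕ → A} {i k : ℕ} (hi : i < k) : T i ∈ parabolicB K T k :=
  Algebra.subset_adjoin ⟨i, hi, rfl⟩

theorem parabolicB_mono (T : ℕ → A) {k l : ℕ} (h : k ≤ l) :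
    parabolicB K T k ≤ parabolicB K T l :=
  Algebra.adjoin_mono (Set.image_mono (Set.Iio_subset_Iio h))

theorem jucysMurphy_mem (q : K) (T : ℕ → A) (i : ℕ) :
    jucysMurphy q T i ∈ parabolicB K T (i + 1) := by
  induction i with
  | zero => exact mem_parabolicB (by omega)
  | succ i ih =>
    have hT : T (i + 1) ∈ parabolicB K T (i + 1 + 1) := mem_parabolicB (by omega)
    exact Subalgebra.smul_mem _ (mul_mem (mul_mem hT (parabolicB_mono T (by omega) ih)) hT) _

theorem IsTypeB.commute_parabolicB {q Q : K} {n : ℕ} {T : ℕ → A} (h : IsTypeB q Q n T) {j k : ℕ}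
    (hk : k < j) (hj : j < n) {a : A} (ha : a ∈ parabolicB K T k) : Commute (T j) a := by
  refine commute_of_mem_adjoin ?_ ha
  rintro _ ⟨i, hi, rfl⟩
  have : i < k := hi
  exact (h.commute (i := i) (j := j) (by omega) hj).symm

theorem IsTypeB.commute_jucysMurphy {q Q : K} {n : ℕ} {T : ℕ → A} (h : IsTypeB q Q n T) {j k : ℕ}
    (hj : j < k) (hk : k < n) : Commute (T j) (jucysMurphy q T k) := by
  induction k with
  | zero => omega
  | succ k ih =>
    rw [jucysMurphy]
    refine Commute.smul_right ?_ _
    rcases Nat.lt_or_ge j k with hjk | hjk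
    · have := h.commute_parabolicB (j := k + 1) (k := k) (by omega) hk
        (mem_parabolicB (K := K) hjk)
      exact (this.symm.mul_right (ih hjk (by omega))).mul_right this.symm
    · obtain rfl : j = k := by omega
      cases j with
      | zero =>
        rw [jucysMurphy, commute_iff_eq, ← mul_assoc, ← mul_assoc]
        exact h.braid_zero hk
      | succ j =>
        have hb := h.braid (j + 1) (by omega) hk
        have hx := h.commute_parabolicB (j := j + 1 + 1) (k := j + 1) (by omega) hk
          (jucysMurphy_mem q T j)
        rw [jucysMurphy, mul_smul_comm, smul_mul_assoc]
        refine Commute.smul_right ?_ _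
        set u := T (j + 1)
        set v := T (j + 1 + 1)
        set x := jucysMurphy q T j
        calc u * (v * (u * x * u) * v) = (u * v * u) * x * u * v := by simp only [mul_assoc]
          _ = v * u * (v * x) * u * v := by rw [← hb]; simp only [mul_assoc]
          _ = v * u * x * (v * u * v) := by rw [hx.eq]; simp only [mul_assoc]
          _ = v * (u * x * u) * v * u := by rw [hb]; simp only [mul_assoc]

theorem IsTypeB.jucysMurphy_commute {q Q : K} {n : ℕ} {T : ℕ → A} (h : IsTypeB q Q n T) {k : ℕ}
    (hk : k < n) {a : A} (ha : a ∈ parabolicB K T k) : Commute (jucysMurphy q T k) a := by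
  refine commute_of_mem_adjoin ?_ ha
  rintro _ ⟨i, hi, rfl⟩
  exact (h.commute_jucysMurphy hi hk).symm

theorem IsTypeB.isAffinePair {q Q : K} {n : ℕ} {T : ℕ → A} (h : IsTypeB q Q n T) (hq : q ≠ 0)
    {i : ℕ} (hi : i + 1 < n) :
    IsAffinePair q (T (i + 1)) (jucysMurphy q T i) (jucysMurphy q T (i + 1)) where
  ne_zero := hq
  quad := h.quad _ (by omega) hi
  conj := by rw [jucysMurphy, smul_smul, mul_inv_cancel₀ hq, one_smul]
  comm := (h.jucysMurphy_commute hi (jucysMurphy_mem q T i)).symm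

theorem IsTypeB.aeval_jucysMurphy {q Q : K} {n : ℕ} {T : ℕ → A} (h : IsTypeB q Q n T)
    (hq : q ≠ 0) {i : ℕ} (hi : i < n) :
    aeval (jucysMurphy q T i) (specPoly q (-1) i * specPoly q Q i) = 0 := by
  induction i with
  | zero =>
    simp only [specPoly, jucysMurphy, map_mul, map_sub, map_add, aeval_X, aeval_C, map_neg, map_one,
      sub_neg_eq_add]
    exact (quad_iff _ _).2 (h.quad_zero hi)
  | succ i ih =>
    rw [← (h.isAffinePair hq hi).aeval_eq_zero (ih (by omega))]
    simp only [specPoly, mul_comp]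
    congr 1
    ring

/-- The elements `X i` are the Jucys-Murphy elements attached to the generators `T i`, and
`E i` is the projection onto the generalized eigenspaces of `X i` for the eigenvalues of the
form `-q ^ f`. -/
structure IsJM (q Q : K) (n : ℕ) (T X E : ℕ → A) : Prop extends IsTypeB q Q n T where
  X_zero : X 0 = T 0
  X_mem : ∀ i, X i ∈ parabolicB K T (i + 1)
  X_comm : ∀ i, i < n → ∀ a ∈ parabolicB K T i, Commute (X i) a
  affine : ∀ i, i + 1 < n → IsAffinePair q (T (i + 1)) (X i) (X (i + 1))
  E_mem : ∀ i, E i ∈ Algebra.adjoin K {X i}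
  E_idem : ∀ i, i < n → E i * E i = E i
  X_mul_E : 0 < n → X 0 * E 0 = -E 0
  X_mul_E_compl : 0 < n → X 0 * (1 - E 0) = Q • (1 - E 0)
  comm_add : ∀ i, i + 1 < n → Commute (T (i + 1)) (E i + E (i + 1))
  comm_mul : ∀ i, i + 1 < n → Commute (T (i + 1)) (E i * E (i + 1))
  corner : ∀ i, i + 1 < n → E i * (1 - E (i + 1)) * T (i + 1) * (E i * (1 - E (i + 1))) ∈
    Algebra.adjoin K {X i, X (i + 1)}
  swap : ∀ i, i + 1 < n → ∃ φ ∈ Algebra.adjoin K {T (i + 1), X i, X (i + 1)},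
    φ * X i = X (i + 1) * φ ∧ φ * X (i + 1) = X i * φ ∧
    φ * E i = E (i + 1) * φ ∧ φ * E (i + 1) = E i * φ ∧
    (∃ g ∈ Algebra.adjoin K {X i, X (i + 1)}, ∀ e : A, E i * e = 0 → E (i + 1) * e = e →
      g * (φ * φ) * e = e) ∧
    (∃ g ∈ Algebra.adjoin K {X i, X (i + 1)}, ∀ e : A, E i * e = e → E (i + 1) * e = 0 →
      g * (φ * φ) * e = e)

theorem IsAffinePair.corner_mem {q : K} {t x y : A} (h : IsAffinePair q t x y) {p p' : K[X]}
    (hp : aeval y p * aeval y p' = 0) :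
    aeval x p * aeval y p' * t * (aeval x p * aeval y p') ∈ Algebra.adjoin K {x, y} := by
  obtain ⟨w, hw, h1, h2⟩ := h.bernstein p
  have e : aeval x p * aeval y p' * t * (aeval x p * aeval y p') =
      -(aeval x p * aeval y p' * w * aeval y p') := by
    have hc : aeval y p' * aeval y p = 0 := by
      rw [← hp, ← map_mul, ← map_mul, mul_comm]
    calc _ = aeval x p * aeval y p' * (t * aeval x p) * aeval y p' := by simp only [mul_assoc]
      _ = aeval x p * (aeval y p' * aeval y p) * t * aeval y p' -
          aeval x p * aeval y p' * w * aeval y p' := by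
          rw [h1, mul_sub, sub_mul]
          simp only [mul_assoc]
      _ = _ := by rw [hc, mul_zero, zero_mul, zero_mul, zero_sub]
  rw [e]
  exact neg_mem (mul_mem (mul_mem (mul_mem (aeval_left_mem p) (aeval_right_mem p')) hw)
    (aeval_right_mem p'))

theorem IsTypeB.exists_isJM {q Q : K} {n : ℕ} {T : ℕ → A} (h : IsTypeB q Q n T) (hq : q ≠ 0)
    (hgen : ∀ f : ℤ, Q ≠ -q ^ f) : ∃ X E, IsJM q Q n T X E := by
  have hgen' : ∀ f : ℤ, Q ≠ -1 * q ^ f := fun f => by rw [neg_one_mul]; exact hgen f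
  have hgen'' : ∀ f : ℤ, -1 ≠ Q * q ^ f := fun f hf => by
    refine hgen (-f) ?_
    rw [zpow_neg]
    have := zpow_ne_zero f hq
    field_simp
    rw [← hf]
  have hcop (i j : ℕ) : IsCoprime (specPoly q (-1) i) (specPoly q Q j) := by
    simpa using isCoprime_specPoly hq hgen' i j 0 0
  have hcop1 (i j : ℕ) : IsCoprime (specPoly q (-1) i) ((specPoly q Q j).comp (C q * X)) := by
    simpa using isCoprime_specPoly hq hgen' i j 0 1
  have hcop2 (i j : ℕ) : IsCoprime (specPoly q Q i) ((specPoly q (-1) j).comp (C q * X)) := by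
    simpa using isCoprime_specPoly hq hgen'' i j 0 1
  obtain ⟨u, v, huv⟩ := hcop n n
  set F := specPoly q (-1) n with hF
  set G := specPoly q Q n with hG
  set X' := jucysMurphy q T with hX
  have hFG (i : ℕ) (hi : i < n) : aeval (X' i) (F * G) = 0 := by
    obtain ⟨r, hr⟩ := mul_dvd_mul (specPoly_dvd q (-1) hi.le) (specPoly_dvd q Q hi.le)
    rw [hF, hG, hr, map_mul, h.aeval_jucysMurphy hq hi, zero_mul]
  have hu : u * F = 1 - v * G := by rw [← huv]; ring
  have hz (i : ℕ) (hi : i < n) (r : K[X]) (hr : F * G ∣ r) : aeval (X' i) r = 0 := by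
    obtain ⟨s, rfl⟩ := hr
    rw [map_mul, hFG i hi, zero_mul]
  have hidem (i : ℕ) (hi : i < n) :
      aeval (X' i) (v * G) * aeval (X' i) (1 - v * G) = 0 := by
    rw [← map_mul, ← hu]
    exact hz i hi _ ⟨u * v, by ring⟩
  have hFE (i : ℕ) (hi : i < n) : aeval (X' i) F * aeval (X' i) (v * G) = 0 := by
    rw [← map_mul]
    exact hz i hi _ ⟨v, by ring⟩
  have hGE (i : ℕ) (hi : i < n) : aeval (X' i) G * (1 - aeval (X' i) (v * G)) = 0 := by
    rw [← map_one (aeval (X' i) : K[X] →ₐ[K] A), ← map_sub, ← hu, ← map_mul]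
    exact hz i hi _ ⟨u, by ring⟩
  have hquad (h0 : 0 < n) : aeval (X' 0) (specPoly q (-1) 0 * specPoly q Q 0) = 0 :=
    h.aeval_jucysMurphy hq h0
  refine ⟨X', fun i => aeval (X' i) (v * G), ⟨h, rfl, jucysMurphy_mem q T,
    fun i hi a ha => h.jucysMurphy_commute hi ha, fun i hi => h.isAffinePair hq hi,
    fun i => aeval_mem_adjoin_singleton K _, ?_, ?_, ?_,
    fun i hi => (h.isAffinePair hq hi).commute_aeval_add _,
    fun i hi => (h.isAffinePair hq hi).commute_aeval_mul _, ?_, ?_⟩⟩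
  · intro i hi
    have := hidem i hi
    rw [map_sub, map_one, mul_sub, mul_one, sub_eq_zero] at this
    exact this.symm
  · intro h0
    obtain ⟨r, s, hrs⟩ := (hcop n 0)
    have e : aeval (X' 0) (specPoly q (-1) 0 * (v * G)) = 0 := by
      have : specPoly q (-1) 0 * (v * G) = (specPoly q (-1) 0 * specPoly q Q 0) * (s * (v * G)) +
          (F * G) * (r * v * specPoly q (-1) 0) := by
        rw [← mul_one (specPoly q (-1) 0 * (v * G)), ← hrs]
        ring
      rw [this, map_add, map_mul _ (specPoly q (-1) 0 * specPoly q Q 0), hquad h0,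
        map_mul _ (F * G), hFG 0 h0, zero_mul, zero_mul, add_zero]
    rw [map_mul, specPoly, map_sub, aeval_X, aeval_C, map_neg, map_one, sub_neg_eq_add, add_mul,
      one_mul] at e
    exact eq_neg_of_add_eq_zero_left e
  · intro h0
    obtain ⟨r, s, hrs⟩ := (hcop 0 n)
    have e : aeval (X' 0) (specPoly q Q 0 * (u * F)) = 0 := by
      have : specPoly q Q 0 * (u * F) = (specPoly q (-1) 0 * specPoly q Q 0) * (r * (u * F)) +
          (F * G) * (s * u * specPoly q Q 0) := by
        rw [← mul_one (specPoly q Q 0 * (u * F)), ← hrs]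
        ring
      rw [this, map_add, map_mul _ (specPoly q (-1) 0 * specPoly q Q 0), hquad h0,
        map_mul _ (F * G), hFG 0 h0, zero_mul, zero_mul, add_zero]
    rw [map_mul, hu, specPoly, map_sub, aeval_X, aeval_C, map_sub, map_one, sub_mul,
      sub_eq_zero, ← Algebra.smul_def] at e
    exact e
  · intro i hi
    have := (h.isAffinePair hq hi).corner_mem (p := v * G) (p' := 1 - v * G) (hidem _ hi)
    simpa only [map_sub, map_one] using this
  · intro i hi
    have ha := h.isAffinePair hq hi
    obtain ⟨φ, hφ, h1, h2, h3⟩ := ha.exists_intertwiner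
    have key {j : ℕ} (hj : j < n) {e : A} (he : aeval (X' j) (v * G) * e = e) :
        aeval (X' j) F * e = 0 := by
      rw [← he, ← mul_assoc, hFE j hj, zero_mul]
    have key' {j : ℕ} (hj : j < n) {e : A} (he : aeval (X' j) (v * G) * e = 0) :
        aeval (X' j) G * e = 0 := by
      have : e = (1 - aeval (X' j) (v * G)) * e := by rw [sub_mul, he, one_mul, sub_zero]
      rw [this, ← mul_assoc, hGE j hj, zero_mul]
    refine ⟨φ, hφ, h1, h2, IsAffinePair.aeval_intertwine h1 _,
      IsAffinePair.aeval_intertwine h2 _, ?_, ?_⟩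
    · obtain ⟨g, hg, hge⟩ := ha.exists_inverse (F := G) (G := F) (hcop2 n n) (hcop1 n n)
      refine ⟨g, hg, fun e h0 h1 => ?_⟩
      rw [h3]
      exact hge e (key' (by omega) h0) (key hi h1)
    · obtain ⟨g, hg, hge⟩ := ha.exists_inverse (F := F) (G := G) (hcop1 n n) (hcop2 n n)
      refine ⟨g, hg, fun e h0 h1 => ?_⟩
      rw [h3]
      exact hge e (key (by omega) h0) (key' hi h1)

end JucysMurphy

section Idempotents

variable {K : Type} [Field K] {A : Type} [Ring A] [Algebra K A]

/-- The ordered product `a 0 * a 1 * ⋯ * a (k - 1)`. -/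
def rangeProd {M : Type*} [Monoid M] (a : ℕ → M) : ℕ → M
  | 0 => 1
  | k + 1 => rangeProd a k * a k

theorem rangeProd_semiconjBy {M : Type*} [Monoid M] {y : M} {a b : ℕ → M} {k : ℕ}
    (h : ∀ l < k, SemiconjBy y (a l) (b l)) : SemiconjBy y (rangeProd a k) (rangeProd b k) := by
  induction k with
  | zero => exact SemiconjBy.one_right y
  | succ k ih => exact (ih fun l hl => h l (by omega)).mul_right (h k (by omega))

theorem rangeProd_semiconjBy_of_pair {M : Type*} [Monoid M] {y : M} {a b : ℕ → M} {i k : ℕ}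
    (hk : i + 2 ≤ k) (h1 : ∀ l < k, l ≠ i → l ≠ i + 1 → SemiconjBy y (a l) (b l))
    (h2 : SemiconjBy y (a i * a (i + 1)) (b i * b (i + 1))) :
    SemiconjBy y (rangeProd a k) (rangeProd b k) := by
  induction k, hk using Nat.le_induction with
  | base =>
    have := rangeProd_semiconjBy (k := i) fun l hl => h1 l (by omega) (by omega) (by omega)
    simpa only [rangeProd, mul_assoc] using this.mul_right h2
  | succ k hk ih =>
    exact (ih fun l hl => h1 l (by omega)).mul_right (h1 k (by omega) (by omega) (by omega))

/-- The idempotent `E i` if `i ∈ S`, and the complementary idempotent otherwise. -/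
def signed (E : ℕ → A) (S : Finset ℕ) (i : ℕ) : A := if i ∈ S then E i else 1 - E i

theorem signed_of_mem (E : ℕ → A) {S : Finset ℕ} {i : ℕ} (hi : i ∈ S) : signed E S i = E i :=
  if_pos hi

theorem signed_of_notMem (E : ℕ → A) {S : Finset ℕ} {i : ℕ} (hi : i ∉ S) :
    signed E S i = 1 - E i := if_neg hi

theorem signed_congr (E : ℕ → A) {S R : Finset ℕ} {i : ℕ} (hi : i ∈ S ↔ i ∈ R) :
    signed E S i = signed E R i := by
  simp only [signed, hi]

/-- The joint idempotent attached to the set `S` of those indices `i < k` for which `E i` acts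
by `1`. -/
def weightIdem (E : ℕ → A) (S : Finset ℕ) (k : ℕ) : A := rangeProd (signed E S) k

theorem weightIdem_succ (E : ℕ → A) (S : Finset ℕ) (k : ℕ) :
    weightIdem E S (k + 1) = weightIdem E S k * signed E S k := rfl

theorem weightIdem_congr (E : ℕ → A) {S R : Finset ℕ} {k : ℕ} (h : ∀ i < k, i ∈ S ↔ i ∈ R) :
    weightIdem E S k = weightIdem E R k := by
  induction k with
  | zero => rfl
  | succ k ih =>
    rw [weightIdem_succ, weightIdem_succ, ih fun i hi => h i (by omega),
      signed_congr E (h k (by omega))]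

theorem sum_weightIdem (E : ℕ → A) (k : ℕ) :
    ∑ S ∈ (Finset.range k).powerset, weightIdem E S k = 1 := by
  induction k with
  | zero => simp [weightIdem, rangeProd]
  | succ k ih =>
    rw [Finset.range_add_one, Finset.sum_powerset_insert (by simp), ← Finset.sum_add_distrib, ← ih]
    refine Finset.sum_congr rfl fun S hS => ?_
    have hkS : k ∉ S := fun hk => by simpa using Finset.mem_powerset.1 hS hk
    rw [weightIdem_succ, weightIdem_succ, signed_of_notMem E hkS, signed_of_mem E (by simp),
      weightIdem_congr E (S := insert k S) (R := S), ← mul_add, sub_add_cancel, mul_one]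
    intro i hi
    simp [hi.ne]

/-- The subalgebra generated by `X i` for `i < k`. -/
def lattice (K : Type) [Field K] [Algebra K A] (X : ℕ → A) (k : ℕ) : Subalgebra K A :=
  Algebra.adjoin K (X '' Set.Iio k)

theorem mem_lattice {X : ℕ → A} {i k : ℕ} (hi : i < k) : X i ∈ lattice K X k :=
  Algebra.subset_adjoin ⟨i, hi, rfl⟩

theorem lattice_mono (X : ℕ → A) {k l : ℕ} (h : k ≤ l) : lattice K X k ≤ lattice K X l :=
  Algebra.adjoin_mono (Set.image_mono (Set.Iio_subset_Iio h))

namespace IsJM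

variable {q Q : K} {n : ℕ} {T X E : ℕ → A} (h : IsJM q Q n T X E)
include h

theorem lattice_le (k : ℕ) : lattice K X k ≤ parabolicB K T k := by
  refine Algebra.adjoin_le ?_
  rintro _ ⟨i, hi, rfl⟩
  exact parabolicB_mono T hi (h.X_mem i)

theorem X_commute {i j : ℕ} (hi : i < n) (hj : j < n) : Commute (X i) (X j) := by
  rcases lt_trichotomy i j with hij | rfl | hij
  · exact (h.X_comm j hj _ (parabolicB_mono T hij (h.X_mem i))).symm
  · exact Commute.refl _
  · exact h.X_comm i hi _ (parabolicB_mono T hij (h.X_mem j))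

theorem lattice_commute {a b : A} (ha : a ∈ lattice K X n) (hb : b ∈ lattice K X n) :
    Commute a b := by
  refine commute_of_mem_adjoin ?_ hb
  rintro _ ⟨i, hi, rfl⟩
  refine (commute_of_mem_adjoin ?_ ha).symm
  rintro _ ⟨j, hj, rfl⟩
  exact h.X_commute hi hj

theorem E_mem_lattice {i k : ℕ} (hi : i < k) : E i ∈ lattice K X k := by
  refine Algebra.adjoin_le ?_ (h.E_mem i)
  rintro _ rfl
  exact mem_lattice hi

theorem signed_mem_lattice (S : Finset ℕ) {i k : ℕ} (hi : i < k) :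
    signed E S i ∈ lattice K X k := by
  rw [signed]
  split_ifs
  exacts [h.E_mem_lattice hi, sub_mem (one_mem _) (h.E_mem_lattice hi)]

theorem weightIdem_mem_lattice (S : Finset ℕ) (k : ℕ) : weightIdem E S k ∈ lattice K X k := by
  induction k with
  | zero => exact one_mem _
  | succ k ih =>
    exact mul_mem (lattice_mono X (by omega) ih) (h.signed_mem_lattice S (by omega))

theorem weightIdem_mem (S : Finset ℕ) {k l : ℕ} (hkl : k ≤ l) :
    weightIdem E S k ∈ parabolicB K T l :=
  parabolicB_mono T hkl (h.lattice_le k (h.weightIdem_mem_lattice S k))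

theorem E_comm {i : ℕ} (hi : i < n) {a : A} (ha : a ∈ parabolicB K T i) : Commute (E i) a := by
  refine (commute_of_mem_adjoin ?_ (h.E_mem i)).symm
  rintro _ rfl
  exact (h.X_comm i hi a ha).symm

theorem signed_comm (S : Finset ℕ) {i : ℕ} (hi : i < n) {a : A} (ha : a ∈ parabolicB K T i) :
    Commute (signed E S i) a := by
  rw [signed]
  split_ifs
  exacts [h.E_comm hi ha, (Commute.one_left a).sub_left (h.E_comm hi ha)]

theorem T_commute_X {i j : ℕ} (hi : i < n) (hj : j < n) (h1 : i ≠ j) (h2 : i + 1 ≠ j) :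
    Commute (T j) (X i) := by
  rcases Nat.lt_or_ge j i with hij | hij
  · exact (h.X_comm i hi _ (mem_parabolicB hij)).symm
  · exact h.commute_parabolicB (by omega) hj (h.X_mem i)

theorem T_commute_E {i j : ℕ} (hi : i < n) (hj : j < n) (h1 : i ≠ j) (h2 : i + 1 ≠ j) :
    Commute (T j) (E i) := by
  refine commute_of_mem_adjoin ?_ (h.E_mem i)
  rintro _ rfl
  exact h.T_commute_X hi hj h1 h2

theorem E_mul_weightIdem {S : Finset ℕ} {i k : ℕ} (hi : i < k) (hk : k ≤ n) :
    E i * weightIdem E S k = if i ∈ S then weightIdem E S k else 0 := by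
  induction k with
  | zero => omega
  | succ k ih =>
    rw [weightIdem_succ]
    rcases Nat.lt_or_ge i k with hik | hik
    · rw [← mul_assoc, ih hik (by omega)]
      split_ifs
      exacts [rfl, zero_mul _]
    · obtain rfl : i = k := by omega
      rw [← mul_assoc, (h.E_comm hk (h.weightIdem_mem S le_rfl)).eq, mul_assoc, signed]
      split_ifs
      · rw [h.E_idem i hk]
      · rw [mul_sub, mul_one, h.E_idem i hk, sub_self, mul_zero]

theorem signed_mul_weightIdem {S : Finset ℕ} {i k : ℕ} (hi : i < k) (hk : k ≤ n) :
    signed E S i * weightIdem E S k = weightIdem E S k := by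
  rw [signed]
  split_ifs with hS
  · rw [h.E_mul_weightIdem hi hk, if_pos hS]
  · rw [sub_mul, one_mul, h.E_mul_weightIdem hi hk, if_neg hS, sub_zero]

theorem weightIdem_mul_of_le (S : Finset ℕ) {j k : ℕ} (hj : j ≤ k) (hk : k ≤ n) :
    weightIdem E S j * weightIdem E S k = weightIdem E S k := by
  induction j with
  | zero => exact one_mul _
  | succ j ih => rw [weightIdem_succ, mul_assoc, h.signed_mul_weightIdem hj hk, ih (by omega)]

theorem weightIdem_idem (S : Finset ℕ) {k : ℕ} (hk : k ≤ n) :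
    weightIdem E S k * weightIdem E S k = weightIdem E S k :=
  h.weightIdem_mul_of_le S le_rfl hk

theorem weightIdem_commute {a : A} (ha : a ∈ lattice K X n) (S : Finset ℕ) {k : ℕ} (hk : k ≤ n) :
    Commute a (weightIdem E S k) :=
  h.lattice_commute ha (lattice_mono X hk (h.weightIdem_mem_lattice S k))

theorem T_commute_weightIdem {S : Finset ℕ} {i k : ℕ} (hi : i + 1 < k) (hk : k ≤ n)
    (hS : i ∈ S ↔ i + 1 ∈ S) : Commute (T (i + 1)) (weightIdem E S k) := by
  refine rangeProd_semiconjBy_of_pair (i := i) hi ?_ ?_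
  · intro l hl h1 h2
    have := h.T_commute_E (i := l) (j := i + 1) (by omega) (by omega) h2 (by omega)
    rw [signed]
    split_ifs
    exacts [this, (Commute.one_right _).sub_right this]
  · by_cases hi' : i ∈ S
    · rw [signed_of_mem E hi', signed_of_mem E (hS.1 hi')]
      exact h.comm_mul i (by omega)
    · rw [signed_of_notMem E hi', signed_of_notMem E (fun h => hi' (hS.2 h))]
      have e : (1 - E i) * (1 - E (i + 1)) = 1 - (E i + E (i + 1)) + E i * E (i + 1) := by
        noncomm_ring
      rw [e]
      exact ((Commute.one_right _).sub_right (h.comm_add i (by omega))).add_right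
        (h.comm_mul i (by omega))

theorem exists_swap {i k : ℕ} (hi : i + 1 < k) (hk : k ≤ n) :
    ∃ φ ∈ parabolicB K T k, X (i + 1) * φ = φ * X i ∧
      (∀ S R : Finset ℕ, (i ∈ S ↔ i + 1 ∈ R) → (i + 1 ∈ S ↔ i ∈ R) →
        (∀ l, l ≠ i → l ≠ i + 1 → (l ∈ S ↔ l ∈ R)) →
        φ * weightIdem E S k = weightIdem E R k * φ) ∧
      ∀ S : Finset ℕ, (i ∈ S ↔ i + 1 ∉ S) → ∃ g ∈ lattice K X k,
        weightIdem E S k = g * φ * φ * weightIdem E S k := by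
  obtain ⟨φ, hφ, h1, h2, h3, h4, h5, h6⟩ := h.swap i (by omega)
  have hX : Algebra.adjoin K {X i, X (i + 1)} ≤ lattice K X k := by
    refine Algebra.adjoin_le ?_
    rintro _ (rfl | rfl)
    exacts [mem_lattice (by omega), mem_lattice (by omega)]
  refine ⟨φ, ?_, h1.symm, ?_, ?_⟩
  · refine Algebra.adjoin_le ?_ hφ
    rintro _ (rfl | rfl | rfl)
    exacts [mem_parabolicB hi, h.lattice_le k (mem_lattice (by omega)),
      h.lattice_le k (mem_lattice (by omega))]
  · intro S R hS1 hS2 hS3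
    refine rangeProd_semiconjBy_of_pair (i := i) hi ?_ ?_
    · intro l hl hl1 hl2
      rw [signed_congr E (hS3 l hl1 hl2)]
      have : Commute φ (E l) := by
        refine (commute_of_mem_adjoin ?_ hφ).symm
        rintro _ (rfl | rfl | rfl)
        · exact (h.T_commute_E (by omega) (by omega) (by omega) (by omega)).symm
        · exact h.lattice_commute (h.E_mem_lattice (by omega)) (mem_lattice (by omega))
        · exact h.lattice_commute (h.E_mem_lattice (by omega)) (mem_lattice (by omega))
      change Commute φ (signed E R l)
      rw [signed]
      split_ifs
      exacts [this, (Commute.one_right _).sub_right this]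
    · have e1 : SemiconjBy φ (signed E S i) (signed E R (i + 1)) := by
        simp only [signed, hS1]
        split_ifs
        exacts [h3, (SemiconjBy.one_right φ).sub_right h3]
      have e2 : SemiconjBy φ (signed E S (i + 1)) (signed E R i) := by
        simp only [signed, hS2]
        split_ifs
        exacts [h4, (SemiconjBy.one_right φ).sub_right h4]
      rw [(h.lattice_commute (h.signed_mem_lattice R (i := i) (k := n) (by omega))
        (h.signed_mem_lattice R (i := i + 1) (k := n) (by omega))).eq]
      exact e1.mul_right e2
  · intro S hS
    have e1 := h.E_mul_weightIdem (S := S) (i := i) (by omega) hk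
    have e2 := h.E_mul_weightIdem (S := S) (i := i + 1) (by omega) hk
    by_cases hi' : i ∈ S
    · obtain ⟨g, hg, hge⟩ := h6
      rw [if_pos hi'] at e1
      rw [if_neg (hS.1 hi')] at e2
      exact ⟨g, hX hg, by rw [mul_assoc g, hge _ e1 e2]⟩
    · obtain ⟨g, hg, hge⟩ := h5
      rw [if_neg hi'] at e1
      rw [if_pos (by tauto)] at e2
      exact ⟨g, hX hg, by rw [mul_assoc g, hge _ e1 e2]⟩

theorem exists_weightIdem_eq {k : ℕ} (hk : k ≤ n) {S : Finset ℕ} (hS : S ⊆ Finset.range k) :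
    ∃ u ∈ parabolicB K T k, ∃ v ∈ parabolicB K T k,
      weightIdem E S k = u * weightIdem E (Finset.range S.card) k * v := by
  induction hN : ∑ i ∈ S, i using Nat.strong_induction_on generalizing S with
  | _ N ih =>
    by_cases hc : ∃ i, i ∉ S ∧ i + 1 ∈ S
    · obtain ⟨i, hi, hi'⟩ := hc
      have hik : i + 1 < k := Finset.mem_range.1 (hS hi')
      obtain ⟨φ, hφ, -, h1, h2⟩ := h.exists_swap hik hk
      obtain ⟨g, hg, hge⟩ := h2 S (by tauto)
      have hi2 : i ∉ S.erase (i + 1) := fun h => hi (Finset.mem_of_mem_erase h)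
      have hcard : (insert i (S.erase (i + 1))).card = S.card := by
        rw [Finset.card_insert_of_notMem hi2, Finset.card_erase_add_one hi']
      have hsum := Finset.sum_erase_add S (fun i => i) hi'
      obtain ⟨u, hu, v, hv, huv⟩ := ih (∑ i ∈ insert i (S.erase (i + 1)), i)
        (by rw [Finset.sum_insert hi2]; omega)
        (S := insert i (S.erase (i + 1)))
        (Finset.insert_subset (by simp; omega) ((Finset.erase_subset _ _).trans hS)) rfl
      have hsw : φ * weightIdem E S k = weightIdem E (insert i (S.erase (i + 1))) k * φ := by
        refine h1 _ _ ?_ ?_ ?_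
        · simp [hi]
        · simp [hi']
        · intro l hl hl'
          simp [hl, hl']
      refine ⟨g * φ * u, mul_mem (mul_mem (h.lattice_le k hg) hφ) hu, v * φ, mul_mem hv hφ, ?_⟩
      rw [hcard] at huv
      rw [hge, mul_assoc (g * φ), hsw, huv]
      simp only [mul_assoc]
    · push Not at hc
      have hS' : S = Finset.range S.card := by
        have hdown : ∀ d i, i + d ∈ S → i ∈ S := by
          intro d
          induction d with
          | zero => exact fun i hi => hi
          | succ d ihd =>
            intro i hi
            by_contra hcon
            exact hc _ (fun hd => hcon (ihd i hd)) hi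
        refine (Finset.eq_of_subset_of_card_le (fun i hi => ?_) (by simp))
        rw [Finset.mem_range]
        have : Finset.range (i + 1) ⊆ S := fun l hl => by
          rw [Finset.mem_range] at hl
          exact hdown (i - l) l (by rwa [show l + (i - l) = i by omega])
        simpa using Finset.card_le_card this
      exact ⟨1, one_mem _, 1, one_mem _, by rw [← hS', one_mul, mul_one]⟩

theorem X_mul_weightIdem {j k : ℕ} (hj : j < k) (hk : k ≤ n) {S : Finset ℕ}
    (hS : Finset.range j ⊆ S) (hjS : j ∉ S) : X j * weightIdem E S k = Q • weightIdem E S k := by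
  induction j generalizing S with
  | zero =>
    have e := h.signed_mul_weightIdem (S := S) hj hk
    rw [signed_of_notMem E hjS] at e
    rw [← e, ← mul_assoc, h.X_mul_E_compl (by omega), smul_mul_assoc]
  | succ i ih =>
    obtain ⟨φ, hφ, h0, h1, h2⟩ := h.exists_swap hj hk
    have hiS : i ∈ S := hS (by simp)
    obtain ⟨g, hg, hge⟩ := h2 S (by tauto)
    have hsw : φ * weightIdem E S k = weightIdem E (insert (i + 1) (S.erase i)) k * φ := by
      refine h1 _ _ ?_ ?_ ?_
      · simp [hiS]
      · simp [hjS]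
      · intro l hl hl'
        simp [hl, hl']
    have e := ih (by omega) (S := insert (i + 1) (S.erase i))
      (fun l hl => by
        have : l < i := by simpa using hl
        have : l ∈ S := hS (by simp; omega)
        simp only [Finset.mem_insert, Finset.mem_erase]
        right
        exact ⟨by omega, this⟩) (by simp)
    have hXg : Commute (X (i + 1)) g :=
      h.lattice_commute (mem_lattice (by omega)) (lattice_mono X hk hg)
    calc X (i + 1) * weightIdem E S k = X (i + 1) * g * φ * (φ * weightIdem E S k) := by
          conv_lhs => rw [hge]
          simp only [mul_assoc]
      _ = g * φ * (X i * weightIdem E (insert (i + 1) (S.erase i)) k) * φ := by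
          rw [hXg.eq, mul_assoc g, h0, hsw]
          simp only [mul_assoc]
      _ = Q • weightIdem E S k := by
          rw [e, mul_smul_comm, smul_mul_assoc, mul_assoc, ← hsw, ← mul_assoc, ← hge]

end IsJM

end Idempotents

section TypeOrthogonality

open Polynomial

variable {K : Type} [Field K] {A : Type} [Ring A] [Algebra K A]

namespace IsJM

variable {q Q : K} {n : ℕ} {T X E : ℕ → A} (h : IsJM q Q n T X E)
include h

/-- The generating polynomial of the sums of the idempotents `weightIdem E S k` over the sets `S`
of given cardinality is central. -/
theorem C_commute_rangeProd {k : ℕ} (hk : k ≤ n) {a : A} (ha : a ∈ parabolicB K T k) :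
    Commute (C a) (rangeProd (fun i => C (1 - E i) + (Polynomial.X : A[X]) * C (E i)) k) := by
  have hC {y b : A} (hb : Commute y b) : Commute (C y) (C b) := by
    rw [commute_iff_eq, ← C_mul, ← C_mul, hb.eq]
  have hE {y : A} {i : ℕ} (hb : Commute y (E i)) :
      Commute (C y) (C (1 - E i) + (Polynomial.X : A[X]) * C (E i)) :=
    (hC ((Commute.one_right y).sub_right hb)).add_right ((commute_X (C y)).symm.mul_right (hC hb))
  induction ha using Algebra.adjoin_induction with
  | mem z hz =>
    obtain ⟨j, hj, rfl⟩ := hz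
    have hj : j < k := hj
    rcases j with _ | j
    · refine rangeProd_semiconjBy fun l hl => hE ?_
      rw [← h.X_zero]
      exact h.lattice_commute (mem_lattice (by omega)) (h.E_mem_lattice (by omega))
    · refine rangeProd_semiconjBy_of_pair (i := j) hj
        (fun l hl h1 h2 => hE (h.T_commute_E (by omega) (by omega) h2 (by omega))) ?_
      have e : (C (1 - E j) + (Polynomial.X : A[X]) * C (E j)) *
          (C (1 - E (j + 1)) + (Polynomial.X : A[X]) * C (E (j + 1))) =
          1 + (Polynomial.X - 1) * C (E j + E (j + 1)) +
            (Polynomial.X - 1) * ((Polynomial.X - 1) * C (E j * E (j + 1))) := by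
        have e1 (i : ℕ) : C (1 - E i) + (Polynomial.X : A[X]) * C (E i) =
            1 + (Polynomial.X - 1) * C (E i) := by
          rw [C_sub, C_1]
          noncomm_ring
        have e2 : C (E j) * ((Polynomial.X : A[X]) - 1) = (Polynomial.X - 1) * C (E j) :=
          ((commute_X (C (E j))).symm.sub_right (Commute.one_right _)).eq
        rw [e1, e1, add_mul, one_mul, mul_add, mul_one, mul_assoc, ← mul_assoc (C (E j)), e2,
          mul_assoc, C_add, mul_add, C_mul]
        abel
      change Commute _ (_ * _)
      rw [e]
      have e3 : Commute (C (T (j + 1))) ((Polynomial.X : A[X]) - 1) :=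
        (commute_X _).symm.sub_right (Commute.one_right _)
      exact ((Commute.one_right _).add_right
        (e3.mul_right (hC (h.comm_add j (by omega))))).add_right
          (e3.mul_right (e3.mul_right (hC (h.comm_mul j (by omega)))))
  | algebraMap r =>
    exact Algebra.commutes (R := K) (A := A[X]) r _
  | add x y _ _ hx hy =>
    rw [C_add]
    exact hx.add_left hy
  | mul x y _ _ hx hy =>
    rw [C_mul]
    exact hx.mul_left hy

theorem C_weightIdem_mul_rangeProd (S : Finset ℕ) {k : ℕ} (hk : k ≤ n) {l : ℕ} (hl : l ≤ k) :
    C (weightIdem E S k) *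
      rangeProd (fun i => C (1 - E i) + (Polynomial.X : A[X]) * C (E i)) l =
    (Polynomial.X : A[X]) ^ (S ∩ Finset.range l).card * C (weightIdem E S k) := by
  induction l with
  | zero => simp [rangeProd]
  | succ l ih =>
    have e := h.E_mul_weightIdem (S := S) hl hk
    rw [(h.weightIdem_commute (h.E_mem_lattice (by omega)) S hk).eq] at e
    rw [rangeProd, ← mul_assoc, ih (by omega), mul_assoc, mul_add, ← mul_assoc (C _) Polynomial.X,
      ← X_mul_C, mul_assoc Polynomial.X, ← C_mul, ← C_mul, mul_sub, mul_one, e,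
      Finset.range_add_one]
    split_ifs with hS
    · rw [Finset.inter_insert_of_mem hS, Finset.card_insert_of_notMem (by simp), sub_self, C_0,
        zero_add, pow_succ, mul_assoc]
    · rw [Finset.inter_insert_of_notMem hS, sub_zero, C_0, mul_zero, add_zero]

theorem weightIdem_mul_mul_eq_zero {S R : Finset ℕ} {k : ℕ} (hk : k ≤ n)
    (hS : S ⊆ Finset.range k) (hR : R ⊆ Finset.range k) (hSR : S.card ≠ R.card) {a : A}
    (ha : a ∈ parabolicB K T k) : weightIdem E S k * a * weightIdem E R k = 0 := by
  have e1 := h.C_weightIdem_mul_rangeProd S hk le_rfl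
  have e2 := h.C_weightIdem_mul_rangeProd R hk le_rfl
  rw [Finset.inter_eq_left.2 hS] at e1
  rw [Finset.inter_eq_left.2 hR] at e2
  have hR' := (h.C_commute_rangeProd hk (h.weightIdem_mem R le_rfl)).eq
  have ha' := (h.C_commute_rangeProd hk ha).eq
  set x := weightIdem E S k * a * weightIdem E R k with hx
  have e : (Polynomial.X : A[X]) ^ S.card * C x = Polynomial.X ^ R.card * C x := by
    rw [hx, C_mul, C_mul, ← mul_assoc, ← mul_assoc, ← e1, mul_assoc (C (weightIdem E S k)), ← ha',
      mul_assoc, mul_assoc _ (rangeProd _ k), ← hR', e2, ← mul_assoc, ← mul_assoc, ← mul_assoc,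
      ← C_mul, X_pow_mul_C]
  have := congrArg (fun p => p.coeff S.card) e
  simpa [coeff_X_pow_mul', coeff_C, hSR, Nat.sub_eq_zero_iff_le, coeff_X_pow] using this

end IsJM

end TypeOrthogonality

section Corner

variable {K : Type} [Field K] {A : Type} [Ring A] [Algebra K A]

/-- The subalgebra generated by `T j` for `0 < j < k`, `j ≠ m`. -/
def youngA (K : Type) [Field K] [Algebra K A] (T : ℕ → A) (k m : ℕ) : Subalgebra K A :=
  Algebra.adjoin K (T '' {j | 0 < j ∧ j < k ∧ j ≠ m})

theorem mem_youngA {T : ℕ → A} {j k m : ℕ} (h0 : 0 < j) (hj : j < k) (hjm : j ≠ m) :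
    T j ∈ youngA K T k m := Algebra.subset_adjoin ⟨j, ⟨h0, hj, hjm⟩, rfl⟩

/-- The elements `c * weightIdem E (Finset.range m) k` for `c` in `youngA K T k m`. -/
def youngCorner (K : Type) [Field K] [Algebra K A] (T E : ℕ → A) (k m : ℕ) : Submodule K A :=
  (Subalgebra.toSubmodule (youngA K T k m)).map
    (LinearMap.mulRight K (weightIdem E (Finset.range m) k))

theorem mem_youngCorner {T E : ℕ → A} {k m : ℕ} {x : A} : x ∈ youngCorner K T E k m ↔
    ∃ c ∈ youngA K T k m, c * weightIdem E (Finset.range m) k = x := Iff.rfl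

theorem mul_mem_youngCorner {T E : ℕ → A} {k m : ℕ} {c x : A} (hc : c ∈ youngA K T k m)
    (hx : x ∈ youngCorner K T E k m) : c * x ∈ youngCorner K T E k m := by
  obtain ⟨d, hd, rfl⟩ := mem_youngCorner.1 hx
  exact mem_youngCorner.2 ⟨c * d, mul_mem hc hd, mul_assoc _ _ _⟩

theorem weightIdem_mem_youngCorner (T E : ℕ → A) (k m : ℕ) :
    weightIdem E (Finset.range m) k ∈ youngCorner K T E k m :=
  mem_youngCorner.2 ⟨1, one_mem _, one_mul _⟩

namespace IsJM

variable {q Q : K} {n : ℕ} {T X E : ℕ → A} (h : IsJM q Q n T X E)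
include h

theorem youngA_commute {k m : ℕ} (hk : k ≤ n) {c : A} (hc : c ∈ youngA K T k m) :
    Commute c (weightIdem E (Finset.range m) k) := by
  refine (commute_of_mem_adjoin ?_ hc).symm
  rintro _ ⟨j, ⟨h0, hj, hjm⟩, rfl⟩
  obtain ⟨i, rfl⟩ := Nat.exists_eq_succ_of_ne_zero h0.ne'
  exact (h.T_commute_weightIdem hj hk (by simp only [Finset.mem_range]; omega)).symm

theorem youngCorner_mul_mem {k m : ℕ} (hk : k ≤ n) {x y : A}
    (hx : x ∈ youngCorner K T E k m) (hy : y ∈ youngCorner K T E k m) :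
    x * y ∈ youngCorner K T E k m := by
  obtain ⟨c, hc, rfl⟩ := mem_youngCorner.1 hx
  obtain ⟨d, hd, rfl⟩ := mem_youngCorner.1 hy
  refine mem_youngCorner.2 ⟨c * d, mul_mem hc hd, ?_⟩
  rw [mul_assoc c (weightIdem _ _ _), ← mul_assoc _ d, ← (h.youngA_commute hk hd).eq,
    mul_assoc d, h.weightIdem_idem _ hk, mul_assoc]

theorem weightIdem_mul_youngCorner {k m : ℕ} (hk : k ≤ n) {x : A}
    (hx : x ∈ youngCorner K T E k m) : weightIdem E (Finset.range m) k * x = x := by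
  obtain ⟨c, hc, rfl⟩ := mem_youngCorner.1 hx
  rw [← mul_assoc, ← (h.youngA_commute hk hc).eq, mul_assoc, h.weightIdem_idem _ hk]

theorem X_mul_weightIdem_mem {j k m : ℕ} (hj : j < k) (hk : k ≤ n) :
    X j * weightIdem E (Finset.range m) k ∈ youngCorner K T E k m := by
  induction j with
  | zero =>
    rcases Nat.eq_zero_or_pos m with rfl | hm
    · rw [h.X_mul_weightIdem hj hk (by simp) (by simp)]
      exact Submodule.smul_mem _ _ (weightIdem_mem_youngCorner T E k 0)
    · have e := h.E_mul_weightIdem (S := Finset.range m) hj hk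
      rw [if_pos (by simpa using hm)] at e
      rw [← e, ← mul_assoc, h.X_mul_E (by omega), neg_mul, e]
      exact neg_mem (weightIdem_mem_youngCorner T E k m)
  | succ i ih =>
    by_cases him : i + 1 = m
    · rw [h.X_mul_weightIdem hj hk (by rw [him]) (by rw [him]; simp)]
      exact Submodule.smul_mem _ _ (weightIdem_mem_youngCorner T E k m)
    · have ha := h.affine i (by omega)
      have hT : T (i + 1) ∈ youngA K T k m := mem_youngA (by omega) hj him
      have e : X (i + 1) = q⁻¹ • (T (i + 1) * X i * T (i + 1)) := by
        rw [ha.conj, smul_smul, inv_mul_cancel₀ ha.ne_zero, one_smul]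
      rw [e, smul_mul_assoc, mul_assoc, (h.youngA_commute hk hT).eq, mul_assoc, ← mul_assoc (X i)]
      refine Submodule.smul_mem _ _ (mul_mem_youngCorner hT ?_)
      obtain ⟨c, hc, hce⟩ := mem_youngCorner.1 (ih (by omega))
      rw [← hce, mul_assoc, ← (h.youngA_commute hk hT).eq, ← mul_assoc]
      exact mem_youngCorner.2 ⟨_, mul_mem hc hT, rfl⟩

theorem X_mul_mem_youngCorner {j k m : ℕ} (hj : j < k) (hk : k ≤ n) {x : A}
    (hx : x ∈ youngCorner K T E k m) : X j * x ∈ youngCorner K T E k m := by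
  rw [← h.weightIdem_mul_youngCorner hk hx, ← mul_assoc]
  exact h.youngCorner_mul_mem hk (h.X_mul_weightIdem_mem hj hk) hx

omit h in
theorem _root_.parabolicB_zero (T : ℕ → A) : parabolicB K T 0 = ⊥ := by
  simp [parabolicB]

/-- The Mackey decomposition. -/
theorem parabolicB_succ_le {k : ℕ} (hk : k < n) {x : A} (hx : x ∈ parabolicB K T (k + 1))
    {M : Submodule K A} (h1 : ∀ a ∈ parabolicB K T k, a ∈ M)
    (h2 : ∀ a ∈ parabolicB K T k, a * X k ∈ M)
    (h3 : 0 < k → ∀ a ∈ parabolicB K T k, ∀ b ∈ parabolicB K T k, a * T k * b ∈ M) :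
    x ∈ M := by
  suffices x ∈ Submodule.span K ({a | a ∈ parabolicB K T k} ∪
      {a | ∃ b ∈ parabolicB K T k, a = b * X k} ∪
      {a | 0 < k ∧ ∃ b ∈ parabolicB K T k, ∃ c ∈ parabolicB K T k, a = b * T k * c}) by
    refine Submodule.span_le.2 ?_ this
    rintro _ ((ha | ⟨b, hb, rfl⟩) | ⟨h0, b, hb, c, hc, rfl⟩)
    exacts [h1 _ ha, h2 b hb, h3 h0 b hb c hc]
  clear h1 h2 h3 M
  induction k generalizing x with
  | zero =>
    set M := Submodule.span K ({a | a ∈ parabolicB K T 0} ∪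
      {a | ∃ b ∈ parabolicB K T 0, a = b * X 0} ∪
      {a | 0 < 0 ∧ ∃ b ∈ parabolicB K T 0, ∃ c ∈ parabolicB K T 0, a = b * T 0 * c}) with hM
    have h1 : ∀ a ∈ parabolicB K T 0, a ∈ M := fun a ha => Submodule.subset_span (Or.inl (Or.inl ha))
    have h2 : ∀ a ∈ parabolicB K T 0, a * X 0 ∈ M := fun a ha =>
      Submodule.subset_span (Or.inl (Or.inr ⟨a, ha, rfl⟩))
    refine adjoin_le_of_mul_mem (h1 1 (one_mem _)) ?_ hx
    rintro _ ⟨i, hi, rfl⟩ y hy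
    obtain rfl : i = 0 := by have : i < 0 + 1 := hi; omega
    refine (Submodule.span_le (p := M.comap (LinearMap.mulLeft K (T 0)))).2 ?_ hy
    rintro _ ((ha | ⟨b, hb, rfl⟩) | ⟨h0, b, hb, c, hc, rfl⟩)
    · change T 0 * _ ∈ M
      rw [← h.X_zero, (h.X_comm 0 hk _ ha).eq]
      exact h2 _ ha
    · change T 0 * (b * X 0) ∈ M
      rw [← mul_assoc, ← h.X_zero, (h.X_comm 0 hk _ hb).eq, mul_assoc, h.X_zero,
        h.quad_zero hk, mul_add, mul_smul_comm, mul_smul_comm, mul_one, ← h.X_zero]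
      exact add_mem (Submodule.smul_mem _ _ (h2 b hb)) (Submodule.smul_mem _ _ (h1 b hb))
    · omega
  | succ j ih =>
    set k := j + 1 with hkj
    set M := Submodule.span K ({a | a ∈ parabolicB K T k} ∪
      {a | ∃ b ∈ parabolicB K T k, a = b * X k} ∪
      {a | 0 < k ∧ ∃ b ∈ parabolicB K T k, ∃ c ∈ parabolicB K T k, a = b * T k * c}) with hM
    have h1 : ∀ a ∈ parabolicB K T k, a ∈ M := fun a ha => Submodule.subset_span (Or.inl (Or.inl ha))
    have h2 : ∀ a ∈ parabolicB K T k, a * X k ∈ M := fun a ha =>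
      Submodule.subset_span (Or.inl (Or.inr ⟨a, ha, rfl⟩))
    have h3 : ∀ a ∈ parabolicB K T k, ∀ b ∈ parabolicB K T k, a * T k * b ∈ M := fun a ha b hb =>
      Submodule.subset_span (Or.inr ⟨by omega, a, ha, b, hb, rfl⟩)
    have haff := h.affine j hk
    have hXj : X j ∈ parabolicB K T k := h.X_mem j
    have hmono : parabolicB K T j ≤ parabolicB K T k := parabolicB_mono T (by omega)
    have hcomm {a : A} (ha : a ∈ parabolicB K T j) : Commute (T k) a :=
      h.commute_parabolicB (by omega) hk ha
    refine adjoin_le_of_mul_mem (h1 1 (one_mem _)) ?_ hx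
    rintro _ ⟨i, hi, rfl⟩ y hy
    refine (Submodule.span_le (p := M.comap (LinearMap.mulLeft K (T i)))).2 ?_ hy
    rcases Nat.lt_or_ge i k with hik | hik
    · have hTi : T i ∈ parabolicB K T k := mem_parabolicB hik
      rintro _ ((ha | ⟨b, hb, rfl⟩) | ⟨h0, b, hb, c, hc, rfl⟩)
      · exact h1 _ (mul_mem hTi ha)
      · change T i * (b * X k) ∈ M
        rw [← mul_assoc]
        exact h2 _ (mul_mem hTi hb)
      · change T i * (b * T k * c) ∈ M
        rw [← mul_assoc, ← mul_assoc]
        exact h3 _ (mul_mem hTi hb) _ hc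
    · obtain rfl : i = k := by have : i < k + 1 := hi; omega
      rintro _ ((ha | ⟨b, hb, rfl⟩) | ⟨h0, b, hb, c, hc, rfl⟩)
      · change T k * _ ∈ M
        simpa using h3 1 (one_mem _) _ ha
      · change T k * (b * X k) ∈ M
        rw [← (h.X_comm k hk b hb).eq, ← mul_assoc, haff.mul_left', add_mul, smul_mul_assoc,
          (h.X_comm k hk b hb).eq]
        exact add_mem (h3 _ hXj _ hb) (Submodule.smul_mem _ _ (h2 b hb))
      · change T k * (b * T k * c) ∈ M
        have e : b ∈ M.comap ((LinearMap.mulLeft K (T k)).comp (LinearMap.mulRight K (T k * c))) := by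
          refine Submodule.span_le.2 ?_ (ih (by omega) hb)
          rintro _ ((ha | ⟨b, hb, rfl⟩) | ⟨h0, b, hb, c', hc', rfl⟩)
          · rename_i a
            have ha : a ∈ parabolicB K T j := ha
            change T k * (a * (T k * c)) ∈ M
            have e : T k * (a * (T k * c)) = (q - 1) • (a * T k * c) + q • (a * c) := by
              rw [← mul_assoc, (hcomm ha).eq, mul_assoc, ← mul_assoc (T k),
                h.quad k (by omega) hk]
              simp only [add_mul, mul_add, smul_mul_assoc, mul_smul_comm, one_mul, mul_assoc]
            rw [e]
            exact add_mem (Submodule.smul_mem _ _ (h3 _ (hmono ha) _ hc))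
              (Submodule.smul_mem _ _ (h1 _ (mul_mem (hmono ha) hc)))
          · change T k * (b * X j * (T k * c)) ∈ M
            have e : T k * (b * X j * (T k * c)) = q • (b * c * X k) := by
              calc _ = (T k * b) * (X j * T k) * c := by simp only [mul_assoc]
                _ = b * (T k * X j * T k) * c := by rw [(hcomm hb).eq]; simp only [mul_assoc]
                _ = _ := by
                  rw [haff.conj, mul_smul_comm, smul_mul_assoc, mul_assoc, mul_assoc,
                    (h.X_comm k hk c hc).eq]
            rw [e]
            exact Submodule.smul_mem _ _ (h2 _ (mul_mem (hmono hb) hc))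
          · change T k * (b * T j * c' * (T k * c)) ∈ M
            have e : T k * (b * T j * c' * (T k * c)) = (b * T j) * T k * (T j * c' * c) := by
              calc _ = (T k * b) * T j * (c' * T k) * c := by simp only [mul_assoc]
                _ = b * (T k * T j * T k) * c' * c := by
                  rw [(hcomm hb).eq, ← (hcomm hc').eq]
                  simp only [mul_assoc]
                _ = _ := by
                  rw [show T k * T j * T k = T j * T k * T j from h.braid j h0 hk]
                  simp only [mul_assoc]
            have hTj : T j ∈ parabolicB K T k := mem_parabolicB (by omega)
            rw [e]
            exact h3 _ (mul_mem (hmono hb) hTj) _ (mul_mem (mul_mem hTj (hmono hc')) hc)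
        change T k * (b * (T k * c)) ∈ M at e
        rwa [mul_assoc]

end IsJM

end Corner

section CornerSurjective

variable {K : Type} [Field K] {A : Type} [Ring A] [Algebra K A]

theorem youngA_le_succ (T : ℕ → A) {k m : ℕ} : youngA K T k (min m k) ≤ youngA K T (k + 1) m := by
  refine Algebra.adjoin_mono (Set.image_mono ?_)
  rintro j ⟨h0, hj, hjm⟩
  exact ⟨h0, by omega, by omega⟩

theorem weightIdem_range_min (E : ℕ → A) (m k : ℕ) :
    weightIdem E (Finset.range (min m k)) k = weightIdem E (Finset.range m) k :=
  weightIdem_congr E fun i hi => by simp only [Finset.mem_range]; omega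

namespace IsJM

variable {q Q : K} {n : ℕ} {T X E : ℕ → A} (h : IsJM q Q n T X E)
include h

theorem weightIdem_eq_mul_signed {k m : ℕ} (hk : k < n) :
    weightIdem E (Finset.range m) (k + 1) =
      weightIdem E (Finset.range m) (k + 1) * signed E (Finset.range m) k := by
  conv_lhs => rw [← h.signed_mul_weightIdem (S := Finset.range m) (i := k) (k := k + 1)
    (by omega) hk]
  exact (h.weightIdem_commute (h.signed_mem_lattice _ hk) _ hk).eq

theorem weightIdem_mul_mul_mem {k m : ℕ} (hk : k ≤ n) (hm : m ≤ k) {a : A}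
    (ha : a ∈ parabolicB K T k) :
    weightIdem E (Finset.range m) k * a * weightIdem E (Finset.range m) k ∈
      youngCorner K T E k m := by
  induction k generalizing m a with
  | zero =>
    rw [parabolicB_zero, Algebra.mem_bot] at ha
    obtain ⟨r, rfl⟩ := ha
    refine mem_youngCorner.2 ⟨algebraMap K A r, Subalgebra.algebraMap_mem _ r, ?_⟩
    simp [weightIdem, rangeProd]
  | succ k ih =>
    have hk' : k ≤ n := by omega
    set e := weightIdem E (Finset.range m) (k + 1) with he
    set f := weightIdem E (Finset.range m) k with hf
    set ε := signed E (Finset.range m) k with hε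
    have hef : e = f * ε := weightIdem_succ _ _ _
    have hfe : f * e = e := h.weightIdem_mul_of_le _ (by omega) hk
    have hee : e * e = e := h.weightIdem_idem _ hk
    have hεe : ε * e = e := h.signed_mul_weightIdem (by omega) hk
    have heε : e * ε = e := (h.weightIdem_eq_mul_signed hk).symm
    have hεc {b : A} (hb : b ∈ parabolicB K T k) : Commute ε b := h.signed_comm _ hk hb
    have hfA : f ∈ parabolicB K T k := h.weightIdem_mem _ le_rfl
    have hef' : e = ε * f := by rw [hef, (hεc hfA).eq]
    have hXe {b : A} (hb : b ∈ lattice K X n) : Commute b e := h.weightIdem_commute hb _ hk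
    have hA {b : A} (hb : b ∈ parabolicB K T k) : e * b * e ∈ youngCorner K T E (k + 1) m := by
      have := ih hk' (m := min m k) (min_le_right _ _) hb
      rw [mem_youngCorner, weightIdem_range_min] at this
      obtain ⟨c, hc, hce⟩ := this
      refine mem_youngCorner.2 ⟨c, youngA_le_succ T hc, ?_⟩
      calc c * e = f * b * e := by rw [hef, ← mul_assoc, hce, mul_assoc]
        _ = f * b * (ε * e) := by rw [hεe]
        _ = f * (ε * b) * e := by rw [(hεc hb).eq]; simp only [mul_assoc]
        _ = e * b * e := by
          conv_rhs => rw [hef]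
          rw [← mul_assoc]
          rw [hef]
    refine h.parabolicB_succ_le hk ha
      (M := (youngCorner K T E (k + 1) m).comap
        ((LinearMap.mulRight K e).comp (LinearMap.mulLeft K e))) (fun b hb => hA hb) ?_ ?_
    · intro b hb
      change e * (b * X k) * e ∈ youngCorner K T E (k + 1) m
      rw [← mul_assoc, mul_assoc, (hXe (mem_lattice hk)).eq, ← mul_assoc, ← hee, ← mul_assoc,
        mul_assoc, ← (hXe (mem_lattice hk)).eq]
      exact h.youngCorner_mul_mem hk (by rw [hee]; exact hA hb) (h.X_mul_weightIdem_mem (by omega) hk)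
    intro hk0 a ha b hb
    change e * (a * T k * b) * e ∈ youngCorner K T E (k + 1) m
    obtain ⟨j, rfl⟩ := Nat.exists_eq_succ_of_ne_zero hk0.ne'
    rw [Nat.succ_eq_add_one] at *
    have hjA : parabolicB K T j ≤ parabolicB K T (j + 1) := parabolicB_mono T (by omega)
    have hTc {c : A} (hc : c ∈ parabolicB K T j) : Commute (T (j + 1)) c :=
      h.commute_parabolicB (by omega) hk hc
    have hsum : e * (a * T (j + 1) * b) * e = ∑ R ∈ (Finset.range (j + 1)).powerset,
        e * a * weightIdem E R (j + 1) * T (j + 1) * b * e := by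
      simp only [← Finset.sum_mul, ← Finset.mul_sum]
      rw [sum_weightIdem, mul_one]
      simp only [mul_assoc]
    rw [hsum]
    refine Submodule.sum_mem _ fun R hR => ?_
    rw [Finset.mem_powerset] at hR
    have hcard : (Finset.range (min m (j + 1))).card = min m (j + 1) := Finset.card_range _
    by_cases hRm : R.card = min m (j + 1)
    swap
    · have := h.weightIdem_mul_mul_eq_zero hk' (S := Finset.range (min m (j + 1))) (R := R)
        (by simp) hR (by rw [hcard]; exact Ne.symm hRm) ha
      rw [weightIdem_range_min] at this
      rw [hef', mul_assoc ε, mul_assoc ε, this]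
      simp
    have hr : R ∩ Finset.range j ⊆ Finset.range j := Finset.inter_subset_right
    have hRj : weightIdem E R j = weightIdem E (R ∩ Finset.range j) j :=
      weightIdem_congr E fun i hi => by simp [hi]
    by_cases hτ : j ∈ R ∧ m ≤ j + 1
    · -- the last two signs are different
      obtain ⟨hjR, hmj⟩ := hτ
      have hε' : ε = 1 - E (j + 1) := signed_of_notMem E (by simpa using hmj)
      have hjA' : weightIdem E R j ∈ parabolicB K T j := h.weightIdem_mem R le_rfl
      have hEj : E j ∈ parabolicB K T (j + 1) := h.lattice_le _ (h.E_mem_lattice (by omega))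
      have hRe : weightIdem E R (j + 1) = E j * weightIdem E R j := by
        rw [weightIdem_succ, signed_of_mem E hjR, (h.E_comm (by omega) hjA').eq]
      have hRb : weightIdem E R j * b * e = E j * weightIdem E R j * b * e := by
        have hR' : R.erase j ⊆ Finset.range (j + 1) := (Finset.erase_subset _ _).trans hR
        have e0 := h.weightIdem_mul_mul_eq_zero hk' (S := R.erase j)
          (R := Finset.range (min m (j + 1))) hR' (by simp)
          (by
            have := Finset.card_erase_add_one hjR
            rw [hcard]; omega) hb
        rw [weightIdem_range_min, weightIdem_succ, signed_of_notMem E (by simp),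
          weightIdem_congr E (S := R.erase j) (R := R) (k := j) (by
            intro i hi
            simp [hi.ne]), mul_sub, mul_one, ← (h.E_comm (by omega) hjA').eq, sub_mul, sub_mul,
            sub_eq_zero] at e0
        rw [hef, ← mul_assoc, ← mul_assoc, e0]
      have key : ∀ w ∈ Algebra.adjoin K {X j, X (j + 1)}, ∀ a ∈ parabolicB K T (j + 1),
          ∀ b ∈ parabolicB K T (j + 1), e * a * w * b * e ∈ youngCorner K T E (j + 1 + 1) m := by
        intro w hw
        refine adjoin_le_of_mul_mem (S :=
          { carrier := {w | ∀ a ∈ parabolicB K T (j + 1),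
              ∀ b ∈ parabolicB K T (j + 1), e * a * w * b * e ∈ youngCorner K T E (j + 1 + 1) m}
            zero_mem' := fun a _ b _ => by simp
            add_mem' := fun {x y} hx hy a ha b hb => by
              rw [mul_add, add_mul, add_mul]
              exact add_mem (hx a ha b hb) (hy a ha b hb)
            smul_mem' := fun c x hx a ha b hb => by
              rw [mul_smul_comm, smul_mul_assoc, smul_mul_assoc]
              exact Submodule.smul_mem _ _ (hx a ha b hb) }) ?_ ?_ hw
        · intro a ha b hb
          rw [mul_one, mul_assoc e]
          exact hA (mul_mem ha hb)
        · rintro _ (rfl | rfl) w hw a ha b hb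
          · have := hw (a * X j) (mul_mem ha (h.X_mem j)) b hb
            simpa only [mul_assoc] using this
          · have e1 : e * a * (X (j + 1) * w) * b * e = X (j + 1) * (e * a * w * b * e) := by
              rw [← mul_assoc (e * a), mul_assoc e, ← (h.X_comm _ hk a ha).eq, ← mul_assoc,
                ← (hXe (mem_lattice hk)).eq]
              simp only [mul_assoc]
            rw [e1]
            exact h.X_mul_mem_youngCorner (by omega) hk (hw a ha b hb)
      have e1 : e * a * weightIdem E R (j + 1) * T (j + 1) * b * e =
          e * a * (E j * (1 - E (j + 1)) * T (j + 1) * (E j * (1 - E (j + 1)))) *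
            (weightIdem E R j * b) * e := by
        calc _ = e * a * E j * (weightIdem E R j * T (j + 1)) * b * e := by
              rw [hRe]
              simp only [mul_assoc]
          _ = e * a * E j * T (j + 1) * (weightIdem E R j * b * e) := by
              rw [← (hTc hjA').eq]
              simp only [mul_assoc]
          _ = e * ε * a * E j * T (j + 1) * (E j * weightIdem E R j * b * (ε * e)) := by
              rw [hRb, heε, hεe]
          _ = e * (ε * (a * E j)) * T (j + 1) * (E j * (weightIdem E R j * b * ε) * e) := by
              simp only [mul_assoc]
          _ = e * (a * E j * ε) * T (j + 1) * (E j * (ε * (weightIdem E R j * b)) * e) := by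
              rw [(hεc (mul_mem ha hEj)).eq, (hεc (mul_mem (hjA hjA') hb)).eq]
          _ = _ := by
              rw [hε']
              simp only [mul_assoc]
      rw [e1]
      exact key _ (h.corner j hk) a ha _ (mul_mem (hjA hjA') hb)
    · -- the last two signs are equal
      obtain ⟨u, hu, v, hv, huv⟩ := h.exists_weightIdem_eq (k := j) (by omega) hr
      have hmk : m ≠ j + 1 := by
        rintro rfl
        have : R = Finset.range (j + 1) := Finset.eq_of_subset_of_card_le hR (by
          rw [hRm, Finset.card_range, min_self])
        exact hτ ⟨by rw [this]; simp, le_rfl⟩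
      have hT : T (j + 1) ∈ youngA K T (j + 1 + 1) m := mem_youngA (by omega) (by omega) hmk.symm
      have hsj : signed E R j = signed E (Finset.range m) j ∧
          (weightIdem E (Finset.range (R ∩ Finset.range j).card) j =
            weightIdem E (Finset.range m) j) := by
        by_cases hjR : j ∈ R
        · have hm2 : m = j + 2 := by
            by_contra hcon
            exact hτ ⟨hjR, by omega⟩
          have hRr : R = Finset.range (j + 1) := Finset.eq_of_subset_of_card_le hR (by
            rw [hRm, Finset.card_range]; omega)
          refine ⟨signed_congr E (by simp [hjR]; omega), weightIdem_congr E fun i hi => ?_⟩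
          rw [hRr, Finset.inter_eq_right.2 (Finset.range_mono (by omega)), Finset.card_range]
          simp only [Finset.mem_range]
          omega
        · have hRj' : R ⊆ Finset.range j := fun i hi => by
            have h1 := Finset.mem_range.1 (hR hi)
            have h2 : i ≠ j := fun hij => hjR (hij ▸ hi)
            rw [Finset.mem_range]
            omega
          have hc := Finset.card_le_card hRj'
          rw [Finset.card_range] at hc
          refine ⟨signed_congr E (by simp [hjR]; omega), ?_⟩
          rw [Finset.inter_eq_left.2 hRj', show R.card = m by omega]
      have hsv : Commute (signed E R j) v := h.signed_comm R (by omega) hv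
      have hsA : signed E (Finset.range m) j ∈ parabolicB K T (j + 1) :=
        h.lattice_le _ (h.signed_mem_lattice _ (by omega))
      have hA1 : a * u * weightIdem E (Finset.range m) j * signed E (Finset.range m) j ∈
          parabolicB K T (j + 1) :=
        mul_mem (mul_mem (mul_mem ha (hjA hu)) (h.weightIdem_mem _ (by omega))) hsA
      have e1 : e * a * weightIdem E R (j + 1) * T (j + 1) * b * e =
          (e * (a * u) * e) * ((T (j + 1) * e) * (e * (v * b) * e)) := by
        calc _ = e * a * u * weightIdem E (Finset.range m) j *
              (v * signed E R j) * T (j + 1) * b * e := by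
              rw [weightIdem_succ, hRj, huv, hsj.2]
              simp only [mul_assoc]
          _ = e * (a * u * weightIdem E (Finset.range m) j *
              signed E (Finset.range m) j) * (v * T (j + 1)) * b * e := by
              rw [← hsv.eq, hsj.1]
              simp only [mul_assoc]
          _ = e * (ε * (a * u * weightIdem E (Finset.range m) j *
              signed E (Finset.range m) j)) * T (j + 1) * (v * b) * e := by
              rw [← (hTc hv).eq, ← mul_assoc e ε, heε]
              simp only [mul_assoc]
          _ = e * (a * u) * e * T (j + 1) * (v * b) * e := by
              rw [(hεc hA1).eq, hef, hf, weightIdem_succ]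
              simp only [mul_assoc]
          _ = _ := by
              have e2 : e * T (j + 1) = e * T (j + 1) * (e * e) := by
                rw [hee, mul_assoc, (h.youngA_commute hk hT).eq, ← mul_assoc, hee]
              rw [mul_assoc _ e (T (j + 1)), e2]
              simp only [mul_assoc]
      rw [e1]
      exact h.youngCorner_mul_mem hk (hA (mul_mem ha (hjA hu))) (h.youngCorner_mul_mem hk
        (mul_mem_youngCorner hT (weightIdem_mem_youngCorner T E _ m)) (hA (mul_mem (hjA hv) hb)))

end IsJM

end CornerSurjective

section DimensionCount

open scoped TensorProduct Nat

variable {K : Type} [Field K] {A : Type} [Ring A] [Algebra K A]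

theorem AlgHom.range_of_heckeAGen {q : K} {m : ℕ} {T : ℕ → A} {f : HeckeA K q m →ₐ[K] A}
    (hf : ∀ i, 0 < i → i < m → f (heckeAGen q m i) = T i) :
    f.range = Algebra.adjoin K (T '' Set.Ioo 0 m) := by
  rw [← Algebra.map_top, ← adjoin_heckeAGen, AlgHom.map_adjoin, ← Set.image_comp]
  congr 1
  exact Set.image_congr fun i hi => hf i hi.1 hi.2

/-- The tensor product of two algebras of type `A` maps onto `youngA`. -/
theorem IsTypeB.exists_youngHom {q Q : K} {n : ℕ} {T : ℕ → A} (h : IsTypeB q Q n T) {m : ℕ}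
    (hm : m ≤ n) : ∃ ψ : HeckeA K q m ⊗[K] HeckeA K q (n - m) →ₐ[K] A,
      ψ.range = youngA K T n m := by
  have hα : IsTypeA q m T :=
    { quad := fun i h0 hi => h.quad i h0 (by omega)
      braid := fun i h0 hi => h.braid i h0 (by omega)
      comm := fun i j h0 hij hj => h.comm i j h0 hij (by omega) }
  have hβ : IsTypeA q (n - m) fun i => T (m + i) :=
    { quad := fun i h0 hi => h.quad (m + i) (by omega) (by omega)
      braid := fun i h0 hi => h.braid (m + i) (by omega) (by omega)
      comm := fun i j h0 hij hj => h.comm (m + i) (m + j) (by omega) (by omega) (by omega) }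
  obtain ⟨α, hα⟩ := exists_heckeA_lift hα
  obtain ⟨β, hβ⟩ := exists_heckeA_lift hβ
  have hα' := AlgHom.range_of_heckeAGen hα
  have hβ' := AlgHom.range_of_heckeAGen hβ
  have hαm (x) : α x ∈ Algebra.adjoin K (T '' Set.Ioo 0 m) := hα' ▸ ⟨x, rfl⟩
  have hβm (x) : β x ∈ Algebra.adjoin K ((fun i => T (m + i)) '' Set.Ioo 0 (n - m)) :=
    hβ' ▸ ⟨x, rfl⟩
  have hcomm (x y) : Commute (α x) (β y) := by
    refine commute_of_mem_adjoin ?_ (hβm y)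
    rintro _ ⟨j, hj, rfl⟩
    refine (commute_of_mem_adjoin ?_ (hαm x)).symm
    rintro _ ⟨i, hi, rfl⟩
    exact (h.commute (i := i) (j := m + j)
      (by have := hi.2; have := hj.1; omega) (by have := hj.2; omega)).symm
  refine ⟨Algebra.TensorProduct.lift α β hcomm, le_antisymm ?_ (Algebra.adjoin_le ?_)⟩
  · rintro _ ⟨x, rfl⟩
    induction x using TensorProduct.induction_on with
    | zero => simp
    | add x y hx hy =>
      simp only [map_add]
      exact add_mem hx hy
    | tmul x y =>
      refine mul_mem (Algebra.adjoin_mono (Set.image_mono ?_) (hαm x))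
        (Algebra.adjoin_mono ?_ (hβm y))
      · rintro i ⟨h0, hi⟩
        exact ⟨h0, by omega, by omega⟩
      · rintro _ ⟨i, ⟨h0, hi⟩, rfl⟩
        exact ⟨m + i, ⟨by omega, by omega, by omega⟩, rfl⟩
  · rintro _ ⟨j, ⟨h0, hj, hjm⟩, rfl⟩
    rcases Nat.lt_or_gt_of_ne hjm with hjm | hjm
    · exact ⟨heckeAGen q m j ⊗ₜ 1, by simp [hα j h0 hjm]⟩
    · refine ⟨1 ⊗ₜ heckeAGen q (n - m) (j - m), ?_⟩
      have := hβ (j - m) (by omega) (by omega)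
      simp only [show m + (j - m) = j by omega] at this
      simp [this]

theorem finrank_heckeA_tensor_le (q : K) (m k : ℕ) :
    Module.finrank K (HeckeA K q m ⊗[K] HeckeA K q k) ≤ m ! * k ! := by
  rw [Module.finrank_tensorProduct]
  exact Nat.mul_le_mul (finrank_heckeA_le q m) (finrank_heckeA_le q k)

namespace IsJM

variable {q Q : K} {n : ℕ} {T X E : ℕ → A} (h : IsJM q Q n T X E)
include h

theorem finrank_le (hT : parabolicB K T n = ⊤)
    (hfin : ∀ m ≤ n, Module.Finite K (youngCorner K T E n m)) :
    Module.rank K A ≤ (∑ S ∈ (Finset.range n).powerset, n.choose S.card *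
      Module.finrank K (youngCorner K T E n S.card) : ℕ) := by
  have hmem (a : A) : a ∈ parabolicB K T n := hT ▸ Algebra.mem_top
  have hex (S : (Finset.range n).powerset) := h.exists_weightIdem_eq le_rfl
    (Finset.mem_powerset.1 S.2)
  choose u hu v hv huv using hex
  have hc (S : (Finset.range n).powerset) : S.1.card ≤ n := by
    simpa using Finset.card_le_card (Finset.mem_powerset.1 S.2)
  let D (p : (Finset.range n).powerset × (Finset.range n).powerset) : Submodule K A :=
    if p.1.1.card = p.2.1.card then youngCorner K T E n p.1.1.card else ⊥
  have hD (p) : Module.Finite K (D p) := by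
    by_cases hp : p.1.1.card = p.2.1.card
    · rw [show D p = _ from if_pos hp]
      exact hfin _ (hc _)
    · rw [show D p = _ from if_neg hp]
      infer_instance
  let f (p : (Finset.range n).powerset × (Finset.range n).powerset) : A →ₗ[K] D p :=
    LinearMap.codRestrict (D p)
      ((LinearMap.mulLeft K (weightIdem E (Finset.range p.1.1.card) n * v p.1)).comp
        (LinearMap.mulRight K (u p.2 * weightIdem E (Finset.range p.2.1.card) n))) (by
        intro x
        have hx := hmem (v p.1 * x * u p.2)
        have e : ((LinearMap.mulLeft K (weightIdem E (Finset.range p.1.1.card) n * v p.1)).comp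
            (LinearMap.mulRight K (u p.2 * weightIdem E (Finset.range p.2.1.card) n))) x =
            weightIdem E (Finset.range p.1.1.card) n * (v p.1 * x * u p.2) *
              weightIdem E (Finset.range p.2.1.card) n := by
          simp only [LinearMap.comp_apply, LinearMap.mulLeft_apply, LinearMap.mulRight_apply,
            mul_assoc]
        rw [e]
        simp only [D]
        split_ifs with hp
        · rw [← hp]
          exact h.weightIdem_mul_mul_mem le_rfl (hc _) hx
        · rw [Submodule.mem_bot]
          exact h.weightIdem_mul_mul_eq_zero le_rfl (Finset.range_mono (hc _))
            (Finset.range_mono (hc _)) (by simpa using hp) hx)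
  have hinj : Function.Injective (LinearMap.pi f) := by
    rw [injective_iff_map_eq_zero]
    intro x hx
    have h0 (S R : (Finset.range n).powerset) :
        weightIdem E S.1 n * x * weightIdem E R.1 n = 0 := by
      have e : ((f (S, R) x : D (S, R)) : A) = 0 := by
        have := congrFun hx (S, R)
        rw [LinearMap.pi_apply] at this
        rw [this]
        rfl
      have e : weightIdem E (Finset.range S.1.card) n * v S *
        (x * (u R * weightIdem E (Finset.range R.1.card) n)) = 0 := e
      calc _ = u S * (weightIdem E (Finset.range S.1.card) n * v S *
            (x * (u R * weightIdem E (Finset.range R.1.card) n))) * v R := by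
            rw [huv S, huv R]
            simp only [mul_assoc]
        _ = 0 := by rw [e, mul_zero, zero_mul]
    calc x = (∑ S ∈ (Finset.range n).powerset, weightIdem E S n) * x *
          ∑ R ∈ (Finset.range n).powerset, weightIdem E R n := by
          rw [sum_weightIdem, one_mul, mul_one]
      _ = 0 := by
        rw [Finset.sum_mul, Finset.sum_mul]
        refine Finset.sum_eq_zero fun S hS => ?_
        rw [Finset.mul_sum]
        exact Finset.sum_eq_zero fun R hR => h0 ⟨S, hS⟩ ⟨R, hR⟩
  refine (LinearMap.rank_le_of_injective _ hinj).trans ?_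
  rw [← Module.finrank_eq_rank, Module.finrank_pi_fintype]
  refine Nat.cast_le.2 (le_of_eq ?_)
  rw [Fintype.sum_prod_type]
  have e1 (S R : (Finset.range n).powerset) : Module.finrank K (D (S, R)) =
      if R.1.card = S.1.card then Module.finrank K (youngCorner K T E n S.1.card) else 0 := by
    split_ifs with hp
    · rw [show D (S, R) = _ from if_pos hp.symm]
    · rw [show D (S, R) = _ from if_neg (Ne.symm hp), finrank_bot]
  simp only [e1]
  rw [Finset.sum_coe_sort (Finset.range n).powerset (fun S =>
    ∑ R : (Finset.range n).powerset, if R.1.card = S.card then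
      Module.finrank K (youngCorner K T E n S.card) else 0)]
  refine Finset.sum_congr rfl fun S hS => ?_
  rw [Finset.sum_coe_sort (Finset.range n).powerset (fun R => if R.card = S.card then
      Module.finrank K (youngCorner K T E n S.card) else 0), ← Finset.sum_filter,
      Finset.sum_const, ← Finset.powersetCard_eq_filter, Finset.card_powersetCard,
      Finset.card_range, smul_eq_mul]

theorem exists_youngHom {m : ℕ} (hm : m ≤ n) :
    ∃ ψ : HeckeA K q m ⊗[K] HeckeA K q (n - m) →ₐ[K] A, ψ.range = youngA K T n m ∧
      LinearMap.range ((LinearMap.mulRight K (weightIdem E (Finset.range m) n)).comp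
        ψ.toLinearMap) = youngCorner K T E n m := by
  obtain ⟨ψ, hψ⟩ := h.toIsTypeB.exists_youngHom hm
  refine ⟨ψ, hψ, ?_⟩
  rw [LinearMap.range_comp, youngCorner, ← hψ]
  rfl

theorem finrank_youngCorner_le {m : ℕ} (hm : m ≤ n) :
    Module.finrank K (youngCorner K T E n m) ≤ m ! * (n - m)! := by
  obtain ⟨ψ, -, hψ⟩ := h.exists_youngHom hm
  rw [← hψ]
  exact (LinearMap.finrank_range_le _).trans (finrank_heckeA_tensor_le q _ _)

theorem le_finrank_youngCorner (hT : parabolicB K T n = ⊤)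
    (hrank : ((2 ^ n * n ! : ℕ) : Cardinal) ≤ Module.rank K A) {m : ℕ} (hm : m ≤ n) :
    m ! * (n - m)! ≤ Module.finrank K (youngCorner K T E n m) := by
  have hfin : ∀ m ≤ n, Module.Finite K (youngCorner K T E n m) := fun m hm => by
    obtain ⟨ψ, -, hψ⟩ := h.exists_youngHom hm
    rw [← hψ]
    infer_instance
  by_contra! hlt
  have hle := Nat.cast_le.1 (hrank.trans (h.finrank_le hT hfin))
  refine absurd hle (not_le.2 ?_)
  have e : 2 ^ n * n ! = ∑ S ∈ (Finset.range n).powerset, n ! := by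
    rw [Finset.sum_const, Finset.card_powerset, Finset.card_range, smul_eq_mul]
  have hS {k : ℕ} (hk : k ≤ n) : n ! = n.choose k * (k ! * (n - k)!) := by
    rw [← Nat.choose_mul_factorial_mul_factorial hk, mul_assoc]
  rw [e]
  refine Finset.sum_lt_sum (fun S hS' => ?_) ⟨Finset.range m, ?_, ?_⟩
  · have hc : S.card ≤ n := by simpa using Finset.card_le_card (Finset.mem_powerset.1 hS')
    rw [hS hc]
    exact Nat.mul_le_mul_left _ (h.finrank_youngCorner_le hc)
  · exact Finset.mem_powerset.2 (Finset.range_mono hm)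
  · rw [Finset.card_range, hS hm]
    exact Nat.mul_lt_mul_of_pos_left hlt (Nat.choose_pos hm)

end IsJM

end DimensionCount

section Assembly

open scoped TensorProduct Nat

theorem eq_zero_of_mul_eq_zero_of_finrank_le {K A B : Type*} [Field K] [Ring A] [Algebra K A]
    [Ring B] [Algebra K B] [Module.Finite K B] (f : B →ₐ[K] A) (a : A)
    (hf : Module.finrank K B ≤
      Module.finrank K (LinearMap.range ((LinearMap.mulRight K a).comp f.toLinearMap)))
    {x : B} (hx : f x * a = 0) : x = 0 := by
  have := ((LinearMap.mulRight K a).comp f.toLinearMap).finrank_range_add_finrank_ker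
  have hker := LinearMap.ker_eq_bot.1 (Submodule.finrank_eq_zero.1
    (show Module.finrank K (LinearMap.ker ((LinearMap.mulRight K a).comp f.toLinearMap)) = 0 by
      omega))
  exact (injective_iff_map_eq_zero _).1 hker x hx

variable {K : Type} [Field K] {A : Type} [Ring A] [Algebra K A]

namespace IsJM

variable {q Q : K} {n : ℕ} {T X E : ℕ → A} (h : IsJM q Q n T X E)
include h

theorem moritaEquivalentOver (hT : parabolicB K T n = ⊤)
    (hrank : ((2 ^ n * n ! : ℕ) : Cardinal) ≤ Module.rank K A) :
    MoritaEquivalentOver K A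
      (∀ m : Fin (n + 1), HeckeA K q (m : ℕ) ⊗[K] HeckeA K q (n - (m : ℕ))) := by
  have hmem (a : A) : a ∈ parabolicB K T n := hT ▸ Algebra.mem_top
  choose ψ hψ hψ' using fun m : Fin (n + 1) => h.exists_youngHom (Nat.lt_succ_iff.1 m.2)
  set e : Fin (n + 1) → A := fun m => weightIdem E (Finset.range m) n with he
  have hee (m) : e m * e m = e m := h.weightIdem_idem _ le_rfl
  have horth (a : A) {m l : Fin (n + 1)} (hml : m ≠ l) : e m * a * e l = 0 :=
    h.weightIdem_mul_mul_eq_zero le_rfl (Finset.range_mono (Nat.lt_succ_iff.1 m.2))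
      (Finset.range_mono (Nat.lt_succ_iff.1 l.2))
      (by simpa [Fin.val_inj] using hml) (hmem a)
  have hcomm (m) (x) : ψ m x * e m = e m * ψ m x :=
    h.youngA_commute le_rfl (hψ m ▸ ⟨x, rfl⟩)
  have hinj (m : Fin (n + 1)) (x) (hx : ψ m x * e m = 0) : x = 0 := by
    refine eq_zero_of_mul_eq_zero_of_finrank_le
      (B := HeckeA K q (m : ℕ) ⊗[K] HeckeA K q (n - (m : ℕ))) (ψ m) (e m) ?_ hx
    rw [hψ' m]
    exact (finrank_heckeA_tensor_le q (m : ℕ) (n - m)).trans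
      (h.le_finrank_youngCorner hT hrank (Nat.lt_succ_iff.1 m.2))
  let Φ : (∀ m : Fin (n + 1), HeckeA K q (m : ℕ) ⊗[K] HeckeA K q (n - (m : ℕ))) →ₙ+* A :=
    { toFun := fun b => ∑ m, ψ m (b m) * e m
      map_zero' := by simp
      map_add' := fun b c => by simp [add_mul, Finset.sum_add_distrib]
      map_mul' := fun b c => by
        rw [Finset.sum_mul]
        refine Finset.sum_congr rfl fun m _ => ?_
        rw [Finset.mul_sum, Finset.sum_eq_single m]
        · rw [Pi.mul_apply, map_mul, mul_assoc (ψ m (b m)), mul_assoc (ψ m (b m)), ← mul_assoc (e m),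
            ← hcomm, mul_assoc _ (e m), hee]
        · intro l _ hl
          rw [mul_assoc, ← mul_assoc (e m), horth _ hl.symm, mul_zero]
        · simp }
  have hΦ (b) : Φ b = ∑ m, ψ m (b m) * e m := rfl
  have hΦ1 : Φ 1 = ∑ m, e m := by simp [hΦ]
  have heΦ (m b) : e m * Φ b = ψ m (b m) * e m := by
    rw [hΦ, Finset.mul_sum, Finset.sum_eq_single m]
    · rw [hcomm, ← mul_assoc, hee]
    · intro l _ hl
      rw [← mul_assoc, horth _ hl.symm]
    · simp
  have hex (S : (Finset.range n).powerset) := h.exists_weightIdem_eq le_rfl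
    (Finset.mem_powerset.1 S.2)
  choose u hu v hv huv using hex
  refine MoritaEquivalentOver.of_full_idempotent K Φ ?_ ?_ ?_ (Finset.range n).powerset.attach
    (fun S => u S * weightIdem E (Finset.range S.1.card) n)
    (fun S => weightIdem E (Finset.range S.1.card) n * v S) ?_
  · intro c b
    simp [hΦ, Finset.smul_sum]
  · rw [injective_iff_map_eq_zero]
    intro b hb
    funext m
    refine hinj m _ ?_
    rw [← heΦ, hb, mul_zero]
  · intro a
    have (m : Fin (n + 1)) : ∃ x, ψ m x * e m = e m * a * e m := by
      have := h.weightIdem_mul_mul_mem le_rfl (Nat.lt_succ_iff.1 m.2) (hmem a)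
      rw [← hψ' m] at this
      exact this
    choose b hb using this
    refine ⟨b, ?_⟩
    rw [hΦ1, hΦ, Finset.sum_mul, Finset.sum_mul]
    refine Finset.sum_congr rfl fun m _ => ?_
    rw [Finset.mul_sum, Finset.sum_eq_single m (fun l _ hl => horth a hl.symm) (by simp), hb]
  · rw [← sum_weightIdem E n,
      ← Finset.sum_attach (Finset.range n).powerset (fun S => weightIdem E S n)]
    refine Finset.sum_congr rfl fun S _ => ?_
    have hc : S.1.card ≤ n := by simpa using Finset.card_le_card (Finset.mem_powerset.1 S.2)
    have e1 : e ⟨S.1.card, by omega⟩ * Φ 1 * e ⟨S.1.card, by omega⟩ = e ⟨S.1.card, by omega⟩ := by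
      rw [heΦ, Pi.one_apply, map_one, one_mul, hee]
    have e1 : weightIdem E (Finset.range S.1.card) n * Φ 1 * weightIdem E (Finset.range S.1.card) n =
      weightIdem E (Finset.range S.1.card) n := e1
    rw [huv, ← mul_assoc, mul_assoc (u S), mul_assoc (u S), e1]

end IsJM

end Assembly

open scoped TensorProduct in
theorem heckeB_morita_equivalent_of_generic_Q
    (K : Type) [Field K] (q Q : K) (hq : q ≠ 0) (hQ : Q ≠ 0)
    (hgen : ∀ f : ℤ, Q ≠ -q ^ f) (n : ℕ) (hn : 1 ≤ n) :
    MoritaEquivalentOver K (HeckeB K (-1) Q q n)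
      (∀ m : Fin (n + 1), HeckeA K q (m : ℕ) ⊗[K] HeckeA K q (n - (m : ℕ))) := by
  obtain ⟨X, E, h⟩ := (isTypeB_heckeBGen q Q n).exists_isJM hq hgen
  exact h.moritaEquivalentOver (adjoin_heckeBGen q Q n) (rank_heckeB_ge q Q n)
end

section
/- Let A be a finite-dimensional algebra over a field K and let B be a subalgebra of A such that B is a direct summand of A as a (B,B)-bimodule, i.e., there is a (B,B)-sub-bimodule M of A with A = B ⊕ M. If A has finite representation type then B has finite representation type; equivalently, if B has infinite representation type then so does A. -/
/-- A finite-dimensional right `A`-module, where `A` is a `K`-algebra.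
Right modules are modules over the opposite ring `Aᵐᵒᵖ`. -/
structure FDRightModule (K A : Type) [Field K] [Ring A] [Algebra K A] : Type 1 where
  carrier : Type
  [isAddCommGroup : AddCommGroup carrier]
  [isModuleK : Module K carrier]
  [isModuleA : Module Aᵐᵒᵖ carrier]
  [isTower : IsScalarTower K Aᵐᵒᵖ carrier]
  [isFinDim : FiniteDimensional K carrier]

attribute [instance] FDRightModule.isAddCommGroup FDRightModule.isModuleK
  FDRightModule.isModuleA FDRightModule.isTower FDRightModule.isFinDim

/-- A module is indecomposable if it is nonzero and is not the (internal) direct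
sum of two nonzero submodules. -/
def IsIndecomposableModule (R M : Type*) [Ring R] [AddCommGroup M] [Module R M] : Prop :=
  Nontrivial M ∧ ∀ N₁ N₂ : Submodule R M, IsCompl N₁ N₂ → N₁ = ⊥ ∨ N₂ = ⊥

/-- A `K`-algebra `A` has finite representation type if there are only finitely many
isomorphism classes of indecomposable finite-dimensional right `A`-modules. -/
def HasFiniteRepresentationType (K A : Type) [Field K] [Ring A] [Algebra K A] : Prop :=
  Finite (Quot fun M N : {M : FDRightModule K A // IsIndecomposableModule Aᵐᵒᵖ M.carrier} =>
    Nonempty (M.1.carrier ≃ₗ[Aᵐᵒᵖ] N.1.carrier))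

open MulOpposite

/-- `X` is isomorphic to a direct summand of `V`. -/
def IsModuleRetract (R X V : Type*) [Ring R] [AddCommGroup X] [Module R X]
    [AddCommGroup V] [Module R V] : Prop :=
  ∃ (i : X →ₗ[R] V) (r : V →ₗ[R] X), r ∘ₗ i = LinearMap.id

section Indecomposable

variable {R X V V₁ V₂ : Type*} [Ring R] [AddCommGroup X] [Module R X]
  [AddCommGroup V] [Module R V] [AddCommGroup V₁] [Module R V₁] [AddCommGroup V₂] [Module R V₂]

theorem IsModuleRetract.of_bijective (i : X →ₗ[R] V) (r : V →ₗ[R] X)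
    (h : Function.Bijective (r ∘ₗ i)) : IsModuleRetract R X V := by
  let e := LinearEquiv.ofBijective (r ∘ₗ i) h
  refine ⟨i, e.symm.toLinearMap ∘ₗ r, ?_⟩
  ext x
  exact e.symm_apply_apply x

theorem IsModuleRetract.trans (h : IsModuleRetract R X V) (h' : IsModuleRetract R V V₁) :
    IsModuleRetract R X V₁ := by
  obtain ⟨i, r, h⟩ := h
  obtain ⟨j, s, h'⟩ := h'
  refine ⟨j ∘ₗ i, r ∘ₗ s, LinearMap.ext fun x => ?_⟩
  have h₁ : r (i x) = x := LinearMap.congr_fun h x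
  have h₂ : s (j (i x)) = i x := LinearMap.congr_fun h' (i x)
  simp [h₁, h₂]

theorem IsModuleRetract.nontrivial [Nontrivial X] (h : IsModuleRetract R X V) :
    Nontrivial V := by
  obtain ⟨i, r, h⟩ := h
  exact (Function.LeftInverse.injective (g := r) (f := i) (LinearMap.congr_fun h)).nontrivial

/-- Fitting's lemma: endomorphisms of an indecomposable module of finite length are
bijective or nilpotent. -/
theorem IsIndecomposableModule.bijective_or_isNilpotent [IsNoetherian R X] [IsArtinian R X]
    (hX : IsIndecomposableModule R X) (f : Module.End R X) :
    Function.Bijective f ∨ IsNilpotent f := by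
  obtain ⟨n, hn, hc⟩ := ((Filter.eventually_ge_atTop 1).and
    f.eventually_isCompl_ker_pow_range_pow).exists
  rcases hX.2 _ _ hc with h | h
  · left
    have hinj : Function.Injective f := by
      have := LinearMap.ker_eq_bot.mp h
      obtain ⟨m, rfl⟩ := Nat.exists_eq_add_of_le' hn
      rw [pow_succ, Module.End.mul_eq_comp, LinearMap.coe_comp] at this
      exact this.of_comp
    exact IsArtinian.bijective_of_injective_endomorphism f hinj
  · exact Or.inr ⟨n, LinearMap.range_eq_bot.mp h⟩

theorem IsIndecomposableModule.bijective_or_bijective_of_add_eq_one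
    [IsNoetherian R X] [IsArtinian R X]
    (hX : IsIndecomposableModule R X) {f g : Module.End R X} (h : f + g = 1) :
    Function.Bijective f ∨ Function.Bijective g := by
  rcases hX.bijective_or_isNilpotent f with hf | hf
  · exact Or.inl hf
  · right
    rw [← Module.End.isUnit_iff, eq_sub_of_add_eq' h]
    exact hf.isUnit_one_sub

/-- An indecomposable direct summand of `V₁ ⊕ V₂` is a direct summand of `V₁` or of `V₂`. -/
theorem IsIndecomposableModule.isModuleRetract_or [IsNoetherian R X] [IsArtinian R X]
    (hX : IsIndecomposableModule R X) (h : IsModuleRetract R X V)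
    (p₁ : V →ₗ[R] V₁) (q₁ : V₁ →ₗ[R] V) (p₂ : V →ₗ[R] V₂) (q₂ : V₂ →ₗ[R] V)
    (hpq : ∀ v, q₁ (p₁ v) + q₂ (p₂ v) = v) :
    IsModuleRetract R X V₁ ∨ IsModuleRetract R X V₂ := by
  obtain ⟨i, r, h⟩ := h
  have hsum : (((r ∘ₗ q₁) ∘ₗ (p₁ ∘ₗ i) : X →ₗ[R] X) : Module.End R X) +
      (r ∘ₗ q₂) ∘ₗ (p₂ ∘ₗ i) = 1 := by
    ext x
    simpa [← map_add, hpq] using LinearMap.congr_fun h x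
  exact (hX.bijective_or_bijective_of_add_eq_one hsum).imp
    (IsModuleRetract.of_bijective _ _) (IsModuleRetract.of_bijective _ _)

theorem IsIndecomposableModule.nonempty_equiv_of_isModuleRetract [Nontrivial X]
    (hV : IsIndecomposableModule R V) (h : IsModuleRetract R X V) : Nonempty (X ≃ₗ[R] V) := by
  obtain ⟨i, r, h⟩ := h
  have hi : Function.Injective i := Function.LeftInverse.injective (LinearMap.congr_fun h)
  refine ⟨LinearEquiv.ofBijective i ⟨hi, ?_⟩⟩
  rcases hV.2 _ _ (LinearMap.isCompl_of_proj (f := i.rangeRestrict ∘ₗ r) (by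
      rintro ⟨_, x, rfl⟩
      exact Subtype.ext (congrArg i (LinearMap.congr_fun h x)))) with hr | hk
  · obtain ⟨x, hx⟩ := exists_ne (0 : X)
    exact absurd (hi (by simpa using LinearMap.congr_fun (LinearMap.range_eq_bot.mp hr) x)) hx
  · rw [← LinearMap.range_eq_top, eq_top_iff]
    intro v _
    have hv : v - i (r v) ∈ LinearMap.ker (i.rangeRestrict ∘ₗ r) := by
      rw [LinearMap.mem_ker, LinearMap.comp_apply, map_sub,
        show r (i (r v)) = r v from LinearMap.congr_fun h (r v), sub_self, map_zero]
    rw [hk, Submodule.mem_bot, sub_eq_zero] at hv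
    exact ⟨r v, hv.symm⟩

end Indecomposable

namespace FDRightModule

variable {K A : Type} [Field K] [Ring A] [Algebra K A]

instance (V : FDRightModule K A) : IsNoetherian Aᵐᵒᵖ V.carrier :=
  isNoetherian_of_tower K inferInstance

instance (V : FDRightModule K A) : IsArtinian Aᵐᵒᵖ V.carrier :=
  isArtinian_of_tower K inferInstance

/-- A submodule of a finite-dimensional right module. -/
def ofSubmodule (V : FDRightModule K A) (N : Submodule Aᵐᵒᵖ V.carrier) : FDRightModule K A where
  carrier := N
  isFinDim := inferInstanceAs (FiniteDimensional K (N.restrictScalars K))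

theorem finrank_ofSubmodule_lt (V : FDRightModule K A) {N : Submodule Aᵐᵒᵖ V.carrier}
    (hN : N ≠ ⊤) : Module.finrank K (V.ofSubmodule N).carrier < Module.finrank K V.carrier :=
  Submodule.finrank_lt (s := N.restrictScalars K)
    (by simpa [lt_top_iff_ne_top] using hN)

theorem exists_decomposition (V : FDRightModule K A) [Nontrivial V.carrier]
    (hV : ¬ IsIndecomposableModule Aᵐᵒᵖ V.carrier) :
    ∃ V₁ V₂ : FDRightModule K A,
      Module.finrank K V₁.carrier < Module.finrank K V.carrier ∧
      Module.finrank K V₂.carrier < Module.finrank K V.carrier ∧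
      ∃ (p₁ : V.carrier →ₗ[Aᵐᵒᵖ] V₁.carrier) (q₁ : V₁.carrier →ₗ[Aᵐᵒᵖ] V.carrier)
        (p₂ : V.carrier →ₗ[Aᵐᵒᵖ] V₂.carrier) (q₂ : V₂.carrier →ₗ[Aᵐᵒᵖ] V.carrier),
        ∀ v, q₁ (p₁ v) + q₂ (p₂ v) = v := by
  simp only [IsIndecomposableModule, not_and, not_forall, not_or] at hV
  obtain ⟨N₁, N₂, hc, h₁, h₂⟩ := hV inferInstance
  refine ⟨V.ofSubmodule N₁, V.ofSubmodule N₂, V.finrank_ofSubmodule_lt ?_,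
    V.finrank_ofSubmodule_lt ?_, N₁.projectionOnto N₂ hc, N₁.subtype,
    N₂.projectionOnto N₁ hc.symm, N₂.subtype, fun v => ?_⟩
  · rintro rfl
    exact h₂ (top_disjoint.mp hc.disjoint)
  · rintro rfl
    exact h₁ (disjoint_top.mp hc.disjoint)
  · exact Submodule.projection_add_projection_eq_self hc v

/-- Restriction of scalars to a subalgebra. -/
def restrict (B : Subalgebra K A) (V : FDRightModule K A) : FDRightModule K B where
  carrier := V.carrier
  isModuleA := Module.compHom V.carrier B.val.toRingHom.op
  isTower := by
    let := Module.compHom V.carrier B.val.toRingHom.op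
    exact ⟨fun k b v => smul_assoc k (op ((unop b : B) : A)) v⟩

/-- Restriction of scalars to a subalgebra, on morphisms. -/
def restrictMap (B : Subalgebra K A) {V W : FDRightModule K A}
    (f : V.carrier →ₗ[Aᵐᵒᵖ] W.carrier) :
    (V.restrict B).carrier →ₗ[Bᵐᵒᵖ] (W.restrict B).carrier where
  toFun := f
  map_add' := f.map_add
  map_smul' b v := f.map_smul (op ((unop b : B) : A)) v

theorem exists_indecomposable_isModuleRetract {B : Subalgebra K A} (X : FDRightModule K B)
    (hX : IsIndecomposableModule Bᵐᵒᵖ X.carrier) (V : FDRightModule K A)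
    (h : IsModuleRetract Bᵐᵒᵖ X.carrier (V.restrict B).carrier) :
    ∃ Y : FDRightModule K A, IsIndecomposableModule Aᵐᵒᵖ Y.carrier ∧
      IsModuleRetract Bᵐᵒᵖ X.carrier (Y.restrict B).carrier := by
  induction hn : Module.finrank K V.carrier using Nat.strong_induction_on generalizing V with
  | _ n ih =>
    subst hn
    by_cases hV : IsIndecomposableModule Aᵐᵒᵖ V.carrier
    · exact ⟨V, hV, h⟩
    have := hX.1
    have : Nontrivial V.carrier := h.nontrivial
    obtain ⟨V₁, V₂, h₁, h₂, p₁, q₁, p₂, q₂, hpq⟩ := V.exists_decomposition hV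
    rcases hX.isModuleRetract_or h (restrictMap B p₁) (restrictMap B q₁) (restrictMap B p₂)
      (restrictMap B q₂) hpq with h | h
    · exact ih _ h₁ V₁ h rfl
    · exact ih _ h₂ V₂ h rfl

theorem exists_finite_isModuleRetract (V : FDRightModule K A) :
    ∃ S : Set {M : FDRightModule K A // IsIndecomposableModule Aᵐᵒᵖ M.carrier}, S.Finite ∧
      ∀ X : {M : FDRightModule K A // IsIndecomposableModule Aᵐᵒᵖ M.carrier},
        IsModuleRetract Aᵐᵒᵖ X.1.carrier V.carrier →
          ∃ Y ∈ S, Nonempty (X.1.carrier ≃ₗ[Aᵐᵒᵖ] Y.1.carrier) := by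
  induction hn : Module.finrank K V.carrier using Nat.strong_induction_on generalizing V with
  | _ n ih =>
    subst hn
    by_cases hV : IsIndecomposableModule Aᵐᵒᵖ V.carrier
    · refine ⟨{⟨V, hV⟩}, Set.finite_singleton _, fun X hX => ⟨_, rfl, ?_⟩⟩
      have := X.2.1
      exact hV.nonempty_equiv_of_isModuleRetract hX
    rcases subsingleton_or_nontrivial V.carrier with hs | hs
    · refine ⟨∅, Set.finite_empty, fun X hX => ?_⟩
      have := X.2.1
      exact absurd hX.nontrivial (not_nontrivial _)
    obtain ⟨V₁, V₂, h₁, h₂, p₁, q₁, p₂, q₂, hpq⟩ := V.exists_decomposition hV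
    obtain ⟨S₁, hf₁, hS₁⟩ := ih _ h₁ V₁ rfl
    obtain ⟨S₂, hf₂, hS₂⟩ := ih _ h₂ V₂ rfl
    refine ⟨S₁ ∪ S₂, hf₁.union hf₂, fun X hX => ?_⟩
    rcases X.2.isModuleRetract_or hX p₁ q₁ p₂ q₂ hpq with h | h
    · obtain ⟨Y, hY, e⟩ := hS₁ X h
      exact ⟨Y, Or.inl hY, e⟩
    · obtain ⟨Y, hY, e⟩ := hS₂ X h
      exact ⟨Y, Or.inr hY, e⟩

section Coinduced

variable (B : Subalgebra K A) (X : FDRightModule K B)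

/-- The right `B`-linear maps from `A` to `X`. -/
def coinducedSubmodule : Submodule K (A →ₗ[K] X.carrier) where
  carrier := {f | ∀ (a : A) (b : B), f (a * b) = op b • f a}
  zero_mem' := by simp
  add_mem' hf hg a b := by simp [hf a b, hg a b]
  smul_mem' c f hf a b := by
    rw [LinearMap.smul_apply, LinearMap.smul_apply, hf a b]
    exact (smul_algebra_smul_comm c (op b) (f a)).symm

/-- `A` acts on the right of `Hom_B(A, X)` by left multiplication on the source. -/
instance : Module Aᵐᵒᵖ (coinducedSubmodule B X) where
  smul a f := ⟨f.1 ∘ₗ LinearMap.mulLeft K (unop a), fun a' b => by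
    simpa [mul_assoc] using f.2 (unop a * a') b⟩
  one_smul f := Subtype.ext <| LinearMap.ext fun x => congrArg f.1 (one_mul x)
  mul_smul a b f := Subtype.ext <| LinearMap.ext fun x =>
    congrArg f.1 (mul_assoc (unop b) (unop a) x)
  smul_zero _ := rfl
  smul_add _ _ _ := rfl
  add_smul a b f := Subtype.ext <| LinearMap.ext fun x =>
    (congrArg f.1 (add_mul (unop a) (unop b) x)).trans (map_add f.1 _ _)
  zero_smul f := Subtype.ext <| LinearMap.ext fun x =>
    (congrArg f.1 (zero_mul x)).trans (map_zero f.1)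

theorem coinducedSubmodule_smul_apply (a : Aᵐᵒᵖ) (f : coinducedSubmodule B X) (x : A) :
    (a • f).1 x = f.1 (unop a * x) := rfl

/-- The right `A`-module `Hom_B(A, X)` coinduced from a right `B`-module `X`. -/
def coinduced [FiniteDimensional K A] : FDRightModule K A where
  carrier := coinducedSubmodule B X
  isTower := ⟨fun k a f => Subtype.ext <| LinearMap.ext fun x => by
    rw [coinducedSubmodule_smul_apply, unop_smul, smul_mul_assoc, map_smul]
    rfl⟩

theorem isModuleRetract_coinduced [FiniteDimensional K A] (π : A →ₗ[K] B)
    (hl : ∀ (b : B) (a : A), π (b * a) = b * π a) (hr : ∀ (a : A) (b : B), π (a * b) = π a * b)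
    (h₁ : π 1 = 1) :
    IsModuleRetract Bᵐᵒᵖ X.carrier ((coinduced B X).restrict B).carrier := by
  let i (x : X.carrier) : coinducedSubmodule B X :=
    ⟨{ toFun := fun a => op (π a) • x
       map_add' := fun a a' => by rw [map_add, op_add, add_smul]
       map_smul' := fun k a => by rw [map_smul, op_smul, smul_assoc]; rfl },
      fun a b => by
        change op (π (a * b)) • x = op b • op (π a) • x
        rw [hr, op_mul, mul_smul]⟩
  refine ⟨
    { toFun := i
      map_add' := fun x y => Subtype.ext <| LinearMap.ext fun a => smul_add (op (π a)) x y
      map_smul' := fun b x => Subtype.ext <| LinearMap.ext fun a => ?_ },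
    { toFun := fun f : coinducedSubmodule B X => f.1 1
      map_add' := fun _ _ => rfl
      map_smul' := fun b f => ?_ }, LinearMap.ext fun x => ?_⟩
  · change op (π a) • b • x = op (π ((unop b : B) * a)) • x
    rw [hl, op_mul, mul_smul, op_unop]
  · change (f : coinducedSubmodule B X).1 ((unop b : B) * 1) = b • f.1 1
    have := f.2 1 (unop b)
    rwa [one_mul, ← mul_one ((unop b : B) : A)] at this
  · change op (π 1) • x = x
    rw [h₁, op_one, one_smul]

end Coinduced

end FDRightModule

/-- A complement of `B` in `A` as a bimodule gives a `B`-bilinear projection. -/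
theorem Subalgebra.exists_bimodule_projection {K A : Type} [Field K] [Ring A] [Algebra K A]
    (B : Subalgebra K A) (M : Submodule K A)
    (hlM : ∀ b ∈ B, ∀ m ∈ M, b * m ∈ M)
    (hrM : ∀ b ∈ B, ∀ m ∈ M, m * b ∈ M)
    (hcompl : IsCompl (Subalgebra.toSubmodule B) M) :
    ∃ π : A →ₗ[K] B, (∀ (b : B) (a : A), π (b * a) = b * π a) ∧
      (∀ (a : A) (b : B), π (a * b) = π a * b) ∧ π 1 = 1 := by
  let π : A →ₗ[K] B := (Subalgebra.toSubmodule B).projectionOnto M hcompl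
  have hB (b : B) : π b = b := Submodule.projectionOnto_apply_left hcompl b
  have hM {m : A} (hm : m ∈ M) : π m = 0 := Submodule.projectionOnto_apply_right hcompl ⟨m, hm⟩
  have hdec (a : A) : ∃ b : B, ∃ m ∈ M, (b : A) + m = a := by
    obtain ⟨b, hb, m, hm, h⟩ := Submodule.mem_sup.mp (hcompl.sup_eq_top ▸ Submodule.mem_top (x := a))
    exact ⟨⟨b, hb⟩, m, hm, h⟩
  refine ⟨π, fun b a => ?_, fun a b => ?_, hB 1⟩
  · obtain ⟨b', m, hm, rfl⟩ := hdec a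
    rw [mul_add, map_add, map_add, hB, hM hm, hM (hlM b b.2 m hm), ← B.coe_mul, hB, add_zero,
      add_zero]
  · obtain ⟨b', m, hm, rfl⟩ := hdec a
    rw [add_mul, map_add, map_add, hB, hM hm, hM (hrM b b.2 m hm), ← B.coe_mul, hB, add_zero,
      add_zero]

theorem finite_representation_type_of_bimodule_summand
    (K A : Type) [Field K] [Ring A] [Algebra K A] [FiniteDimensional K A]
    (B : Subalgebra K A) (M : Submodule K A)
    (hlM : ∀ b ∈ B, ∀ m ∈ M, b * m ∈ M)
    (hrM : ∀ b ∈ B, ∀ m ∈ M, m * b ∈ M)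
    (hcompl : IsCompl (Subalgebra.toSubmodule B) M)
    (hA : HasFiniteRepresentationType K A) :
    HasFiniteRepresentationType K B := by
  obtain ⟨π, hl, hr, h₁⟩ := B.exists_bimodule_projection M hlM hrM hcompl
  choose S hfin hS using fun V : FDRightModule K B => V.exists_finite_isModuleRetract
  have hA' : Finite _ := hA
  have hequiv : Equivalence
      fun M N : {M : FDRightModule K A // IsIndecomposableModule Aᵐᵒᵖ M.carrier} =>
        Nonempty (M.1.carrier ≃ₗ[Aᵐᵒᵖ] N.1.carrier) :=
    ⟨fun _ => ⟨LinearEquiv.refl _ _⟩, fun ⟨e⟩ => ⟨e.symm⟩, fun ⟨e⟩ ⟨e'⟩ => ⟨e.trans e'⟩⟩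
  refine Set.finite_univ_iff.mp <| (Set.finite_iUnion fun q : Quot
    fun M N : {M : FDRightModule K A // IsIndecomposableModule Aᵐᵒᵖ M.carrier} =>
      Nonempty (M.1.carrier ≃ₗ[Aᵐᵒᵖ] N.1.carrier) =>
    (hfin (q.out.1.restrict B)).image (Quot.mk _)).subset ?_
  rintro ⟨X⟩ -
  obtain ⟨Y, hY, hXY⟩ := X.1.exists_indecomposable_isModuleRetract X.2 _
    (X.1.isModuleRetract_coinduced B π hl hr h₁)
  let q := Quot.mk (fun M N : {M : FDRightModule K A // IsIndecomposableModule Aᵐᵒᵖ M.carrier} =>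
    Nonempty (M.1.carrier ≃ₗ[Aᵐᵒᵖ] N.1.carrier)) ⟨Y, hY⟩
  obtain ⟨e⟩ := hequiv.eqvGen_iff.mp (Quot.eqvGen_exact (Quot.out_eq q))
  have hq : IsModuleRetract Bᵐᵒᵖ (Y.restrict B).carrier (q.out.1.restrict B).carrier :=
    ⟨FDRightModule.restrictMap B e.symm.toLinearMap, FDRightModule.restrictMap B e.toLinearMap,
      LinearMap.ext e.apply_symm_apply⟩
  obtain ⟨Z, hZ, hXZ⟩ := hS _ X (hXY.trans hq)
  exact Set.mem_iUnion.mpr ⟨q, Z, hZ, (Quot.sound hXZ).symm⟩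
end

section
/- Let A be a finite-dimensional algebra over a field K which is a splitting field for A, and let P be an indecomposable projective right A-module. If the endomorphism algebra End_A(P) has infinite representation type, then A has infinite representation type. -/
/-- `K` is a splitting field for the `K`-algebra `A` if every `A`-endomorphism of every
simple right `A`-module is multiplication by a scalar from `K`. -/
def IsSplittingFieldFor (K A : Type) [Field K] [Ring A] [Algebra K A] : Prop :=
  ∀ (D : Type) [AddCommGroup D] [Module Aᵐᵒᵖ D], IsSimpleModule Aᵐᵒᵖ D →
    ∀ φ : D →ₗ[Aᵐᵒᵖ] D, ∃ c : K, ∀ x : D, φ x = algebraMap K Aᵐᵒᵖ c • x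

/-- Fitting's lemma for an endomorphism of finite rank. -/
theorem exists_pow_fitting {K V : Type*} [Field K] [AddCommGroup V] [Module K V]
    (v : Module.End K V) [FiniteDimensional K (LinearMap.range v)] :
    ∃ m : ℕ, 0 < m ∧ (∀ x, ∃ y, (v ^ m) x = (v ^ m) ((v ^ m) y)) ∧
      ∀ y, (v ^ m) ((v ^ m) y) = 0 → (v ^ m) y = 0 := by
  have hle : ∀ a b : ℕ, LinearMap.range (v ^ (a + b)) ≤ LinearMap.range (v ^ a) := by
    rintro a b _ ⟨x, rfl⟩
    exact ⟨(v ^ b) x, by rw [pow_add]; rfl⟩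
  have hfin : ∀ a : ℕ, FiniteDimensional K (LinearMap.range (v ^ (a + 1))) := fun a =>
    Submodule.finiteDimensional_of_le (S₂ := LinearMap.range v) (by
      have := hle 1 a
      rwa [add_comm, pow_one] at this)
  obtain ⟨m, hm⟩ : ∃ m : ℕ, ∀ n, Module.finrank K (LinearMap.range (v ^ (m + 1))) ≤
      Module.finrank K (LinearMap.range (v ^ (n + 1))) := by
    let d : ℕ → ℕ := fun n => Module.finrank K (LinearMap.range (v ^ (n + 1)))
    exact ⟨Function.argmin d, fun n => Function.argmin_le d n⟩
  have hfin' : FiniteDimensional K (LinearMap.range (v ^ ((m + 1) + (m + 1)))) :=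
    hfin (m + 1 + m)
  have := hfin m
  have hrank : Module.finrank K (LinearMap.range (v ^ (m + 1))) =
      Module.finrank K (LinearMap.range (v ^ ((m + 1) + (m + 1)))) :=
    le_antisymm (hm (m + 1 + m)) (Submodule.finrank_mono (hle _ _))
  have heq : LinearMap.range (v ^ ((m + 1) + (m + 1))) = LinearMap.range (v ^ (m + 1)) :=
    Submodule.eq_of_le_of_finrank_eq (hle _ _) hrank.symm
  refine ⟨m + 1, Nat.succ_pos m, fun x => ?_, fun y hy => ?_⟩
  · have hx : (v ^ (m + 1)) x ∈ LinearMap.range (v ^ ((m + 1) + (m + 1))) := by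
      rw [heq]; exact ⟨x, rfl⟩
    obtain ⟨y, hy⟩ := hx
    exact ⟨y, by rw [← hy, pow_add]; rfl⟩
  · let g : LinearMap.range (v ^ (m + 1)) →ₗ[K] LinearMap.range (v ^ ((m + 1) + (m + 1))) :=
      ((v ^ (m + 1)).comp (LinearMap.range (v ^ (m + 1))).subtype).codRestrict _ (by
        rintro ⟨_, ⟨x, rfl⟩⟩
        exact ⟨x, by rw [pow_add]; rfl⟩)
    have hsurj : Function.Surjective g := by
      rintro ⟨_, ⟨x, rfl⟩⟩
      refine ⟨⟨(v ^ (m + 1)) x, x, rfl⟩, Subtype.ext ?_⟩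
      change (v ^ (m + 1)) ((v ^ (m + 1)) x) = (v ^ ((m + 1) + (m + 1))) x
      rw [pow_add v (m + 1) (m + 1)]; rfl
    have hinj := (LinearMap.injective_iff_surjective_of_finrank_eq_finrank hrank).2 hsurj
    have h0 : (⟨(v ^ (m + 1)) y, y, rfl⟩ : LinearMap.range (v ^ (m + 1))) = 0 :=
      hinj (by rw [map_zero]; exact Subtype.ext hy)
    exact congrArg Subtype.val h0

/-- A finite-rank endomorphism of an indecomposable infinite-dimensional module is nilpotent. -/
theorem IsIndecomposableModule.isNilpotent_or_finite {K R P : Type*} [Field K] [Ring R]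
    [Algebra K R] [AddCommGroup P] [Module K P] [Module R P] [IsScalarTower K R P]
    (hindec : IsIndecomposableModule R P) (v : Module.End R P)
    [FiniteDimensional K (LinearMap.range (v.restrictScalars K))] :
    IsNilpotent v ∨ FiniteDimensional K P := by
  obtain ⟨m, hm, hsurj, hinj⟩ := exists_pow_fitting (v.restrictScalars K)
  have hpow : ∀ x, ((v.restrictScalars K) ^ m) x = (v ^ m) x := fun x => by
    rw [Module.End.pow_apply, Module.End.pow_apply]; rfl
  simp only [hpow] at hsurj hinj
  have hcompl : IsCompl (LinearMap.ker (v ^ m)) (LinearMap.range (v ^ m)) := by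
    constructor
    · rw [Submodule.disjoint_def]
      rintro _ hx ⟨y, rfl⟩
      exact hinj y hx
    · rw [codisjoint_iff, eq_top_iff]
      intro x _
      obtain ⟨y, hy⟩ := hsurj x
      refine Submodule.mem_sup.2 ⟨x - (v ^ m) y, ?_, (v ^ m) y, ⟨y, rfl⟩, by abel⟩
      rw [LinearMap.mem_ker, map_sub, hy, sub_self]
  rcases hindec.2 _ _ hcompl with h | h
  · right
    obtain ⟨k, rfl⟩ : ∃ k, m = k + 1 := ⟨m - 1, by omega⟩
    have hvinj : Function.Injective (v.restrictScalars K).rangeRestrict := by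
      rw [injective_iff_map_eq_zero]
      intro x hx
      have hvx : v x = 0 := congrArg Subtype.val hx
      have : x ∈ LinearMap.ker (v ^ (k + 1)) := by
        rw [LinearMap.mem_ker, pow_succ, Module.End.mul_apply, hvx, map_zero]
      rwa [h, Submodule.mem_bot] at this
    exact FiniteDimensional.of_injective _ hvinj
  · left
    exact ⟨m, LinearMap.range_eq_bot.1 h⟩

/-- An indecomposable projective module over a finite-dimensional algebra is
finite-dimensional. -/
theorem IsIndecomposableModule.finiteDimensional_of_projective {K R P : Type*} [Field K] [Ring R]
    [Algebra K R] [FiniteDimensional K R] [AddCommGroup P] [Module K P] [Module R P]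
    [IsScalarTower K R P] [Module.Projective R P] (hindec : IsIndecomposableModule R P) :
    FiniteDimensional K P := by
  by_contra hP
  have hnil : ∀ (f : P →ₗ[R] R) (p : P), IsNilpotent (f p) := by
    intro f p
    let v : Module.End R P := (LinearMap.toSpanSingleton R P p).comp f
    have : FiniteDimensional K (LinearMap.range (v.restrictScalars K)) := by
      refine Submodule.finiteDimensional_of_le
        (S₂ := LinearMap.range ((LinearMap.toSpanSingleton R P p).restrictScalars K)) ?_
      rintro _ ⟨x, rfl⟩
      exact ⟨f x, rfl⟩
    obtain ⟨n, hn⟩ := (hindec.isNilpotent_or_finite (K := K) v).resolve_right hP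
    have key : ∀ (k : ℕ) (x : P), f ((v ^ k) x) = f x * f p ^ k := by
      intro k
      induction k with
      | zero => intro x; simp
      | succ k ih =>
        intro x
        rw [pow_succ, Module.End.mul_apply, ih]
        simp [v, pow_succ', mul_assoc]
    refine ⟨n + 1, ?_⟩
    rw [pow_succ', ← key, hn, LinearMap.zero_apply, map_zero]
  have hjac : ∀ (f : P →ₗ[R] R) (p : P), f p ∈ Ring.jacobson R := by
    intro f p
    rw [← Ideal.jacobson_bot, Ideal.mem_jacobson_iff]
    intro y
    have hu : IsUnit (1 + y * f p) := by
      have := hnil f (y • p)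
      rw [map_smul, smul_eq_mul] at this
      exact this.isUnit_one_add
    obtain ⟨z, hz⟩ := hu.exists_left_inv
    refine ⟨z, ?_⟩
    rw [Submodule.mem_bot, ← sub_eq_zero.2 hz]
    noncomm_ring
  obtain ⟨s, hs⟩ := Module.projective_def'.1 (inferInstance : Module.Projective R P)
  have htop : Ring.jacobson R • (⊤ : Submodule R P) = ⊤ := by
    rw [eq_top_iff]
    intro x _
    have hx : Finsupp.linearCombination R id (s x) = x := LinearMap.congr_fun hs x
    rw [← hx, Finsupp.linearCombination_apply]
    exact Submodule.sum_mem _ fun q _ =>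
      Submodule.smul_mem_smul (hjac ((Finsupp.lapply q).comp s) x) Submodule.mem_top
  have hpow : ∀ n : ℕ, (Ring.jacobson R) ^ n • (⊤ : Submodule R P) = ⊤ := by
    intro n
    induction n with
    | zero => simp [Submodule.pow_zero]
    | succ n ih => rw [Submodule.pow_succ, Submodule.mul_smul, htop, ih]
  have : IsArtinianRing R := IsArtinianRing.of_finite K R
  obtain ⟨n, hn⟩ := IsSemiprimaryRing.isNilpotent (R := R)
  have hbot := hpow n
  rw [hn, Submodule.zero_eq_bot, Submodule.bot_smul] at hbot
  have := hindec.1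
  exact bot_ne_top hbot

/-- A direct summand `X` of a quotient of a finite power of `P` vanishes as soon as every map from
`P` with range in `X` is zero. -/
theorem eq_bot_of_forall_range_le {R P M : Type*} [Ring R] [AddCommGroup P] [Module R P]
    [AddCommGroup M] [Module R M] {ι : Type*} [Finite ι]
    (q : (ι → P) →ₗ[R] M) (hq : Function.Surjective q) {X Y : Submodule R M} (h : IsCompl X Y)
    (hX : ∀ φ : P →ₗ[R] M, LinearMap.range φ ≤ X → φ = 0) : X = ⊥ := by
  classical
  rw [eq_bot_iff]
  intro x hx
  have h0 : (X.projection Y h).comp q = 0 := by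
    refine LinearMap.pi_ext' fun i => ?_
    rw [LinearMap.zero_comp]
    refine hX _ ?_
    rintro _ ⟨p, rfl⟩
    exact Submodule.projection_apply_mem h _
  obtain ⟨y, rfl⟩ := hq x
  have := LinearMap.congr_fun h0 y
  rw [LinearMap.comp_apply, Submodule.projection_apply_of_mem_left h hx] at this
  exact this

/-- Over a finitely generated projective module `P`, every finitely generated right module over
`Module.End R P` is isomorphic to `Hom(P, M)` for a quotient `M` of a finite power of `P`. -/
theorem exists_quotient_pi_hom_equiv {R P N : Type*} [Ring R] [AddCommGroup P] [Module R P]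
    [Module.Projective R P] [Module.Finite R P] [AddCommGroup N]
    [Module (Module.End R P)ᵐᵒᵖ N] [Module.Finite (Module.End R P)ᵐᵒᵖ N] :
    ∃ (n : ℕ) (S : Submodule R (Fin n → P)) (τ : (P →ₗ[R] (Fin n → P) ⧸ S) ≃+ N),
      ∀ (φ : P →ₗ[R] (Fin n → P) ⧸ S) (g : Module.End R P),
        τ (φ.comp g) = MulOpposite.op g • τ φ := by
  classical
  obtain ⟨n, s, hs⟩ := Module.Finite.exists_fin (R := (Module.End R P)ᵐᵒᵖ) (M := N)
  let ρ : (P →ₗ[R] (Fin n → P)) →+ N :=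
    { toFun := fun φ => ∑ i, MulOpposite.op ((LinearMap.proj i).comp φ : Module.End R P) • s i
      map_zero' := by simp
      map_add' := fun φ ψ => by
        rw [← Finset.sum_add_distrib]
        refine Finset.sum_congr rfl fun i _ => ?_
        rw [LinearMap.comp_add, MulOpposite.op_add, add_smul] }
  have hρ : ∀ (φ : P →ₗ[R] (Fin n → P)) (g : Module.End R P),
      ρ (φ.comp g) = MulOpposite.op g • ρ φ := by
    intro φ g
    change ∑ i, MulOpposite.op ((LinearMap.proj i).comp (φ.comp g) : Module.End R P) • s i =
      MulOpposite.op g • ∑ i, MulOpposite.op ((LinearMap.proj i).comp φ : Module.End R P) • s i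
    rw [Finset.smul_sum]
    refine Finset.sum_congr rfl fun i _ => ?_
    rw [smul_smul, ← MulOpposite.op_mul]
    rfl
  have hρs : Function.Surjective ρ := by
    intro x
    have hx : x ∈ Submodule.span (Module.End R P)ᵐᵒᵖ (Set.range s) := hs ▸ Submodule.mem_top
    obtain ⟨c, hc⟩ := (Submodule.mem_span_range_iff_exists_fun _).1 hx
    exact ⟨LinearMap.pi fun i => (c i).unop, hc⟩
  let S : Submodule R (Fin n → P) := ⨆ k : ρ.ker, LinearMap.range k.1
  let π : (P →ₗ[R] (Fin n → P)) →+ (P →ₗ[R] (Fin n → P) ⧸ S) :=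
    { toFun := fun φ => S.mkQ.comp φ
      map_zero' := LinearMap.comp_zero _
      map_add' := fun φ ψ => LinearMap.comp_add _ _ _ }
  have hπs : Function.Surjective π := fun φ =>
    Module.projective_lifting_property S.mkQ φ S.mkQ_surjective
  have hker : π.ker = ρ.ker := by
    ext φ
    have h1 : φ ∈ π.ker ↔ LinearMap.range φ ≤ S := by
      have h2 := LinearMap.range_le_ker_iff (f := φ) (g := S.mkQ)
      rw [Submodule.ker_mkQ] at h2
      exact h2.symm
    rw [h1]
    refine ⟨fun h => ?_, fun h => le_iSup (fun k : ρ.ker => LinearMap.range k.1) ⟨φ, h⟩⟩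
    have hfg : (LinearMap.range φ).FG := Module.Finite.iff_fg.1 inferInstance
    obtain ⟨t, ht⟩ := CompleteLattice.IsCompactElement.exists_finset_of_le_iSup _
      ((Submodule.fg_iff_compact _).1 hfg) _ h
    let Ψ : (t → P) →ₗ[R] (Fin n → P) := ∑ k : t, (k.1.1).comp (LinearMap.proj k)
    have hΨ : LinearMap.range φ ≤ LinearMap.range Ψ := by
      refine ht.trans (iSup₂_le fun k hk => ?_)
      rintro _ ⟨x, rfl⟩
      refine ⟨Pi.single ⟨k, hk⟩ x, ?_⟩
      simp only [Ψ, LinearMap.sum_apply, LinearMap.comp_apply, LinearMap.proj_apply]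
      rw [Finset.sum_eq_single ⟨k, hk⟩]
      · simp
      · intro j _ hj
        simp [Pi.single_eq_of_ne hj]
      · simp
    obtain ⟨h', hh'⟩ := Module.projective_lifting_property Ψ.rangeRestrict
      (φ.codRestrict (LinearMap.range Ψ) fun x => hΨ ⟨x, rfl⟩) Ψ.surjective_rangeRestrict
    have hφ : φ = ∑ k : t, (k.1.1).comp ((LinearMap.proj k).comp h' : Module.End R P) := by
      ext1 x
      have := congrArg Subtype.val (LinearMap.congr_fun hh' x)
      change Ψ (h' x) = φ x at this
      rw [← this]
      simp [Ψ]
    rw [AddMonoidHom.mem_ker, hφ, map_sum]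
    refine Finset.sum_eq_zero fun k _ => ?_
    rw [hρ, AddMonoidHom.mem_ker.1 k.1.2, smul_zero]
  let τ : (P →ₗ[R] (Fin n → P) ⧸ S) ≃+ N :=
    ((QuotientAddGroup.quotientKerEquivOfSurjective π hπs).symm.trans
      (QuotientAddGroup.quotientAddEquivOfEq hker)).trans
      (QuotientAddGroup.quotientKerEquivOfSurjective ρ hρs)
  have hτ : ∀ φ, τ (π φ) = ρ φ := by
    intro φ
    have : (QuotientAddGroup.quotientKerEquivOfSurjective π hπs).symm (π φ) =
        QuotientAddGroup.mk φ := by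
      rw [AddEquiv.symm_apply_eq]; rfl
    simp only [τ, AddEquiv.trans_apply, this]
    rfl
  refine ⟨n, S, τ, fun φ g => ?_⟩
  obtain ⟨φ, rfl⟩ := hπs φ
  have : (π φ).comp g = π (φ.comp g) := rfl
  rw [this, hτ, hτ, hρ]

/-- If `Hom(P, M)` is an indecomposable right module over `Module.End R P` and `M` is a quotient of
a finite power of `P`, then `M` is indecomposable. -/
theorem isIndecomposableModule_of_hom_equiv {R P M N : Type*} [Ring R] [AddCommGroup P] [Module R P]
    [AddCommGroup M] [Module R M] [AddCommGroup N] [Module (Module.End R P)ᵐᵒᵖ N]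
    {ι : Type*} [Finite ι] (q : (ι → P) →ₗ[R] M) (hq : Function.Surjective q)
    (τ : (P →ₗ[R] M) ≃+ N)
    (hτ : ∀ (φ : P →ₗ[R] M) (g : Module.End R P), τ (φ.comp g) = MulOpposite.op g • τ φ)
    (hN : IsIndecomposableModule (Module.End R P)ᵐᵒᵖ N) : IsIndecomposableModule R M := by
  refine ⟨?_, fun X Y hXY => ?_⟩
  · by_contra hM
    rw [not_nontrivial_iff_subsingleton] at hM
    have := hN.1
    have : Subsingleton N := τ.symm.injective.subsingleton
    exact not_subsingleton N this
  · let H : Submodule R M → Submodule (Module.End R P)ᵐᵒᵖ N := fun X =>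
      { carrier := {x | LinearMap.range (τ.symm x) ≤ X}
        zero_mem' := by simp
        add_mem' := by
          rintro a b ha hb _ ⟨x, rfl⟩
          rw [map_add]
          exact X.add_mem (ha ⟨x, rfl⟩) (hb ⟨x, rfl⟩)
        smul_mem' := by
          rintro c a ha _ ⟨x, rfl⟩
          have : τ.symm (c • a) = (τ.symm a).comp c.unop := by
            rw [AddEquiv.symm_apply_eq, hτ, AddEquiv.apply_symm_apply, MulOpposite.op_unop]
          rw [this]
          exact ha ⟨c.unop x, rfl⟩ }
    have hH : ∀ X, H X = ⊥ → ∀ φ : P →ₗ[R] M, LinearMap.range φ ≤ X → φ = 0 := by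
      intro X hX φ hφ
      have : τ φ ∈ H X := by
        change LinearMap.range (τ.symm (τ φ)) ≤ X
        rwa [AddEquiv.symm_apply_apply]
      rwa [hX, Submodule.mem_bot, map_eq_zero_iff τ τ.injective] at this
    have hcompl : IsCompl (H X) (H Y) := by
      constructor
      · rw [Submodule.disjoint_def]
        intro x hx hy
        rw [← map_eq_zero_iff τ.symm τ.symm.injective]
        ext p
        exact Submodule.disjoint_def.1 hXY.disjoint _ (hx ⟨p, rfl⟩) (hy ⟨p, rfl⟩)
      · rw [codisjoint_iff, eq_top_iff]
        intro x _
        refine Submodule.mem_sup.2 ⟨τ ((X.projection Y hXY).comp (τ.symm x)), ?_,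
          τ ((Y.projection X hXY.symm).comp (τ.symm x)), ?_, ?_⟩
        · change LinearMap.range (τ.symm (τ _)) ≤ X
          rw [AddEquiv.symm_apply_apply]
          rintro _ ⟨p, rfl⟩
          exact Submodule.projection_apply_mem hXY _
        · change LinearMap.range (τ.symm (τ _)) ≤ Y
          rw [AddEquiv.symm_apply_apply]
          rintro _ ⟨p, rfl⟩
          exact Submodule.projection_apply_mem hXY.symm _
        · rw [← map_add, ← LinearMap.add_comp, Submodule.projection_add_projection_eq_id,
            LinearMap.id_comp, AddEquiv.apply_symm_apply]
    rcases hN.2 _ _ hcompl with h | h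
    · exact Or.inl (eq_bot_of_forall_range_le q hq hXY (hH X h))
    · exact Or.inr (eq_bot_of_forall_range_le q hq hXY.symm (hH Y h))

theorem infinite_representation_type_of_end_of_projective
    (K A : Type) [Field K] [Ring A] [Algebra K A] [FiniteDimensional K A]
    (hsplit : IsSplittingFieldFor K A)
    (P : Type) [AddCommGroup P] [Module K P] [Module Aᵐᵒᵖ P] [IsScalarTower K Aᵐᵒᵖ P]
    (hproj : Module.Projective Aᵐᵒᵖ P)
    (hindec : IsIndecomposableModule Aᵐᵒᵖ P)
    (hEnd : ¬ HasFiniteRepresentationType K (Module.End Aᵐᵒᵖ P)) :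
    ¬ HasFiniteRepresentationType K A := by
  intro hA
  apply hEnd
  have hP : FiniteDimensional K P := hindec.finiteDimensional_of_projective
  have hP' : Module.Finite Aᵐᵒᵖ P := Module.Finite.of_restrictScalars_finite K Aᵐᵒᵖ P
  have key : ∀ N : {N : FDRightModule K (Module.End Aᵐᵒᵖ P) //
      IsIndecomposableModule (Module.End Aᵐᵒᵖ P)ᵐᵒᵖ N.carrier},
      ∃ (M : {M : FDRightModule K A // IsIndecomposableModule Aᵐᵒᵖ M.carrier})
        (τ : (P →ₗ[Aᵐᵒᵖ] M.1.carrier) ≃+ N.1.carrier),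
        ∀ (φ : P →ₗ[Aᵐᵒᵖ] M.1.carrier) (g : Module.End Aᵐᵒᵖ P),
          τ (φ.comp g) = MulOpposite.op g • τ φ := by
    rintro ⟨N, hN⟩
    have : Module.Finite (Module.End Aᵐᵒᵖ P)ᵐᵒᵖ N.carrier :=
      Module.Finite.of_restrictScalars_finite K _ _
    obtain ⟨n, S, τ, hτ⟩ := exists_quotient_pi_hom_equiv (R := Aᵐᵒᵖ) (P := P) (N := N.carrier)
    have hfin : FiniteDimensional K ((Fin n → P) ⧸ S) :=
      Module.Finite.of_surjective (S.mkQ.restrictScalars K) S.mkQ_surjective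
    exact ⟨⟨⟨(Fin n → P) ⧸ S⟩,
      isIndecomposableModule_of_hom_equiv S.mkQ S.mkQ_surjective τ hτ hN⟩, τ, hτ⟩
  choose F τ hτ using key
  have hequiv : Equivalence
      fun M N : {M : FDRightModule K A // IsIndecomposableModule Aᵐᵒᵖ M.carrier} =>
        Nonempty (M.1.carrier ≃ₗ[Aᵐᵒᵖ] N.1.carrier) :=
    ⟨fun _ => ⟨LinearEquiv.refl _ _⟩, fun ⟨e⟩ => ⟨e.symm⟩, fun ⟨e⟩ ⟨f⟩ => ⟨e.trans f⟩⟩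
  refine @Finite.of_injective _ _ hA (fun q => Quot.mk _ (F q.out)) fun a b hab => ?_
  obtain ⟨θ⟩ := (hequiv.quot_mk_eq_iff _ _).1 hab
  rw [← Quot.out_eq a, ← Quot.out_eq b]
  apply Quot.sound
  let σ : (P →ₗ[Aᵐᵒᵖ] (F a.out).1.carrier) ≃+ (P →ₗ[Aᵐᵒᵖ] (F b.out).1.carrier) :=
    { toFun := fun φ => θ.toLinearMap.comp φ
      invFun := fun φ => θ.symm.toLinearMap.comp φ
      left_inv := fun φ => by ext; simp
      right_inv := fun φ => by ext; simp
      map_add' := fun φ ψ => LinearMap.comp_add _ _ _ }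
  have hσ : ∀ φ (g : Module.End Aᵐᵒᵖ P), σ (φ.comp g) = (σ φ).comp g := fun _ _ => rfl
  refine ⟨{ ((τ a.out).symm.trans σ).trans (τ b.out) with map_smul' := fun c x => ?_ }⟩
  obtain ⟨φ, rfl⟩ := (τ a.out).surjective x
  have hc : c • τ a.out φ = τ a.out (φ.comp c.unop) := by
    rw [hτ, MulOpposite.op_unop]
  change τ b.out (σ ((τ a.out).symm (c • τ a.out φ))) =
    c • τ b.out (σ ((τ a.out).symm (τ a.out φ)))
  rw [hc, AddEquiv.symm_apply_apply, AddEquiv.symm_apply_apply, hσ, hτ, MulOpposite.op_unop]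
end
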